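/- arXiv:math/0406405 — 2 statements merged into one kernel-verified Lean document; each statement's English description precedes it below -/
import Mathlib

section
/- Let J be a Lie algebra over a field, equipped with an exhaustive increasing filtration by submodules F₀J ⊆ F₁J ⊆ … compatible with the bracket ([FₘJ, FₙJ] ⊆ Fₘ₊ₙJ), such that the associated graded Lie algebra gr(J) = ⊕ₖ FₖJ/Fₖ₋₁J is a free Lie algebra. Then J itself is a free Lie algebra. -/
namespace FreeLift

attribute [local instance] LieRing.ofAssociativeRing

/-! ### A relative Poincare-Birkhoff-Witt theorem -/
namespace PBW

section
variable {C : Type} [LinearOrder C] {D : Type} {F : Type} [Field F]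
  {L : Type} [LieRing L] [LieAlgebra F L]

/-- sorted lists -/
abbrev SL (C : Type) [LinearOrder C] := {l : List C // l.Pairwise (· ≤ ·)}

open Classical in
/-- put a letter in front of a sorted list -/
noncomputable def cns (F : Type) [Field F] (c : C) (s : SL C) : SL C →₀ F :=
  if h : (c :: s.1).Pairwise (· ≤ ·) then Finsupp.single ⟨c :: s.1, h⟩ 1 else 0

noncomputable def cnsI (F : Type) [Field F] (i : C ⊕ D) (s : SL C) : SL C →₀ F :=
  match i with
  | Sum.inl c => cns F c s
  | Sum.inr _ => 0

def small (i : C ⊕ D) (s : SL C) : Prop := ∃ c, i = Sum.inl c ∧ ∀ z ∈ s.1, c ≤ z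

open Classical in
noncomputable def act (b : Module.Basis (C ⊕ D) F L) (i : C ⊕ D) (s : SL C) : SL C →₀ F :=
  match s with
  | ⟨[], h⟩ => cnsI F i ⟨[], h⟩
  | ⟨y :: l, h⟩ =>
    if small i ⟨y :: l, h⟩ then cnsI F i ⟨y :: l, h⟩ else
      ((act b i ⟨l, (List.pairwise_cons.1 h).2⟩).sum fun s r =>
        r • (if s.1.length < l.length + 1 then act b (Sum.inl y) s else cns F y s)) +
      ((b.repr ⁅b i, b (Sum.inl y)⁆).sum fun k r => r • act b k ⟨l, (List.pairwise_cons.1 h).2⟩)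
termination_by s.1.length
decreasing_by all_goals simp_all

/-- bilinear extension -/
noncomputable def X (b : Module.Basis (C ⊕ D) F L) : L →ₗ[F] (SL C →₀ F) →ₗ[F] (SL C →₀ F) :=
  b.constr F fun i => Finsupp.linearCombination F (act b i)

variable (b : Module.Basis (C ⊕ D) F L)

lemma X_basis (i : C ⊕ D) (v : SL C →₀ F) :
    X b (b i) v = Finsupp.linearCombination F (act b i) v := by
  simp [X]

lemma X_single (i : C ⊕ D) (s : SL C) : X b (b i) (Finsupp.single s 1) = act b i s := by
  simp [X_basis]

lemma X_repr (x : L) (s : SL C) :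
    X b x (Finsupp.single s 1) = (b.repr x).sum fun k r => r • act b k s := by
  conv_lhs => rw [← b.linearCombination_repr x]
  simp only [Finsupp.linearCombination_apply, Finsupp.sum, map_sum, map_smul,
    LinearMap.sum_apply, LinearMap.smul_apply, X_single]

/-- lists of length at most n -/
noncomputable def V (F : Type) [Field F] (C : Type) [LinearOrder C] (n : ℕ) :
    Submodule F (SL C →₀ F) :=
  Finsupp.supported F F {s : SL C | s.1.length ≤ n}

lemma V_mono {m n : ℕ} (h : m ≤ n) : V F C m ≤ V F C n :=
  Finsupp.supported_mono fun _ hs => le_trans hs h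

lemma single_mem_V {s : SL C} {n : ℕ} (h : s.1.length ≤ n) (r : F) : Finsupp.single s r ∈ V F C n :=
  Finsupp.single_mem_supported F r h

def insS (c : C) (s : SL C) : SL C := ⟨s.1.orderedInsert (· ≤ ·) c, s.2.orderedInsert c s.1⟩

noncomputable def ins (F : Type) [Field F] (i : C ⊕ D) (s : SL C) : SL C →₀ F :=
  match i with
  | Sum.inl c => Finsupp.single (insS c s) 1
  | Sum.inr _ => 0

lemma length_insS (c : C) (s : SL C) : (insS c s).1.length = s.1.length + 1 := by
  simp [insS, List.orderedInsert_length]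

lemma cns_of_le (c : C) (s : SL C) (h : ∀ z ∈ s.1, c ≤ z) :
    cns F c s = Finsupp.single (insS c s) 1 := by
  have h1 : (c :: s.1).Pairwise (· ≤ ·) := List.pairwise_cons.2 ⟨h, s.2⟩
  rw [cns, dif_pos h1]
  congr 2
  rcases hs : s.1 with _ | ⟨y, l⟩
  · simp
  · rw [List.orderedInsert_cons_of_le]
    exact h y (by simp [hs])

lemma act_small {i : C ⊕ D} {s : SL C} (h : small i s) : act b i s = ins F i s := by
  obtain ⟨c, rfl, hc⟩ := h
  obtain ⟨l, hl⟩ := s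
  rcases l with _ | ⟨y, l⟩
  · rw [act]; exact cns_of_le c _ hc
  · rw [act, if_pos ⟨c, rfl, hc⟩]; exact cns_of_le c _ hc

lemma ins_mem (i : C ⊕ D) (s : SL C) : ins F i s ∈ V F C (s.1.length + 1) := by
  rcases i with c | d
  · exact single_mem_V (length_insS c s).le _
  · exact Submodule.zero_mem _

lemma not_small_cons {i : C ⊕ D} {y : C} {l : List C} {h} (hn : ¬ small i (⟨y :: l, h⟩ : SL C)) :
    (∃ c, i = Sum.inl c ∧ y < c) ∨ ∃ d, i = Sum.inr d := by
  rcases i with c | d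
  · left
    refine ⟨c, rfl, ?_⟩
    by_contra hc
    refine hn ⟨c, rfl, fun z hz => ?_⟩
    rcases List.mem_cons.1 hz with rfl | hz
    · exact not_lt.1 hc
    · exact (not_lt.1 hc).trans ((List.pairwise_cons.1 h).1 z hz)
  · right; exact ⟨d, rfl⟩

lemma insS_cons {c y : C} {l : List C} {h} (hy : y < c) :
    insS c (⟨y :: l, h⟩ : SL C) = insS y (insS c ⟨l, (List.pairwise_cons.1 h).2⟩) := by
  apply Subtype.ext
  have h1 := (insS y (insS c ⟨l, (List.pairwise_cons.1 h).2⟩)).2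
  simp only [insS] at *
  rw [List.orderedInsert_cons, if_neg (not_le.2 hy)]
  rcases hl : List.orderedInsert (· ≤ ·) c l with _ | ⟨z, l'⟩
  · simp
  · rw [List.orderedInsert_cons_of_le]
    have : z ∈ List.orderedInsert (· ≤ ·) c l := by simp [hl]
    rcases (List.mem_orderedInsert _).1 this with rfl | hz
    · exact hy.le
    · exact (List.pairwise_cons.1 h).1 z hz

lemma le_insS {c y : C} {l : List C} {h : (y :: l).Pairwise (· ≤ ·)} (hy : y < c) :
    ∀ z ∈ (insS c (⟨l, (List.pairwise_cons.1 h).2⟩ : SL C)).1, y ≤ z := by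
  intro z hz
  rcases (List.mem_orderedInsert _).1 hz with rfl | hz
  · exact hy.le
  · exact (List.pairwise_cons.1 h).1 z hz

lemma lc_mem {g : SL C → (SL C →₀ F)} {m n : ℕ} (hg : ∀ s : SL C, s.1.length ≤ n → g s ∈ V F C m)
    {v : SL C →₀ F} (hv : v ∈ V F C n) : Finsupp.linearCombination F g v ∈ V F C m := by
  rw [Finsupp.linearCombination_apply]
  exact Submodule.sum_mem _ fun s hs => Submodule.smul_mem _ _ (hg s (hv hs))

lemma act_deg (n : ℕ) : ∀ (i : C ⊕ D) (s : SL C), s.1.length = n →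
    act b i s - ins F i s ∈ V F C n := by
  induction n using Nat.strong_induction_on with
  | _ n ih =>
  intro i s hs
  have full : ∀ (i : C ⊕ D) (s : SL C), s.1.length < n → act b i s ∈ V F C (s.1.length + 1) := by
    intro i s h
    have := Submodule.add_mem _ (V_mono (Nat.le_succ _) (ih _ h i s rfl)) (ins_mem (F := F) i s)
    simpa using this
  obtain ⟨l, hl⟩ := s
  by_cases hsm : small i ⟨l, hl⟩
  · rw [act_small b hsm]; simp
  rcases l with _ | ⟨y, l⟩
  · rcases i with c | d
    · exact absurd ⟨c, rfl, by simp⟩ hsm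
    · rw [act]; simp [cnsI, ins]
  · simp only [List.length_cons] at hs
    rw [act, if_neg hsm]
    set s' : SL C := ⟨l, (List.pairwise_cons.1 hl).2⟩ with hs'
    set g : SL C → (SL C →₀ F) := fun s => if s.1.length < l.length + 1 then act b (Sum.inl y) s
      else cns F y s with hg
    have e1 : ((act b i s').sum fun s r => r • g s) = Finsupp.linearCombination F g (act b i s') :=
      (Finsupp.linearCombination_apply _ _).symm
    have e2 : Finsupp.linearCombination F g (ins F i s') = ins F i ⟨y :: l, hl⟩ := by
      rcases not_small_cons hsm with ⟨c, rfl, hc⟩ | ⟨d, rfl⟩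
      · simp only [ins, Finsupp.linearCombination_single, one_smul]
        rw [hg]
        simp only
        rw [if_neg (by rw [length_insS]; simp [hs']), cns_of_le y _ (le_insS (h := hl) hc), insS_cons hc]
      · simp [ins]
    have e3 := lc_mem (g := g) (m := n) (n := l.length) (by
      intro s hsl
      rw [hg]; simp only
      rw [if_pos (by omega)]
      exact V_mono (by omega) (full _ s (by omega))) (ih l.length (by omega) i s' rfl)
    rw [map_sub, e2] at e3
    rw [e1, add_sub_right_comm]
    refine Submodule.add_mem _ e3 ?_
    exact Submodule.sum_mem _ fun k _ => Submodule.smul_mem _ _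
      (V_mono (by simp [hs']; omega) (full k s' (by simp [hs']; omega)))

lemma act_rec {i : C ⊕ D} {y : C} {l : List C} {h} (hn : ¬ small i (⟨y :: l, h⟩ : SL C)) :
    act b i ⟨y :: l, h⟩ =
      X b (b (Sum.inl y)) (act b i ⟨l, (List.pairwise_cons.1 h).2⟩) +
      X b ⁅b i, b (Sum.inl y)⁆ (Finsupp.single ⟨l, (List.pairwise_cons.1 h).2⟩ 1) := by
  rw [act, if_neg hn, X_repr]
  congr 1
  set s' : SL C := ⟨l, (List.pairwise_cons.1 h).2⟩ with hs'
  rw [X_basis]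
  have hd := act_deg b _ i s' rfl
  rw [Finsupp.linearCombination_apply]
  refine Finsupp.sum_congr fun s hs => ?_
  split_ifs with hlen
  · rfl
  · have h1 : s ∉ (act b i s' - ins F i s').support := by
      intro h2
      have := hd h2
      simp [hs'] at this
      omega
    have h2 : ins F i s' s ≠ 0 := by
      rw [Finsupp.notMem_support_iff, Finsupp.sub_apply, sub_eq_zero] at h1
      rw [← h1]; exact Finsupp.mem_support_iff.1 hs
    rcases not_small_cons hn with ⟨c, rfl, hc⟩ | ⟨d, rfl⟩
    · have : s = insS c s' := by
        by_contra hne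
        exact h2 (by simp [ins, Ne.symm hne])
      subst this
      rw [act_small b ⟨y, rfl, le_insS (h := h) hc⟩, cns_of_le y _ (le_insS (h := h) hc)]; rfl
    · simp [ins] at h2

/-- the commutation relation on v -/
def Rel (x y : L) (v : SL C →₀ F) : Prop := X b x (X b y v) - X b y (X b x v) = X b ⁅x, y⁆ v

lemma Rel.symm {x y : L} {v : SL C →₀ F} (h : Rel b x y v) : Rel b y x v := by
  unfold Rel at *
  rw [← lie_skew, map_neg, LinearMap.neg_apply, ← h, neg_sub]

lemma Rel.add {x y : L} {v w : SL C →₀ F} (h : Rel b x y v) (h' : Rel b x y w) :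
    Rel b x y (v + w) := by
  unfold Rel at *
  simp only [map_add, ← h, ← h']; abel

lemma Rel.smul {x y : L} {v : SL C →₀ F} (r : F) (h : Rel b x y v) : Rel b x y (r • v) := by
  unfold Rel at *
  simp only [map_smul, ← h, smul_sub]

lemma Rel.zero (x y : L) : Rel b x y (0 : SL C →₀ F) := by simp [Rel]

lemma Rel.of_basis {v : SL C →₀ F} (h : ∀ i j, Rel b (b i) (b j) v) (x y : L) : Rel b x y v := by
  have h1 : ∀ i, Rel b (b i) y v := by
    intro i
    have : (X b (b i)).comp ((X b).flip v) - (X b).flip (X b (b i) v) =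
        ((X b).flip v).comp ((LieModule.toEnd F L L (b i))) := by
      refine b.ext fun j => ?_
      simpa [Rel] using h i j
    simpa [Rel] using LinearMap.congr_fun this y
  have : (X b).flip (X b y v) - (X b y).comp ((X b).flip v) =
        -((X b).flip v).comp ((LieModule.toEnd F L L y)) := by
      refine b.ext fun j => ?_
      have := h1 j
      unfold Rel at this
      simp only [LinearMap.sub_apply, LinearMap.flip_apply, LinearMap.comp_apply, this,
        LinearMap.neg_apply, LieModule.toEnd_apply_apply]
      rw [← lie_skew (b j) y, map_neg, LinearMap.neg_apply]
  have := LinearMap.congr_fun this x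
  simp only [LinearMap.sub_apply, LinearMap.flip_apply, LinearMap.comp_apply, 
        LinearMap.neg_apply, LieModule.toEnd_apply_apply] at this
  unfold Rel
  rw [this, ← lie_skew x y, map_neg, LinearMap.neg_apply]

lemma Rel.of_V {x y : L} {n : ℕ} (h : ∀ s : SL C, s.1.length ≤ n → Rel b x y (Finsupp.single s 1))
    {v : SL C →₀ F} (hv : v ∈ V F C n) : Rel b x y v := by
  have hv2 : v = v.sum fun s r => r • Finsupp.single s 1 := by simp
  rw [hv2, Finsupp.sum]
  have : ∀ s ∈ v.support, Rel b x y (v s • Finsupp.single s 1) :=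
    fun s hs => (h s (hv hs)).smul b _
  exact Finset.sum_induction _ (Rel b x y) (fun _ _ => Rel.add b) (Rel.zero b x y) this

lemma not_small_insS {i : C ⊕ D} {c : C} {s : SL C} (hc : ∀ z ∈ s.1, c ≤ z)
    (hi : (∃ c', i = Sum.inl c' ∧ c < c') ∨ ∃ d, i = Sum.inr d) :
    ¬ small i (⟨c :: s.1, List.pairwise_cons.2 ⟨hc, s.2⟩⟩ : SL C) := by
  rintro ⟨c'', rfl, h⟩
  rcases hi with ⟨c', h', hlt⟩ | ⟨d, h'⟩
  · cases h'
    exact absurd (h c (by simp)) (not_le.2 hlt)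
  · cases h'

lemma insS_eq {c : C} {s : SL C} (hc : ∀ z ∈ s.1, c ≤ z) :
    insS c s = ⟨c :: s.1, List.pairwise_cons.2 ⟨hc, s.2⟩⟩ := by
  apply Subtype.ext
  rcases s with ⟨_ | ⟨y, l⟩, hl⟩
  · simp [insS]
  · simp only [insS]
    rw [List.orderedInsert_cons_of_le]
    exact hc y (by simp)

lemma rel_big {i : C ⊕ D} {c : C} {s : SL C} (hc : ∀ z ∈ s.1, c ≤ z)
    (hi : (∃ c', i = Sum.inl c' ∧ c < c') ∨ ∃ d, i = Sum.inr d) :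
    Rel b (b i) (b (Sum.inl c)) (Finsupp.single s 1) := by
  unfold Rel
  rw [X_single, X_single, act_small b ⟨c, rfl, hc⟩]
  simp only [ins]
  rw [X_single, insS_eq hc, act_rec b (not_small_insS hc hi)]
  simp

lemma rel_small {j : C ⊕ D} {s : SL C} (hj : small j s) (i : C ⊕ D) :
    Rel b (b i) (b j) (Finsupp.single s 1) := by
  obtain ⟨c, rfl, hc⟩ := hj
  rcases i with c' | d
  · rcases lt_trichotomy c' c with h | rfl | h
    · exact (rel_big b (fun z hz => h.le.trans (hc z hz)) (Or.inl ⟨c, rfl, h⟩)).symm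
    · simp [Rel]
    · exact rel_big b hc (Or.inl ⟨c', rfl, h⟩)
  · exact rel_big b hc (Or.inr ⟨d, rfl⟩)

lemma X_nil_inr (d : D) (h) : X b (b (Sum.inr d)) (Finsupp.single (⟨[], h⟩ : SL C) 1) = 0 := by
  rw [X_single, act]; rfl

lemma rel_all (H : LieSubalgebra F L) (hH : ∀ d, b (Sum.inr d) ∈ H)
    (hnil : ∀ x ∈ H, X b x (Finsupp.single (⟨[], List.Pairwise.nil⟩ : SL C) 1) = 0) (n : ℕ) :
    ∀ s : SL C, s.1.length = n → ∀ x y : L, Rel b x y (Finsupp.single s 1) := by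
  induction n using Nat.strong_induction_on with
  | _ n ih =>
  intro s hs
  refine Rel.of_basis b fun i j => ?_
  by_cases hi : small i s
  · exact (rel_small b hi j).symm
  by_cases hj : small j s
  · exact rel_small b hj i
  obtain ⟨l, hl⟩ := s
  rcases l with _ | ⟨z, l⟩
  · rcases i with c | d
    · exact absurd ⟨c, rfl, by simp⟩ hi
    rcases j with c | d'
    · exact absurd ⟨c, rfl, by simp⟩ hj
    unfold Rel
    rw [X_nil_inr, X_nil_inr, hnil _ (H.lie_mem (hH d) (hH d'))]
    simp
  · simp only [List.length_cons] at hs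
    set s' : SL C := ⟨l, (List.pairwise_cons.1 hl).2⟩ with hs'
    have hl' : s'.1.length = l.length := rfl
    have hz : ∀ w ∈ s'.1, z ≤ w := (List.pairwise_cons.1 hl).1
    have IH : ∀ x y : L, Rel b x y (Finsupp.single s' 1) := ih l.length (by omega) s' rfl
    -- the relation with z holds on X_j s'
    have key : ∀ i j : C ⊕ D, ¬ small j (⟨z :: l, hl⟩ : SL C) →
        Rel b (b i) (b (Sum.inl z)) (X b (b j) (Finsupp.single s' 1)) := by
      intro i j hj
      have h1 : Rel b (b i) (b (Sum.inl z)) (act b j s' - ins F j s') :=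
        Rel.of_V b (fun s hs => ih _ (by omega) s rfl _ _) (act_deg b _ j s' rfl)
      have h2 : Rel b (b i) (b (Sum.inl z)) (ins F j s') := by
        rcases not_small_cons hj with ⟨c, rfl, hc⟩ | ⟨d, rfl⟩
        · exact rel_small b ⟨z, rfl, le_insS (h := hl) hc⟩ i
        · exact Rel.zero b _ _
      rw [X_single]
      simpa using h1.add b h2
    have ei : X b (b i) (Finsupp.single ⟨z :: l, hl⟩ 1) = X b (b (Sum.inl z))
        (X b (b i) (Finsupp.single s' 1)) + X b ⁅b i, b (Sum.inl z)⁆ (Finsupp.single s' 1) := by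
      rw [X_single, act_rec b hi, X_single]
    have ej : X b (b j) (Finsupp.single ⟨z :: l, hl⟩ 1) = X b (b (Sum.inl z))
        (X b (b j) (Finsupp.single s' 1)) + X b ⁅b j, b (Sum.inl z)⁆ (Finsupp.single s' 1) := by
      rw [X_single, act_rec b hj, X_single]
    have ez : (Finsupp.single ⟨z :: l, hl⟩ 1 : SL C →₀ F) =
        X b (b (Sum.inl z)) (Finsupp.single s' 1) := by
      rw [X_single, act_small b ⟨z, rfl, hz⟩]
      simp only [ins]; rw [insS_eq hz]
    have k1 := key i j hj
    have k2 := key j i hi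
    have r1 := IH (b i) (b j)
    have r2 := IH ⁅b i, b j⁆ (b (Sum.inl z))
    have r3 := IH ⁅b i, b (Sum.inl z)⁆ (b j)
    have r4 := IH (b i) ⁅b j, b (Sum.inl z)⁆
    have r1' := congrArg (X b (b (Sum.inl z))) r1
    have jac : ⁅⁅b i, b j⁆, b (Sum.inl z)⁆ = ⁅⁅b i, b (Sum.inl z)⁆, b j⁆ +
        ⁅b i, ⁅b j, b (Sum.inl z)⁆⁆ := by
      rw [lie_lie, ← lie_skew ⁅b i, b (Sum.inl z)⁆ (b j)]; abel
    unfold Rel at *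
    rw [jac, map_add, LinearMap.add_apply, ← r3, ← r4] at r2
    rw [ei, ej]
    conv_rhs => rw [ez]
    rw [sub_eq_iff_eq_add] at r2
    rw [r2]
    rw [sub_eq_iff_eq_add] at k1 k2
    simp only [map_add, map_sub] at *
    rw [k1, k2, ← r1']
    abel

end

/-- For a Lie subalgebra H, there is a representation with a vector whose annihilator is H. -/
theorem exists_rep {F L : Type} [Field F] [LieRing L] [LieAlgebra F L] (H : LieSubalgebra F L) :
    ∃ (V : Type) (_ : AddCommGroup V) (_ : Module F V) (ρ : L →ₗ⁅F⁆ Module.End F V) (v : V),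
      ∀ x, ρ x v = 0 ↔ x ∈ H := by
  classical
  obtain ⟨K, hK⟩ := Submodule.exists_isCompl H.toSubmodule
  let bC := Module.Basis.ofVectorSpace F K
  let bH := Module.Basis.ofVectorSpace F H.toSubmodule
  let b := (bC.prod bH).map (Submodule.prodEquivOfIsCompl K H.toSubmodule hK.symm)
  let _ : LinearOrder (Module.Basis.ofVectorSpaceIndex F K) := linearOrderOfSTO WellOrderingRel
  have hH : ∀ d, b (Sum.inr d) ∈ H := by
    intro d
    simp [b]
  have hCK : ∀ c, b (Sum.inl c) ∈ K := by
    intro d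
    simp [b]
  let nl : SL (Module.Basis.ofVectorSpaceIndex F K) := ⟨[], List.Pairwise.nil⟩
  have hval : ∀ k : K, X b (k : L) (Finsupp.single nl 1) = 
      Finsupp.linearCombination F (fun c => Finsupp.single (insS c nl) 1) (bC.repr k) := by
    intro k
    have : ((X b).flip (Finsupp.single nl 1)).comp K.subtype =
      (Finsupp.linearCombination F (fun c => (Finsupp.single (insS c nl) (1:F)))).comp
        (bC.repr : K →ₗ[F] _) := by
      refine bC.ext fun c => ?_
      have hc : (bC c : L) = b (Sum.inl c) := by simp [b]
      simp only [LinearMap.comp_apply, Submodule.subtype_apply, hc, LinearMap.flip_apply, X_single]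
      rw [act_small b ⟨c, rfl, by simp [nl]⟩]
      simp [ins]
    exact LinearMap.congr_fun this k
  have hnil : ∀ x ∈ H, X b x (Finsupp.single nl 1) = 0 := by
    intro x hx
    have : ((X b).flip (Finsupp.single nl 1)).comp H.toSubmodule.subtype = 0 := by
      refine bH.ext fun c => ?_
      have hc : (bH c : L) = b (Sum.inr c) := by simp [b]
      simp only [LinearMap.comp_apply, Submodule.subtype_apply, hc, LinearMap.flip_apply,
        LinearMap.zero_apply]
      exact X_nil_inr b c _
    exact LinearMap.congr_fun this ⟨x, hx⟩
  have hinj : Function.Injective (fun c => insS c nl) := by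
    intro c c' h
    have := congrArg Subtype.val h
    simpa [insS, nl] using this
  refine ⟨SL (Module.Basis.ofVectorSpaceIndex F K) →₀ F, inferInstance, inferInstance,
    { X b with
      map_lie' := ?_ }, Finsupp.single nl 1, ?_⟩
  · intro x y
    refine Finsupp.lhom_ext' fun s => LinearMap.ext_ring ?_
    have := rel_all b H hH hnil _ s rfl x y
    simp only [LinearMap.comp_apply, Finsupp.lsingle_apply]
    exact Eq.symm this
  · intro x
    change X b x (Finsupp.single nl 1) = 0 ↔ x ∈ H
    refine ⟨fun h => ?_, hnil x⟩
    obtain ⟨k, hk, h', hh', rfl⟩ : ∃ k ∈ K, ∃ h ∈ H.toSubmodule, k + h = x := by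
      have : x ∈ K ⊔ H.toSubmodule := by rw [hK.symm.sup_eq_top]; trivial
      exact Submodule.mem_sup.1 this
    rw [map_add, LinearMap.add_apply, hnil _ hh', add_zero, hval ⟨k, hk⟩] at h
    have hli : LinearIndependent F
        (fun c : Module.Basis.ofVectorSpaceIndex F K => Finsupp.single (insS c nl) (1:F)) := by
      have := LinearIndependent.comp (Finsupp.basisSingleOne (R := F)).linearIndependent
        (fun c => insS c nl) hinj
      simpa [Function.comp_def] using this
    have h0 := hli (h.trans (map_zero _).symm)
    have : (⟨k, hk⟩ : K) = 0 := by simpa using h0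
    have : k = 0 := congrArg Subtype.val this
    rw [this, zero_add]; exact hh'

end PBW
end FreeLift

namespace FreeLift

attribute [local instance] LieRing.ofAssociativeRing

/-! ### Words in the free algebra -/
section Words
variable {F : Type} [Field F] {X : Type}

/-- the monomial of a word -/
noncomputable def bw (F : Type) [Field F] {X : Type} (w : List X) : FreeAlgebra F X :=
  (w.map (FreeAlgebra.ι F)).prod

@[simp] lemma bw_nil : bw F ([] : List X) = 1 := rfl

lemma bw_cons (x : X) (w : List X) : bw F (x :: w) = FreeAlgebra.ι F x * bw F w := by
  simp [bw]

lemma bw_append (v w : List X) : bw F (v ++ w) = bw F v * bw F w := by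
  simp [bw]

lemma bw_single (x : X) : bw F [x] = FreeAlgebra.ι F x := by simp [bw]

noncomputable def bB (F : Type) [Field F] (X : Type) : Module.Basis (List X) F (FreeAlgebra F X) :=
  FreeAlgebra.basisFreeMonoid F X

@[simp] lemma bB_apply (w : List X) : bB F X w = bw F w := by
  have h : ∀ v : FreeMonoid X, FreeAlgebra.basisFreeMonoid F X v =
      FreeMonoid.lift (FreeAlgebra.ι F) v := by
    intro v
    rw [FreeAlgebra.basisFreeMonoid, Module.Basis.map_apply]
    simp [FreeAlgebra.equivMonoidAlgebraFreeMonoid]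
  refine (h w).trans ?_
  exact FreeMonoid.lift_apply _ _

/-- span of the words satisfying P -/
noncomputable def sp (F : Type) [Field F] {X : Type} (P : List X → Prop) :
    Submodule F (FreeAlgebra F X) := Submodule.span F (bw F '' {w | P w})

lemma bw_mem {P : List X → Prop} {w : List X} (h : P w) : bw F w ∈ sp F P :=
  Submodule.subset_span ⟨w, h, rfl⟩

lemma sp_le {P : List X → Prop} {S : Submodule F (FreeAlgebra F X)}
    (h : ∀ w, P w → bw F w ∈ S) : sp F P ≤ S := by
  refine Submodule.span_le.2 ?_
  rintro _ ⟨w, hw, rfl⟩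
  exact h w hw

lemma sp_map {M : Type} [AddCommGroup M] [Module F M] (f : FreeAlgebra F X →ₗ[F] M)
    {P : List X → Prop} {S : Submodule F M} (h : ∀ w, P w → f (bw F w) ∈ S)
    {a : FreeAlgebra F X} (ha : a ∈ sp F P) : f a ∈ S :=
  sp_le (S := S.comap f) h ha

lemma sp_mono {P Q : List X → Prop} (h : ∀ w, P w → Q w) : sp F P ≤ sp F Q :=
  sp_le fun w hw => bw_mem (h w hw)

lemma sp_true (a : FreeAlgebra F X) : a ∈ sp F (fun _ : List X => True) := by
  have := (bB F X).span_eq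
  have h : a ∈ (⊤ : Submodule F (FreeAlgebra F X)) := trivial
  rw [← this] at h
  refine Submodule.span_mono ?_ h
  rintro _ ⟨w, rfl⟩
  exact ⟨w, trivial, by simp⟩

lemma word_ext {M : Type} [AddCommGroup M] [Module F M] {f g : FreeAlgebra F X →ₗ[F] M}
    (h : ∀ w, f (bw F w) = g (bw F w)) : f = g :=
  (bB F X).ext fun w => by simpa using h w

/-- linear extension from words -/
noncomputable def wl {M : Type} [AddCommGroup M] [Module F M] (f : List X → M) :
    FreeAlgebra F X →ₗ[F] M := (bB F X).constr F f

@[simp] lemma wl_bw {M : Type} [AddCommGroup M] [Module F M] (f : List X → M) (w : List X) :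
    wl (F := F) f (bw F w) = f w := by
  rw [← bB_apply]; exact (bB F X).constr_basis F f w

lemma sp_mul {P Q R : List X → Prop} (h : ∀ v w, P v → Q w → R (v ++ w))
    {a b : FreeAlgebra F X} (ha : a ∈ sp F P) (hb : b ∈ sp F Q) : a * b ∈ sp F R := by
  refine sp_map (LinearMap.mulLeft F a) (P := Q) (fun w hw => ?_) hb
  refine sp_map (LinearMap.mulRight F (bw F w)) (P := P) (fun v hv => ?_) ha
  simp only [LinearMap.mulRight_apply, ← bw_append]
  exact bw_mem (h v w hv hw)

/-- coefficient functional -/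
noncomputable def wc (F : Type) [Field F] {X : Type} (w : List X) : FreeAlgebra F X →ₗ[F] F :=
  open Classical in wl fun v => if v = w then 1 else 0

lemma wc_eq_zero {P : List X → Prop} {w : List X} (hw : ¬ P w) {a : FreeAlgebra F X}
    (ha : a ∈ sp F P) : wc F w a = 0 := by
  have := sp_map (wc F w) (S := ⊥) (P := P) (fun v hv => ?_) ha
  · simpa using this
  · have : v ≠ w := fun h => hw (h ▸ hv)
    simp [wc, this]

lemma eq_zero_of_wc {a : FreeAlgebra F X} (h : ∀ w, wc F w a = 0) : a = 0 := by
  classical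
  have h1 : ∀ w, wc F w a = (bB F X).repr a w := by
    intro w
    have : wc F w = (Finsupp.lapply w).comp ((bB F X).repr : FreeAlgebra F X →ₗ[F] _) := by
      refine word_ext fun v => ?_
      simp only [wc, wl_bw, LinearMap.comp_apply, LinearEquiv.coe_coe]
      rw [← bB_apply, (bB F X).repr_self]
      simp [Finsupp.single_apply]
    rw [this]; rfl
  apply (bB F X).repr.injective
  ext w
  rw [← h1, h]; simp

/-- constant coefficient -/
noncomputable def eps (F : Type) [Field F] (X : Type) : FreeAlgebra F X →ₐ[F] F :=
  FreeAlgebra.lift F fun _ => 0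

@[simp] lemma eps_one : eps F X 1 = 1 := map_one _
@[simp] lemma eps_cons (x : X) (w : List X) : eps F X (bw F (x :: w)) = 0 := by
  simp [bw_cons, eps]

/-- degree filtration -/
noncomputable def Ad (F : Type) [Field F] (X : Type) (d : ℕ) : Submodule F (FreeAlgebra F X) :=
  sp F fun w : List X => w.length < d

lemma Ad_mono : Monotone (Ad F X) := fun _ _ h => sp_mono fun _ hw => lt_of_lt_of_le hw h

lemma Ad_zero : Ad F X 0 = ⊥ := by
  refine le_bot_iff.1 (sp_le fun w hw => ?_)
  simp at hw

lemma Ad_mul {d e : ℕ} {a b : FreeAlgebra F X} (ha : a ∈ Ad F X (d + 1)) (hb : b ∈ Ad F X (e + 1)) :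
    a * b ∈ Ad F X (d + e + 1) :=
  sp_mul (fun v w hv hw => by simp only [List.length_append]; omega) ha hb

lemma Ad_mul' {d e : ℕ} {a b : FreeAlgebra F X} (ha : a ∈ Ad F X (d + 1)) (hb : b ∈ Ad F X e) :
    a * b ∈ Ad F X (d + e) :=
  sp_mul (fun v w hv hw => by simp only [List.length_append]; omega) ha hb

lemma exists_Ad (a : FreeAlgebra F X) : ∃ d, a ∈ Ad F X d := by
  have h : (⊤ : Submodule F (FreeAlgebra F X)) ≤ ⨆ d, Ad F X d := by
    intro a _
    exact sp_le (P := fun _ => True) (fun w _ =>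
      Submodule.mem_iSup_of_mem (w.length + 1) (bw_mem (Nat.lt_succ_self _))) (sp_true a)
  exact (Submodule.mem_iSup_of_directed _ (Ad_mono (F := F) (X := X)).directed_le).1
    (h (Submodule.mem_top (x := a)))

lemma Ad_one_eq {a : FreeAlgebra F X} (ha : a ∈ Ad F X 1) :
    a = algebraMap F _ (eps F X a) := by
  have := sp_map (LinearMap.id - (Algebra.linearMap F (FreeAlgebra F X)).comp (eps F X).toLinearMap)
    (S := ⊥) (P := fun w : List X => w.length < 1) (fun w hw => ?_) ha
  · simpa [sub_eq_zero] using this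
  · have : w = [] := List.length_eq_zero_iff.1 (by omega)
    simp [this]

/-- left transduction -/
noncomputable def del (F : Type) [Field F] {X : Type} (y : X) : FreeAlgebra F X →ₗ[F] FreeAlgebra F X :=
  open Classical in wl fun w => match w with
    | [] => 0
    | x :: v => if x = y then bw F v else 0

lemma del_one (y : X) : del F y 1 = 0 := by
  rw [← bw_nil, del, wl_bw]

open Classical in
lemma del_cons (y x : X) (w : List X) : del F y (bw F (x :: w)) = if x = y then bw F w else 0 := by
  rw [del, wl_bw]

lemma del_mul (y : X) (a b : FreeAlgebra F X) :
    del F y (a * b) = del F y a * b + eps F X a • del F y b := by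
  have h : ∀ w, del F y (bw F w * b) = del F y (bw F w) * b + eps F X (bw F w) • del F y b := by
    intro w
    have : (del F y).comp (LinearMap.mulLeft F (bw F w)) =
        LinearMap.mulLeft F (del F y (bw F w)) + eps F X (bw F w) • del F y := by
      refine word_ext fun v => ?_
      simp only [LinearMap.comp_apply, LinearMap.mulLeft_apply, LinearMap.add_apply,
        LinearMap.smul_apply, ← bw_append]
      rcases w with _ | ⟨x, w⟩
      · simp [del_one]
      · rw [List.cons_append, del_cons, del_cons, eps_cons]
        split_ifs <;> simp [bw_append]
    exact LinearMap.congr_fun this b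
  have : (del F y).comp (LinearMap.mulRight F b) = (LinearMap.mulRight F b).comp (del F y) +
      (eps F X).toLinearMap.smulRight (del F y b) := by
    refine word_ext fun w => ?_
    simpa using h w
  simpa using LinearMap.congr_fun this a

lemma del_Ad {y : X} {d : ℕ} {a : FreeAlgebra F X} (ha : a ∈ Ad F X (d + 1)) :
    del F y a ∈ Ad F X d := by
  classical
  refine sp_map (del F y) (P := fun w : List X => w.length < d + 1) (fun w hw => ?_) ha
  rcases w with _ | ⟨x, w⟩
  · rw [bw_nil, del_one]; exact Submodule.zero_mem _
  · rw [del_cons]; split_ifs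
    · exact bw_mem (by simpa using hw)
    · exact Submodule.zero_mem _

lemma eps_eq_wc (a : FreeAlgebra F X) : eps F X a = wc F [] a := by
  have : (eps F X).toLinearMap = wc F [] := by
    refine word_ext fun w => ?_
    rcases w with _ | ⟨x, w⟩
    · rw [wc, wl_bw]; simp
    · simp [wc]
  exact LinearMap.congr_fun this a

lemma wc_del (y : X) (w : List X) (a : FreeAlgebra F X) : wc F w (del F y a) = wc F (y :: w) a := by
  classical
  have : (wc F w).comp (del F y) = wc F (y :: w) := by
    refine word_ext fun v => ?_
    rcases v with _ | ⟨x, v⟩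
    · rw [LinearMap.comp_apply, bw_nil, del_one, ← bw_nil]; simp [wc, -bw_nil]
    · rw [LinearMap.comp_apply, del_cons]
      split_ifs with h <;> simp [wc, h]
  exact LinearMap.congr_fun this a

lemma mem_sp_of_wc {P : List X → Prop} {a : FreeAlgebra F X} (h : ∀ w, ¬ P w → wc F w a = 0) :
    a ∈ sp F P := by
  classical
  -- decompose
  let c : FreeAlgebra F X →ₗ[F] FreeAlgebra F X := wl fun w => if P w then bw F w else 0
  have hc : ∀ b, c b ∈ sp F P := fun b => sp_map c (P := fun _ => True)
    (fun w _ => by simp only [c, wl_bw]; split_ifs with h; exacts [bw_mem h, Submodule.zero_mem _])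
    (sp_true b)
  have hcw : ∀ w, ¬ P w → wc F w (c a) = 0 := fun w hw => wc_eq_zero hw (hc a)
  have hcw' : ∀ w, P w → wc F w (c a) = wc F w a := by
    intro w hw
    have : (wc F w).comp c = wc F w := by
      refine word_ext fun v => ?_
      simp only [LinearMap.comp_apply, c, wl_bw]
      split_ifs with hv
      · rfl
      · have : v ≠ w := fun h => hv (h ▸ hw)
        simp [wc, this]
    exact LinearMap.congr_fun this a
  have : a = c a := by
    rw [← sub_eq_zero]
    refine eq_zero_of_wc fun w => ?_
    by_cases hw : P w
    · simp [hcw' w hw]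
    · simp [hcw w hw, h w hw]
  rw [this]; exact hc a

/-- the key descent: if eps a = 0 and all transductions are small, so is a -/
lemma mem_Ad_of_del {d : ℕ} {a : FreeAlgebra F X} (h : ∀ y, del F y a ∈ Ad F X d) :
    a ∈ Ad F X (d + 1) := by
  refine mem_sp_of_wc fun w hw => ?_
  rcases w with _ | ⟨y, w⟩
  · simp at hw
  · rw [← wc_del]
    exact wc_eq_zero (P := fun w : List X => w.length < d) (by simpa using hw) (h y)

/-- homogeneous component -/
noncomputable def cmp (F : Type) [Field F] (X : Type) (d : ℕ) : FreeAlgebra F X →ₗ[F] FreeAlgebra F X :=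
  wl fun w => if w.length = d then bw F w else 0

lemma cmp_bw (d : ℕ) (w : List X) : cmp F X d (bw F w) = if w.length = d then bw F w else 0 := by
  simp [cmp]

lemma cmp_Ad {d : ℕ} {a : FreeAlgebra F X} (ha : a ∈ Ad F X d) : cmp F X d a = 0 := by
  have := sp_map (cmp F X d) (S := ⊥) (P := fun w : List X => w.length < d) (fun w hw => ?_) ha
  · simpa using this
  · simp [cmp_bw, hw.ne]

lemma cmp_mem (d : ℕ) (a : FreeAlgebra F X) : cmp F X d a ∈ sp F fun w : List X => w.length = d :=
  sp_map (cmp F X d) (P := fun _ => True)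
    (fun w _ => by rw [cmp_bw]; split_ifs with h; exacts [bw_mem h, Submodule.zero_mem _])
    (sp_true a)

lemma cmp_mem_Ad (d : ℕ) (a : FreeAlgebra F X) : cmp F X d a ∈ Ad F X (d + 1) :=
  sp_mono (fun w hw => by omega) (cmp_mem d a)

lemma sub_cmp_mem {d : ℕ} {a : FreeAlgebra F X} (ha : a ∈ Ad F X (d + 1)) :
    a - cmp F X d a ∈ Ad F X d := by
  refine sp_map (LinearMap.id - cmp F X d) (P := fun w : List X => w.length < d + 1)
    (fun w hw => ?_) ha
  simp only [LinearMap.sub_apply, LinearMap.id_apply, cmp_bw]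
  split_ifs with h
  · simp
  · rw [sub_zero]; exact bw_mem (by omega)

lemma mem_Ad_of_cmp {d : ℕ} {a : FreeAlgebra F X} (ha : a ∈ Ad F X (d + 1)) (h : cmp F X d a = 0) :
    a ∈ Ad F X d := by simpa [h] using sub_cmp_mem ha

lemma cmp_of_sp {d : ℕ} {a : FreeAlgebra F X} (ha : a ∈ sp F fun w : List X => w.length = d) (e : ℕ) :
    cmp F X e a = if e = d then a else 0 := by
  have := sp_map (cmp F X e - (if e = d then (1:F) else 0) • LinearMap.id) (S := ⊥)
    (P := fun w : List X => w.length = d) (fun w hw => ?_) ha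
  · rw [Submodule.mem_bot, LinearMap.sub_apply, sub_eq_zero] at this
    rw [this]; split_ifs <;> simp
  · simp only [LinearMap.sub_apply, cmp_bw, hw, LinearMap.smul_apply, LinearMap.id_apply]
    by_cases h : d = e
    · simp [h]
    · simp [h, Ne.symm h]

lemma cmp_mul {d e : ℕ} {a b : FreeAlgebra F X} (ha : a ∈ Ad F X (d + 1)) (hb : b ∈ Ad F X (e + 1)) :
    cmp F X (d + e) (a * b) = cmp F X d a * cmp F X e b := by
  have e1 : a * b = cmp F X d a * cmp F X e b +
      (cmp F X d a * (b - cmp F X e b) + (a - cmp F X d a) * b) := by noncomm_ring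
  have h1 : cmp F X d a * (b - cmp F X e b) ∈ Ad F X (d + e) :=
    Ad_mul' (cmp_mem_Ad d a) (sub_cmp_mem hb)
  have h2 : (a - cmp F X d a) * b ∈ Ad F X (d + e) :=
    sp_mul (fun v w hv hw => by simp only [List.length_append]; omega) (sub_cmp_mem ha) hb
  conv_lhs => rw [e1]
  rw [map_add, cmp_Ad (Submodule.add_mem _ h1 h2), add_zero]
  rw [cmp_of_sp (d := d + e), if_pos rfl]
  exact sp_mul (fun v w hv hw => by simp only [List.length_append]; omega) (cmp_mem d a) (cmp_mem e b)

end Words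

/-! ### The free Lie algebra in the free algebra -/
section FL
variable {F : Type} [Field F] {X : Type}

noncomputable def fl (F : Type) [Field F] (X : Type) : FreeLieAlgebra F X →ₗ⁅F⁆ FreeAlgebra F X :=
  FreeLieAlgebra.lift F (FreeAlgebra.ι F)

@[simp] lemma fl_of (x : X) : fl F X (FreeLieAlgebra.of F x) = FreeAlgebra.ι F x := by simp [fl]

lemma lsub_top (S : LieSubalgebra F (FreeLieAlgebra F X)) (h : ∀ x, FreeLieAlgebra.of F x ∈ S)
    (z : FreeLieAlgebra F X) : z ∈ S := by
  let f : FreeLieAlgebra F X →ₗ⁅F⁆ S := FreeLieAlgebra.lift F fun x => ⟨_, h x⟩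
  have : S.incl.comp f = LieHom.id := by
    ext x; simp [f]
  have h2 := LieHom.congr_fun this z
  simp only [LieHom.comp_apply] at h2
  rw [show z = S.incl (f z) from h2.symm]
  exact (f z).2

/-- sum of a bracket-graded family of submodules is a subalgebra -/
def gsub {L : Type} [LieRing L] [LieAlgebra F L] {I : Type} [Add I] (T : I → Submodule F L)
    (hT : ∀ i j, ∀ x ∈ T i, ∀ y ∈ T j, ⁅x, y⁆ ∈ T (i + j)) : LieSubalgebra F L :=
  { (⨆ i, T i) with
    lie_mem' := by
      intro x y hx hy
      change x ∈ ⨆ i, T i at hx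
      change y ∈ ⨆ i, T i at hy
      change ⁅x, y⁆ ∈ ⨆ i, T i
      have h1 : ∀ i, ∀ x ∈ T i, ∀ y ∈ ⨆ i, T i, ⁅x, y⁆ ∈ ⨆ i, T i := by
        intro i x hx
        have : (⨆ i, T i) ≤ (⨆ i, T i).comap (LieModule.toEnd F L L x : L →ₗ[F] L) :=
          iSup_le fun j y hy => Submodule.mem_iSup_of_mem (i + j) (hT i j x hx y hy)
        exact fun y hy => this hy
      have : (⨆ i, T i) ≤ (⨆ i, T i).comap (LieModule.toEnd F L L y : L →ₗ[F] L) := by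
        refine iSup_le fun i x hx => ?_
        change ⁅y, x⁆ ∈ ⨆ i, T i
        rw [← lie_skew]
        exact Submodule.neg_mem _ (h1 i x hx y hy)
      rw [← lie_skew]
      exact Submodule.neg_mem _ (this hx) }

lemma mem_gsub {L : Type} [LieRing L] [LieAlgebra F L] {I : Type} [Add I] (T : I → Submodule F L)
    (hT : ∀ i j, ∀ x ∈ T i, ∀ y ∈ T j, ⁅x, y⁆ ∈ T (i + j)) {x : L} :
    x ∈ gsub T hT ↔ x ∈ ⨆ i, T i := Iff.rfl

/-- A Lie element in the left ideal generated by a Lie subalgebra lies in the subalgebra. -/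
lemma mem_of_fl_mem_span (H : LieSubalgebra F (FreeLieAlgebra F X)) {z : FreeLieAlgebra F X}
    (hz : fl F X z ∈ Submodule.span (FreeAlgebra F X) (fl F X '' H)) : z ∈ H := by
  obtain ⟨V, _, _, ρ, v, hv⟩ := PBW.exists_rep H
  let σ : FreeAlgebra F X →ₐ[F] Module.End F V := FreeAlgebra.lift F fun x => ρ (FreeLieAlgebra.of F x)
  have hσ : ∀ z, σ (fl F X z) = ρ z := by
    intro z
    have : (LieHom.comp (σ : FreeAlgebra F X →ₗ⁅F⁆ Module.End F V) (fl F X)) = ρ := by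
      ext x : 1
      simp [σ]
    exact LieHom.congr_fun this z
  have key : ∀ a ∈ Submodule.span (FreeAlgebra F X) (fl F X '' (H : Set (FreeLieAlgebra F X))), σ a v = 0 := by
    intro a ha
    induction ha using Submodule.span_induction with
    | mem a ha =>
      obtain ⟨h, hh, rfl⟩ := ha
      rw [hσ]; exact (hv h).2 hh
    | zero => simp
    | add a b _ _ ha hb => simp [ha, hb]
    | smul r a _ ha => simp [ha]
  exact (hv z).1 (by rw [← hσ]; exact key _ hz)

lemma fl_injective : Function.Injective (fl F X) := by
  rw [injective_iff_map_eq_zero]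
  intro z hz
  have := mem_of_fl_mem_span (⊥ : LieSubalgebra F (FreeLieAlgebra F X)) (z := z) (by
    rw [hz]; exact Submodule.zero_mem _)
  simpa using this

lemma eps_fl (z : FreeLieAlgebra F X) : eps F X (fl F X z) = 0 := by
  have : (LieHom.comp (eps F X : FreeAlgebra F X →ₗ⁅F⁆ F) (fl F X)) = 0 := by
    ext x : 1
    simp [eps]
  exact LieHom.congr_fun this z

end FL

end FreeLift

namespace FreeLift

attribute [local instance] LieRing.ofAssociativeRing

/-! ### The weak algorithm -/
section Sel
variable {F : Type} [Field F] {Y : Type} {E : Type} [AddCommGroup E] [Module F E]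
  [Module (FreeAlgebra F Y) E] [IsScalarTower F (FreeAlgebra F Y) E]

structure WFilt (E' : ℕ → Submodule F E) (δ : Y → E →ₗ[F] E) : Prop where
  mono : Monotone E'
  zero : E' 0 = ⊥
  del : ∀ y d, ∀ v ∈ E' (d + 1), δ y v ∈ E' d
  smul : ∀ y (a : FreeAlgebra F Y) (m : E), δ y (a • m) = FreeLift.del F y a • m + eps F Y a • δ y m

/-- elements of lower type -/
def lowSet (E' : ℕ → Submodule F E) (N : Submodule F E) (d : ℕ) : Set E :=
  {v | ∃ e < d, ∃ a ∈ Ad F Y (d + 1 - e), ∃ m ∈ N ⊓ E' (e + 1), v = a • m}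

lemma indep_aux {E' : ℕ → Submodule F E} {δ : Y → E →ₗ[F] E} (h : WFilt E' δ)
    (N : Submodule F E) {ι : ℕ → Type} (x : (Σ d, ι d) → E)
    (hxE : ∀ i, x i ∈ N ⊓ E' (i.1 + 1))
    (hli : ∀ d, LinearIndependent F fun j : ι d => x ⟨d, j⟩)
    (K : ℕ → Submodule F E) (hK : ∀ i, x i ∈ K i.1)
    (hdis : ∀ d, K d ⊓ (Submodule.span F (lowSet (Y := Y) E' N d) ⊔ E' d) = ⊥) (d : ℕ) :
    ∀ (s : Finset (Σ d, ι d)) (a : (Σ d, ι d) → FreeAlgebra F Y),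
      (∀ i ∈ s, a i ∈ Ad F Y (d + 1 - i.1)) → ∑ i ∈ s, a i • x i ∈ E' d →
      ∀ i ∈ s, a i ∈ Ad F Y (d - i.1) := by
  classical
  induction d using Nat.strong_induction_on with
  | _ d ih =>
  intro s a ha hsum
  -- deal with deg = d
  have hgt : ∀ i ∈ s, d < i.1 → a i = 0 := by
    intro i hi hd
    have := ha i hi
    rw [show d + 1 - i.1 = 0 by omega, Ad_zero] at this
    simpa using this
  have hlowmem : ∀ i ∈ s, i.1 ≠ d → a i • x i ∈
      Submodule.span F (lowSet (Y := Y) E' N d) := by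
    intro i hi hne
    rcases lt_or_gt_of_ne hne with hlt | hlt
    · exact Submodule.subset_span ⟨i.1, hlt, a i, ha i hi, x i, hxE i, rfl⟩
    · rw [hgt i hi hlt]; simp
  have hscal : ∀ i ∈ s, i.1 = d → a i • x i = eps F Y (a i) • x i := by
    intro i hi he
    have := ha i hi
    rw [show d + 1 - i.1 = 1 by omega] at this
    conv_lhs => rw [Ad_one_eq this]
    rw [algebraMap_smul]
  have hsplit := Finset.sum_filter_add_sum_filter_not s (fun i => i.1 = d) (fun i => a i • x i)
  have hlow : ∑ i ∈ s with ¬ i.1 = d, a i • x i ∈ Submodule.span F (lowSet (Y := Y) E' N d) :=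
    Submodule.sum_mem _ fun i hi => hlowmem i (Finset.mem_filter.1 hi).1 (Finset.mem_filter.1 hi).2
  have htop : ∑ i ∈ s with i.1 = d, a i • x i ∈ K d := by
    refine Submodule.sum_mem _ fun i hi => ?_
    have hi' := Finset.mem_filter.1 hi
    rw [hscal i hi'.1 hi'.2]
    exact Submodule.smul_mem _ _ (hi'.2 ▸ hK i)
  have htop0 : ∑ i ∈ s with i.1 = d, a i • x i = 0 := by
    have : ∑ i ∈ s with i.1 = d, a i • x i ∈
        K d ⊓ (Submodule.span F (lowSet (Y := Y) E' N d) ⊔ E' d) := by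
      refine ⟨htop, ?_⟩
      rw [eq_sub_of_add_eq hsplit]
      exact Submodule.sub_mem _ (Submodule.mem_sup_right hsum) (Submodule.mem_sup_left hlow)
    rw [hdis] at this
    simpa using this
  have heps : ∀ i ∈ s, i.1 = d → a i = 0 := by
    intro i hi he
    have h1 : ∑ j ∈ s.preimage (Sigma.mk d) (sigma_mk_injective.injOn),
        eps F Y (a ⟨d, j⟩) • x ⟨d, j⟩ = 0 := by
      rw [← htop0, Finset.sum_filter]
      rw [← Finset.sum_preimage (Sigma.mk d) s (sigma_mk_injective.injOn)
        (fun i => if i.1 = d then a i • x i else 0)]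
      · refine Finset.sum_congr rfl fun j hj => ?_
        rw [if_pos rfl, hscal _ (Finset.mem_preimage.1 hj) rfl]
      · intro i _ hi
        rw [if_neg]
        intro he
        exact hi ⟨he ▸ i.2, by cases he; rfl⟩
    obtain ⟨d', j⟩ := i
    cases he
    have h2 := linearIndependent_iff'.1 (hli d') _ _ h1 j (Finset.mem_preimage.2 hi)
    have := ha _ hi
    rw [show d' + 1 - d' = 1 by omega] at this
    rw [Ad_one_eq this, h2, map_zero]
  rcases d with _ | d
  · intro i hi
    have : a i = 0 := by
      rcases Nat.eq_zero_or_pos i.1 with h | h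
      · exact heps i hi h
      · exact hgt i hi h
    rw [this]; exact Submodule.zero_mem _
  · intro i hi
    rcases lt_trichotomy i.1 (d + 1) with hlt | he | hl
    · rw [show d + 1 - i.1 = d - i.1 + 1 by omega]
      refine mem_Ad_of_del fun y => ?_
      refine ih d (Nat.lt_succ_self _) s (fun i => del F y (a i)) ?_ ?_ i hi
      · intro i hi
        rcases lt_or_ge i.1 (d + 2) with h2 | h2
        · refine del_Ad ?_
          rw [show d + 1 - i.1 + 1 = d + 1 + 1 - i.1 by omega]
          exact ha i hi
        · rw [hgt i hi (by omega), map_zero]; exact Submodule.zero_mem _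
      · have h3 := h.del y d _ hsum
        simp only [map_sum, h.smul, Finset.sum_add_distrib] at h3
        refine (Submodule.add_mem_iff_left _ (Submodule.sum_mem _ fun i hi => ?_)).1 h3
        rcases lt_or_ge d i.1 with h2 | h2
        · have : a i = 0 := by
            rcases Nat.eq_or_lt_of_le (Nat.succ_le_of_lt h2) with h | h
            · exact heps i hi h.symm
            · exact hgt i hi h
          simp [this]
        · exact Submodule.smul_mem _ _ (h.mono h2 (h.del y _ _ (hxE i).2))
    · rw [heps i hi he]; exact Submodule.zero_mem _
    · rw [hgt i hi hl]; exact Submodule.zero_mem _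

theorem sel {E' : ℕ → Submodule F E} {δ : Y → E →ₗ[F] E} (h : WFilt E' δ)
    (N : Submodule F E) :
    ∃ (X : Type) (x : X → E) (deg : X → ℕ), (∀ i, x i ∈ N) ∧ (∀ i, x i ∈ E' (deg i + 1)) ∧
      LinearIndependent (FreeAlgebra F Y) x ∧
      ∀ d, ∀ n ∈ N ⊓ E' (d + 1), ∃ u ∈ Submodule.span F (x '' {i | deg i = d}),
        n - u ∈ Submodule.span F (lowSet (Y := Y) E' N d) ⊔ E' d := by
  classical
  let S : ℕ → Submodule F E := fun d => Submodule.span F (lowSet (Y := Y) E' N d) ⊔ E' d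
  let M : ℕ → Submodule F E := fun d => N ⊓ E' (d + 1)
  have hex : ∀ d, ∃ K : Submodule F E, K ≤ M d ∧ K ⊓ S d = ⊥ ∧ M d ≤ K ⊔ S d := by
    intro d
    obtain ⟨K, hK⟩ := Submodule.exists_isCompl (M d ⊓ S d)
    refine ⟨K ⊓ M d, inf_le_right, ?_, ?_⟩
    · rw [inf_assoc, inf_comm]; exact hK.inf_eq_bot
    · intro n hn
      have : n ∈ (M d ⊓ S d) ⊔ K := by rw [hK.sup_eq_top]; trivial
      obtain ⟨s, hs, k, hk, rfl⟩ := Submodule.mem_sup.1 this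
      refine Submodule.mem_sup.2 ⟨k, ⟨hk, ?_⟩, s, hs.2, add_comm _ _⟩
      exact (Submodule.add_mem_iff_right _ hs.1).1 hn
  choose K hKM hKS hKsup using hex
  let x : (Σ d, Module.Basis.ofVectorSpaceIndex F (K d)) → E :=
    fun i => (Module.Basis.ofVectorSpace F (K i.1) i.2 : K i.1)
  have hxK : ∀ i, x i ∈ K i.1 := fun i => Subtype.coe_prop _
  refine ⟨_, x, fun i => i.1, fun i => (hKM _ (hxK i)).1, fun i => (hKM _ (hxK i)).2, ?_, ?_⟩
  · have aux := indep_aux h N x (fun i => hKM _ (hxK i)) (fun d => by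
      have := (Module.Basis.ofVectorSpace F (K d)).linearIndependent.map' (K d).subtype
        (Submodule.ker_subtype _)
      exact this) K hxK hKS
    rw [linearIndependent_iff']
    intro s g hg
    have key : ∀ d, (∀ i ∈ s, g i ∈ Ad F Y (d - i.1)) → ∀ i ∈ s, g i = 0 := by
      intro d
      induction d with
      | zero => intro h i hi; simpa [Ad_zero] using h i hi
      | succ d ih =>
        intro h
        exact ih (aux d s g h (by rw [hg]; exact Submodule.zero_mem _))
    choose D hD using fun i => exists_Ad (g i)
    refine key (∑ i ∈ s, (D i + i.1)) fun i hi => Ad_mono ?_ (hD i)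
    have := Finset.single_le_sum (f := fun i => D i + i.1) (fun _ _ => Nat.zero_le _) hi
    omega
  · intro d n hn
    obtain ⟨u, hu, v, hv, rfl⟩ := Submodule.mem_sup.1 (hKsup d hn)
    refine ⟨u, ?_, by simpa using hv⟩
    have h1 := (Module.Basis.ofVectorSpace F (K d)).mem_span ⟨u, hu⟩
    have h2 := Submodule.mem_map_of_mem (f := (K d).subtype) h1
    rw [Submodule.map_span] at h2
    refine Submodule.span_mono ?_ h2
    rintro _ ⟨_, ⟨j, rfl⟩, rfl⟩
    exact ⟨⟨d, j⟩, rfl, rfl⟩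

/-- the free module -/
lemma wfilt_finsupp (S : Type) : WFilt (F := F) (Y := Y) (E := S →₀ FreeAlgebra F Y)
    (fun d => ⨅ s, (Ad F Y d).comap (Finsupp.lapply s))
    (fun y => Finsupp.mapRange.linearMap (del F y)) where
  mono := fun _ _ h => iInf_mono fun _ => Submodule.comap_mono (Ad_mono h)
  zero := by
    rw [eq_bot_iff]
    intro v hv
    ext1 s
    have := (Submodule.mem_iInf _).1 hv s
    simpa [Ad_zero] using this
  del := by
    intro y d v hv
    refine (Submodule.mem_iInf _).2 fun s => ?_
    have := (Submodule.mem_iInf _).1 hv s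
    simp only [Submodule.mem_comap, Finsupp.lapply_apply, Finsupp.mapRange.linearMap_apply, Finsupp.mapRange_apply] at *
    exact del_Ad this
  smul := by
    intro y a m
    ext1 s
    simp [del_mul]

theorem submodule_free (S : Type) (N : Submodule (FreeAlgebra F Y) (S →₀ FreeAlgebra F Y)) :
    ∃ (X : Type) (x : X → (S →₀ FreeAlgebra F Y)), (∀ i, x i ∈ N) ∧
      LinearIndependent (FreeAlgebra F Y) x ∧ Submodule.span (FreeAlgebra F Y) (Set.range x) = N := by
  obtain ⟨X, x, deg, hN, -, hli, hgen⟩ := sel (wfilt_finsupp (F := F) (Y := Y) S) (N.restrictScalars F)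
  refine ⟨X, x, hN, hli, le_antisymm (Submodule.span_le.2 (by rintro _ ⟨i, rfl⟩; exact hN i)) ?_⟩
  set E' : ℕ → Submodule F (S →₀ FreeAlgebra F Y) :=
    (fun d => ⨅ s, (Ad F Y d).comap (Finsupp.lapply s)) with hE
  have key : ∀ d, ∀ n ∈ N, n ∈ E' d → n ∈ Submodule.span (FreeAlgebra F Y) (Set.range x) := by
    intro d
    induction d using Nat.strong_induction_on with
    | _ d ih =>
    intro n hn hd
    rcases d with _ | d
    · rw [show E' 0 = ⊥ from (wfilt_finsupp S).zero] at hd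
      have : n = 0 := by simpa using hd
      rw [this]; exact Submodule.zero_mem _
    · obtain ⟨u, hu, hnu⟩ := hgen d n ⟨hn, hd⟩
      have hu' : u ∈ Submodule.span (FreeAlgebra F Y) (Set.range x) :=
        Submodule.span_subset_span F _ _ (Submodule.span_mono (Set.image_subset_range _ _) hu)
      obtain ⟨l, hl, r, hr, hlr⟩ := Submodule.mem_sup.1 hnu
      have hl' : l ∈ Submodule.span (FreeAlgebra F Y) (Set.range x) ⊓ N := by
        have : Submodule.span F (lowSet (Y := Y) E' (N.restrictScalars F) d) ≤
          (Submodule.span (FreeAlgebra F Y) (Set.range x) ⊓ N).restrictScalars F := by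
          refine Submodule.span_le.2 ?_
          rintro _ ⟨e, he, a, -, m, hm, rfl⟩
          have := ih (e + 1) (by omega) m hm.1 hm.2
          exact ⟨Submodule.smul_mem _ _ this, Submodule.smul_mem _ _ hm.1⟩
        exact this hl
      have huN : u ∈ N := (Submodule.span_le.2 (by rintro _ ⟨i, rfl⟩; exact hN i)) hu'
      have hrN : r ∈ N := by
        rw [← eq_sub_iff_add_eq'] at hlr
        rw [hlr]
        exact Submodule.sub_mem _ (Submodule.sub_mem _ hn huN) hl'.2
      have := ih d (Nat.lt_succ_self _) r hrN hr
      rw [← sub_add_cancel n u, ← hlr]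
      exact Submodule.add_mem _ (Submodule.add_mem _ hl'.1 this) hu'
  intro n hn
  choose D hD using fun s => exists_Ad (n s)
  refine key (∑ s ∈ n.support, D s) n hn ((Submodule.mem_iInf _).2 fun s => ?_)
  by_cases hs : s ∈ n.support
  · exact Ad_mono (Finset.single_le_sum (f := D) (fun _ _ => Nat.zero_le _) hs) (hD s)
  · have : n s = 0 := by simpa using hs
    simp [this]

end Sel

end FreeLift

namespace FreeLift

attribute [local instance] LieRing.ofAssociativeRing

/-! ### Subalgebras of free Lie algebras are free -/
section SW
variable {F : Type} [Field F] {X W : Type}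

lemma right_decomp {n : ℕ} {a : FreeAlgebra F X} (ha : a ∈ Ad F X (n + 1)) :
    ∃ b : X →₀ FreeAlgebra F X, (∀ i, b i ∈ Ad F X n) ∧
      a = algebraMap F _ (eps F X a) + b.sum fun i r => r * FreeAlgebra.ι F i := by
  let Φ : (X →₀ FreeAlgebra F X) →ₗ[F] FreeAlgebra F X :=
    (Finsupp.linearCombination (FreeAlgebra F X) (FreeAlgebra.ι F)).restrictScalars F
  have := sp_map (LinearMap.id - (Algebra.linearMap F (FreeAlgebra F X)).comp (eps F X).toLinearMap)
    (S := (⨅ s, (Ad F X n).comap (Finsupp.lapply s)).map Φ)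
    (P := fun w : List X => w.length < n + 1) (fun w hw => ?_) ha
  · obtain ⟨b, hb, hb2⟩ := this
    refine ⟨b, fun i => (Submodule.mem_iInf _).1 hb i, ?_⟩
    have h3 : Φ b = b.sum fun i r => r * FreeAlgebra.ι F i := rfl
    rw [← h3, hb2]; simp
  · rcases List.eq_nil_or_concat w with rfl | ⟨u, i, rfl⟩
    · simp
    · refine ⟨Finsupp.single i (bw F u), (Submodule.mem_iInf _).2 fun s => ?_, ?_⟩
      · classical
        simp only [Submodule.mem_comap, Finsupp.lapply_apply, Finsupp.single_apply]
        split_ifs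
        · exact bw_mem (by simpa using hw)
        · exact Submodule.zero_mem _
      · have : eps F X (bw F (u ++ [i])) = 0 := by
          rw [bw_append, bw_single]; simp [eps]
        simp [Φ, eps, bw_append, bw_single]

lemma lift_injective (ξ : X → FreeAlgebra F W) (h0 : ∀ i, eps F W (ξ i) = 0)
    (hli : LinearIndependent (FreeAlgebra F W) ξ) :
    Function.Injective (FreeAlgebra.lift F ξ) := by
  rw [injective_iff_map_eq_zero]
  have key : ∀ n, ∀ a ∈ Ad F X n, FreeAlgebra.lift F ξ a = 0 → a = 0 := by
    intro n
    induction n with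
    | zero => intro a ha _; simpa [Ad_zero] using ha
    | succ n ih =>
      intro a ha hj
      obtain ⟨b, hb, hab⟩ := right_decomp ha
      have h1 : algebraMap F (FreeAlgebra F W) (eps F X a) +
          ∑ i ∈ b.support, FreeAlgebra.lift F ξ (b i) • ξ i = 0 := by
        rw [← hj]
        conv_rhs => rw [hab]
        simp [Finsupp.sum]
      have h2 : eps F X a = 0 := by
        have := congrArg (eps F W) h1
        simpa [h0] using this
      rw [h2, map_zero, zero_add] at h1
      have h3 := linearIndependent_iff'.1 hli _ _ h1
      rw [hab, h2, map_zero, zero_add]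
      refine Finset.sum_eq_zero fun i hi => ?_
      simp only [ih _ (hb i) (h3 i hi), zero_mul]
  intro a ha
  obtain ⟨n, hn⟩ := exists_Ad a
  exact key n a hn ha

lemma wfilt_self : WFilt (F := F) (Y := W) (E := FreeAlgebra F W) (Ad F W) (del F) where
  mono := Ad_mono
  zero := Ad_zero
  del := fun _ _ _ hv => del_Ad hv
  smul := fun y a m => del_mul y a m

lemma cmp_fl_mem (d : ℕ) (z : FreeLieAlgebra F W) : ∃ z', fl F W z' = cmp F W d (fl F W z) := by
  let T : ℕ → Submodule F (FreeLieAlgebra F W) := fun d =>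
    (sp F fun w : List W => w.length = d).comap (fl F W).toLinearMap
  have hT : ∀ i j, ∀ x ∈ T i, ∀ y ∈ T j, ⁅x, y⁆ ∈ T (i + j) := by
    intro i j x hx y hy
    change fl F W ⁅x, y⁆ ∈ sp F fun w : List W => w.length = i + j
    rw [LieHom.map_lie, LieRing.of_associative_ring_bracket]
    refine Submodule.sub_mem _ ?_ ?_
    · exact sp_mul (fun v w hv hw => by simp only [List.length_append]; omega) hx hy
    · exact sp_mul (fun v w hv hw => by simp only [List.length_append]; omega) hy hx
  have h1 : z ∈ gsub T hT := lsub_top _ (fun x => by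
    rw [mem_gsub]
    refine Submodule.mem_iSup_of_mem 1 ?_
    change fl F W (FreeLieAlgebra.of F x) ∈ sp F fun w : List W => w.length = 1
    rw [fl_of, ← bw_single]
    exact bw_mem (by simp)) z
  have h2 : (⨆ e, T e) ≤ (LinearMap.range (fl F W).toLinearMap).comap
      ((cmp F W d).comp (fl F W).toLinearMap) := by
    refine iSup_le fun e z hz => ?_
    change cmp F W d (fl F W z) ∈ LinearMap.range (fl F W).toLinearMap
    rw [cmp_of_sp (d := e) (a := fl F W z) hz]
    split_ifs
    · exact ⟨z, rfl⟩
    · exact Submodule.zero_mem _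
  exact h2 h1

lemma cmp_fl_lie {d e : ℕ} {s t : FreeLieAlgebra F W} (hs : fl F W s ∈ Ad F W (d + 1))
    (ht : fl F W t ∈ Ad F W (e + 1)) :
    cmp F W (d + e) (fl F W ⁅s, t⁆) = ⁅cmp F W d (fl F W s), cmp F W e (fl F W t)⁆ := by
  rw [LieHom.map_lie, LieRing.of_associative_ring_bracket, LieRing.of_associative_ring_bracket,
    map_sub, cmp_mul hs ht, add_comm d e, cmp_mul ht hs]

lemma fl_lie_Ad {d e : ℕ} {s t : FreeLieAlgebra F W} (hs : fl F W s ∈ Ad F W (d + 1))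
    (ht : fl F W t ∈ Ad F W (e + 1)) : fl F W ⁅s, t⁆ ∈ Ad F W (d + e + 1) := by
  rw [LieHom.map_lie, LieRing.of_associative_ring_bracket]
  refine Submodule.sub_mem _ (Ad_mul hs ht) ?_
  rw [add_comm d e]; exact Ad_mul ht hs

theorem sw (G : LieSubalgebra F (FreeLieAlgebra F W)) :
    ∃ (X : Type) (x : X → FreeLieAlgebra F W), (∀ i, x i ∈ G) ∧
      Function.Injective (FreeLieAlgebra.lift F x) ∧
      ∀ z ∈ G, z ∈ (FreeLieAlgebra.lift F x).range := by
  obtain ⟨X, ξ, deg, hN, hdeg, hli, hgen⟩ := sel (wfilt_self (F := F) (W := W))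
    (G.toSubmodule.map (fl F W).toLinearMap)
  choose x hxG hxξ using hN
  have hxξ' : ∀ i, fl F W (x i) = ξ i := hxξ
  refine ⟨X, x, hxG, ?_, ?_⟩
  · have hj : Function.Injective (FreeAlgebra.lift F ξ) :=
      lift_injective ξ (fun i => by rw [← hxξ', eps_fl]) hli
    have hc : ∀ z, fl F W (FreeLieAlgebra.lift F x z) = FreeAlgebra.lift F ξ (fl F X z) := by
      intro z
      have : (fl F W).comp (FreeLieAlgebra.lift F x) =
          (LieHom.comp (FreeAlgebra.lift F ξ : FreeAlgebra F X →ₗ⁅F⁆ FreeAlgebra F W) (fl F X)) := by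
        ext i : 1
        simp [hxξ']
      exact LieHom.congr_fun this z
    intro z z' h
    apply fl_injective
    apply hj
    rw [← hc, ← hc, h]
  · set S := (FreeLieAlgebra.lift F x).range with hS
    have hxS : ∀ i, x i ∈ S := fun i => ⟨FreeLieAlgebra.of F i, by simp⟩
    have hSG : ∀ s ∈ S, s ∈ G := by
      rintro _ ⟨z, rfl⟩
      exact lsub_top (G.comap (FreeLieAlgebra.lift F x)) (fun i => by simpa using hxG i) z
    let T : ℕ → Submodule F (FreeLieAlgebra F W) := fun e =>
      ((S.toSubmodule ⊓ (Ad F W (e + 1)).comap (fl F W).toLinearMap).map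
        ((cmp F W e).comp (fl F W).toLinearMap)).comap (fl F W).toLinearMap
    have hTmem : ∀ e z, z ∈ T e ↔ ∃ s, (s ∈ S ∧ fl F W s ∈ Ad F W (e + 1)) ∧
      cmp F W e (fl F W s) = fl F W z := fun e z => Iff.rfl
    have hT : ∀ i j, ∀ x ∈ T i, ∀ y ∈ T j, ⁅x, y⁆ ∈ T (i + j) := by
      intro i j x hx y hy
      rw [hTmem] at *
      obtain ⟨s, ⟨hs1, hs2⟩, hs3⟩ := hx
      obtain ⟨t, ⟨ht1, ht2⟩, ht3⟩ := hy
      refine ⟨⁅s, t⁆, ⟨S.lie_mem hs1 ht1, fl_lie_Ad hs2 ht2⟩, ?_⟩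
      rw [cmp_fl_lie hs2 ht2, hs3, ht3, LieHom.map_lie]
    have key : ∀ d, ∀ g ∈ G, fl F W g ∈ Ad F W d → g ∈ S := by
      intro d
      induction d using Nat.strong_induction_on with
      | _ d ih =>
      intro g hg hd
      rcases d with _ | d
      · rw [Ad_zero, Submodule.mem_bot] at hd
        have : g = 0 := fl_injective (by rw [hd, map_zero])
        rw [this]; exact S.zero_mem
      obtain ⟨u, hu, hlow⟩ := hgen d (fl F W g) ⟨⟨g, hg, rfl⟩, hd⟩
      have hu1 : u ∈ S.toSubmodule.map (fl F W).toLinearMap := by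
        refine Submodule.span_le.2 ?_ hu
        rintro _ ⟨i, -, rfl⟩
        exact ⟨x i, hxS i, hxξ' i⟩
      have hu2 : u ∈ Ad F W (d + 1) := by
        refine Submodule.span_le.2 ?_ hu
        rintro _ ⟨i, hi, rfl⟩
        rw [← show deg i = d from hi]
        exact hdeg i
      obtain ⟨u', hu'S, rfl⟩ := hu1
      have hu3 : fl F W u' ∈ Ad F W (d + 1) := hu2
      have hlow' : fl F W g - fl F W u' ∈ _ := hlow
      rw [← map_sub] at hlow'
      obtain ⟨g', hg'⟩ : ∃ g', g' = g - u' := ⟨_, rfl⟩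
      have hg'G : g' ∈ G := by rw [hg']; exact G.sub_mem hg (hSG _ hu'S)
      have hg'd : fl F W g' ∈ Ad F W (d + 1) := by
        rw [hg', map_sub]; exact Submodule.sub_mem _ hd hu3
      rw [← hg'] at hlow'
      suffices g' ∈ S by
        rw [show g = g' + u' by rw [hg']; simp]
        exact S.add_mem this hu'S
      obtain ⟨gb, hgb⟩ := cmp_fl_mem d g'
      have hgbH : gb ∈ gsub T hT := by
        refine mem_of_fl_mem_span _ ?_
        obtain ⟨l, hl, r, hr, hlr⟩ := Submodule.mem_sup.1 hlow'
        rw [hgb, ← hlr, map_add, cmp_Ad hr, add_zero]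
        have : Submodule.span F (lowSet (Y := W) (Ad F W)
            (G.toSubmodule.map (fl F W).toLinearMap) d) ≤
            ((Submodule.span (FreeAlgebra F W)
              (fl F W '' (gsub T hT : LieSubalgebra F (FreeLieAlgebra F W)))).restrictScalars F).comap (cmp F W d) := by
          refine Submodule.span_le.2 ?_
          rintro _ ⟨e, he, a, ha, m, ⟨⟨h, hhG, rfl⟩, hm⟩, rfl⟩
          change cmp F W d (a * fl F W h) ∈ Submodule.span (FreeAlgebra F W) _
          have hm' : fl F W h ∈ Ad F W (e + 1) := hm
          have ha' : a ∈ Ad F W (d - e + 1) := by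
            rw [show d - e + 1 = d + 1 - e by omega]; exact ha
          have := cmp_mul ha' hm'
          rw [show d - e + e = d by omega] at this
          rw [this]
          obtain ⟨hb, hhb⟩ := cmp_fl_mem e h
          rw [← hhb, ← smul_eq_mul]
          refine Submodule.smul_mem _ _ (Submodule.subset_span ⟨hb, ?_, rfl⟩)
          refine (mem_gsub T hT).2 (Submodule.mem_iSup_of_mem e ?_)
          rw [hTmem]
          exact ⟨h, ⟨ih (e + 1) (by omega) h hhG hm', hm'⟩, hhb.symm⟩
        exact this hl
      rw [mem_gsub] at hgbH
      have hQ : (⨆ e, T e) ≤ ((T d).map (fl F W).toLinearMap).comap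
          ((cmp F W d).comp (fl F W).toLinearMap) := by
        refine iSup_le fun e z hz => ?_
        obtain ⟨s, -, hs⟩ := (hTmem e z).1 hz
        change cmp F W d (fl F W z) ∈ (T d).map (fl F W).toLinearMap
        rw [cmp_of_sp (d := e) (by rw [← hs]; exact cmp_mem _ _)]
        split_ifs with h
        · rw [h]; exact ⟨z, hz, rfl⟩
        · exact Submodule.zero_mem _
      obtain ⟨z, hz, hz2⟩ := hQ hgbH
      obtain ⟨s, ⟨hsS, hsd⟩, hs⟩ := (hTmem d z).1 hz
      have hz3 : fl F W z = cmp F W d (fl F W gb) := hz2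
      rw [hgb, cmp_of_sp (cmp_mem d _), if_pos rfl] at hz3
      have : g' - s ∈ S := by
        refine ih d (Nat.lt_succ_self d) _ (G.sub_mem hg'G (hSG s hsS)) ?_
        refine mem_Ad_of_cmp ?_ ?_
        · rw [map_sub]; exact Submodule.sub_mem _ hg'd hsd
        · rw [map_sub, map_sub, hs, hz3, sub_self]
      rw [← sub_add_cancel g' s]
      exact S.add_mem this hsS
    intro z hz
    obtain ⟨n, hn⟩ := exists_Ad (fl F W z)
    exact key n z hz hn

end SW
end FreeLift

namespace FreeLift

attribute [local instance] LieRing.ofAssociativeRing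

section Alpha
variable {F : Type} [Field F] {Y : Type} {L : Type} [LieRing L] [LieAlgebra F L]

/-- the action of the free algebra through adjoint maps -/
noncomputable def alpha (F : Type) [Field F] {Y : Type} {L : Type} [LieRing L] [LieAlgebra F L]
    (x : Y → L) : FreeAlgebra F Y →ₐ[F] Module.End F L :=
  FreeAlgebra.lift F fun i => LieAlgebra.ad F L (x i)

lemma alpha_ι (x : Y → L) (i : Y) (z : L) : alpha F x (FreeAlgebra.ι F i) z = ⁅x i, z⁆ := by
  simp [alpha]

lemma alpha_fl (x : Y → L) (g : FreeLieAlgebra F Y) (z : L) :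
    alpha F x (fl F Y g) z = ⁅FreeLieAlgebra.lift F x g, z⁆ := by
  have : LieHom.comp (alpha F x : FreeAlgebra F Y →ₗ⁅F⁆ Module.End F L) (fl F Y) =
      (LieAlgebra.ad F L).comp (FreeLieAlgebra.lift F x) := by
    ext i : 1
    simp [alpha]
  have h := LieHom.congr_fun this g
  exact LinearMap.congr_fun h z

lemma alpha_stable (x : Y → L) (M : Submodule F L) (h : ∀ i, ∀ z ∈ M, ⁅x i, z⁆ ∈ M)
    (a : FreeAlgebra F Y) : ∀ z ∈ M, alpha F x a z ∈ M := by
  induction a using FreeAlgebra.induction with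
  | grade0 r => intro z hz; simpa [Module.algebraMap_end_apply] using M.smul_mem r hz
  | grade1 i => intro z hz; rw [alpha_ι]; exact h i z hz
  | mul a b ha hb => intro z hz; rw [map_mul]; exact ha _ (hb z hz)
  | add a b ha hb => intro z hz; rw [map_add]; exact M.add_mem (ha z hz) (hb z hz)

lemma alpha_map {L' : Type} [LieRing L'] [LieAlgebra F L'] (φ : L' →ₗ⁅F⁆ L) (x' : Y → L')
    (x : Y → L) (hx : ∀ i, φ (x' i) = x i) (a : FreeAlgebra F Y) :
    ∀ z, φ (alpha F x' a z) = alpha F x a (φ z) := by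
  induction a using FreeAlgebra.induction with
  | grade0 r => intro z; simp [Module.algebraMap_end_apply]
  | grade1 i => intro z; rw [alpha_ι, alpha_ι, LieHom.map_lie, hx]
  | mul a b ha hb => intro z; rw [map_mul, map_mul, Module.End.mul_apply, ha, hb]; rfl
  | add a b ha hb => intro z; rw [map_add, map_add, LinearMap.add_apply, map_add, ha, hb]; rfl

lemma alpha_lin {E : Type} [AddCommGroup E] [Module F E]
    [Module (FreeAlgebra F Y) E] [IsScalarTower F (FreeAlgebra F Y) E]
    (x : Y → L) (M : Submodule F L) (h : ∀ i, ∀ z ∈ M, ⁅x i, z⁆ ∈ M)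
    (D : L →ₗ[F] E) (hD : ∀ i, ∀ z ∈ M, D ⁅x i, z⁆ = FreeAlgebra.ι F i • D z)
    (a : FreeAlgebra F Y) : ∀ z ∈ M, D (alpha F x a z) = a • D z := by
  induction a using FreeAlgebra.induction with
  | grade0 r => intro z hz; simp [Module.algebraMap_end_apply]
  | grade1 i => intro z hz; rw [alpha_ι]; exact hD i z hz
  | mul a b ha hb =>
    intro z hz
    rw [map_mul, Module.End.mul_apply, ha _ (alpha_stable x M h b z hz), hb z hz, mul_smul]
  | add a b ha hb => intro z hz; rw [map_add, LinearMap.add_apply, map_add, ha z hz, hb z hz, add_smul]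

lemma lie_sup {I J : Type} {S : I → Submodule F L} {T : J → Submodule F L} {Q : Submodule F L}
    (h : ∀ i j, ∀ x ∈ S i, ∀ y ∈ T j, ⁅x, y⁆ ∈ Q) {x y : L} (hx : x ∈ ⨆ i, S i)
    (hy : y ∈ ⨆ j, T j) : ⁅x, y⁆ ∈ Q := by
  have h1 : ∀ i, ∀ x ∈ S i, ⁅x, y⁆ ∈ Q := by
    intro i x hx
    have : (⨆ j, T j) ≤ Q.comap (LieModule.toEnd F L L x : L →ₗ[F] L) :=
      iSup_le fun j y hy => h i j x hx y hy
    exact this hy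
  have : (⨆ i, S i) ≤ Q.comap (LieModule.toEnd F L L y : L →ₗ[F] L) := by
    refine iSup_le fun i x hx => ?_
    change ⁅y, x⁆ ∈ Q
    rw [← lie_skew]
    exact Submodule.neg_mem _ (h1 i x hx)
  rw [← lie_skew]
  exact Submodule.neg_mem _ (this hx)

end Alpha

section Der
variable {F : Type} [Field F] {W : Type} {A : Type} [Ring A] [Algebra F A]
  {E : Type} [AddCommGroup E] [Module F E] [Module A E] [IsScalarTower F A E]

lemma exists_der (P : FreeLieAlgebra F W →ₗ⁅F⁆ A) (f : W → E) :
    ∃ D : FreeLieAlgebra F W →ₗ[F] E, (∀ w, D (FreeLieAlgebra.of F w) = f w) ∧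
      ∀ x y, D ⁅x, y⁆ = P x • D y - P y • D x := by
  let ρ : FreeLieAlgebra F W →ₗ⁅F⁆ Module.End F (E × F) := FreeLieAlgebra.lift F fun w =>
    LinearMap.inl F E F ∘ₗ ((Algebra.lsmul F F E (P (FreeLieAlgebra.of F w))).coprod
      (LinearMap.toSpanSingleton F E (f w)))
  have hρ : ∀ w v c, ρ (FreeLieAlgebra.of F w) (v, c) =
      (P (FreeLieAlgebra.of F w) • v + c • f w, 0) := by
    intro w v c
    simp [ρ]
  let D : FreeLieAlgebra F W →ₗ[F] E :=
    LinearMap.fst F E F ∘ₗ (LinearMap.applyₗ ((0 : E), (1 : F))) ∘ₗ ρ.toLinearMap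
  have hD : ∀ x, D x = (ρ x (0, 1)).1 := fun x => rfl
  have hlie : ∀ x y v, ρ ⁅x, y⁆ v = ρ x (ρ y v) - ρ y (ρ x v) := by
    intro x y v
    rw [LieHom.map_lie, LieRing.of_associative_ring_bracket]; rfl
  let S : LieSubalgebra F (FreeLieAlgebra F W) :=
    { carrier := {x | ∀ v c, ρ x (v, c) = (P x • v + c • D x, 0)}
      add_mem' := by
        intro x y hx hy v c
        simp only [Set.mem_ofPred_eq] at hx hy
        rw [map_add, LinearMap.add_apply, hx, hy, map_add, map_add]
        simp [add_smul]; abel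
      zero_mem' := by intro v c; simp; rfl
      smul_mem' := by
        intro r x hx v c
        simp only [Set.mem_ofPred_eq] at hx
        rw [map_smul, LinearMap.smul_apply, hx, map_smul, map_smul]
        simp [smul_comm r c]
      lie_mem' := by
        intro x y hx hy v c
        change ∀ v c, ρ x (v, c) = (P x • v + c • D x, 0) at hx
        change ∀ v c, ρ y (v, c) = (P y • v + c • D y, 0) at hy
        have h1 : D ⁅x, y⁆ = P x • D y - P y • D x := by
          rw [hD, hlie, hx 0 1, hy 0 1, hx, hy]; simp
        rw [hlie, hx, hy, hx, hy, h1, LieHom.map_lie, LieRing.of_associative_ring_bracket]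
        have sc : ∀ (a : A) (c : F) (v : E), a • c • v = c • a • v := by
          intro a c v
          rw [← algebraMap_smul A c v, ← algebraMap_smul A c (a • v), ← mul_smul, ← mul_smul,
            Algebra.commutes]
        simp [sub_smul, mul_smul, smul_sub, sc]; abel }
  have hS : ∀ x, ∀ v c, ρ x (v, c) = (P x • v + c • D x, 0) := fun x =>
    lsub_top S (fun w v c => by
      rw [hρ, hD, hρ]; simp) x
  refine ⟨D, fun w => by rw [hD, hρ]; simp, fun x y => ?_⟩
  rw [hD, hlie, hS x 0 1, hS y 0 1, hS, hS]; simp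

end Der

end FreeLift

namespace FreeLift

attribute [local instance] LieRing.ofAssociativeRing

section Grading
variable {F : Type} [Field F] {L : Type} [LieRing L] [LieAlgebra F L]

/-- A nonnegative grading with its projections. -/
structure Grd (R : ℕ → Submodule F L) (cp : ℕ → L →ₗ[F] L) : Prop where
  mem : ∀ n x, cp n x ∈ R n
  self : ∀ n, ∀ x ∈ R n, cp n x = x
  ne : ∀ m n, m ≠ n → ∀ x ∈ R n, cp m x = 0
  top : ⨆ n, R n = ⊤
  lie : ∀ m n, ∀ x ∈ R m, ∀ y ∈ R n, ⁅x, y⁆ ∈ R (m + n)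

/-- positive part -/
def Np (R : ℕ → Submodule F L) : Submodule F L := ⨆ i, R (i + 1)

/-- commutators of the positive part -/
def Cm (N : Submodule F L) : Submodule F L := Submodule.span F {z | ∃ u ∈ N, ∃ v ∈ N, z = ⁅u, v⁆}

lemma lie_mem_Cm {N : Submodule F L} {u v : L} (hu : u ∈ N) (hv : v ∈ N) : ⁅u, v⁆ ∈ Cm N :=
  Submodule.subset_span ⟨u, hu, v, hv, rfl⟩

lemma Cm_le {N Q : Submodule F L} (h : ∀ u ∈ N, ∀ v ∈ N, ⁅u, v⁆ ∈ Q) : Cm N ≤ Q := by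
  refine Submodule.span_le.2 ?_
  rintro _ ⟨u, hu, v, hv, rfl⟩
  exact h u hu v hv

lemma lie_Cm {N : Submodule F L} (x : L) (hx : ∀ n ∈ N, ⁅x, n⁆ ∈ N) :
    ∀ c ∈ Cm N, ⁅x, c⁆ ∈ Cm N := by
  have : Cm N ≤ (Cm N).comap (LieModule.toEnd F L L x : L →ₗ[F] L) := by
    refine Cm_le fun u hu v hv => ?_
    change ⁅x, ⁅u, v⁆⁆ ∈ Cm N
    rw [leibniz_lie]
    exact Submodule.add_mem _ (lie_mem_Cm (hx u hu) hv) (lie_mem_Cm hu (hx v hv))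
  exact fun c hc => this hc

variable {R : ℕ → Submodule F L} {cp : ℕ → L →ₗ[F] L}

lemma R_le_Np (n : ℕ) : R (n + 1) ≤ Np R := le_iSup (fun i => R (i + 1)) n

namespace Grd

lemma sub_mem_Np (h : Grd R cp) (x : L) : x - cp 0 x ∈ Np R := by
  have : (⨆ n, R n) ≤ (Np R).comap (LinearMap.id - cp 0) := by
    refine iSup_le fun n x hx => ?_
    change x - cp 0 x ∈ Np R
    rcases n with _ | n
    · rw [h.self 0 x hx, sub_self]; exact Submodule.zero_mem _
    · rw [h.ne 0 (n + 1) (by omega) x hx, sub_zero]; exact R_le_Np n hx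
  exact this (by rw [h.top]; trivial)

lemma cp0_Np (h : Grd R cp) {x : L} (hx : x ∈ Np R) : cp 0 x = 0 := by
  have : Np R ≤ LinearMap.ker (cp 0) :=
    iSup_le fun n x hx => h.ne 0 (n + 1) (by omega) x hx
  exact this hx

lemma lie_Np (h : Grd R cp) (x : L) {y : L} (hy : y ∈ Np R) : ⁅x, y⁆ ∈ Np R := by
  refine lie_sup (S := R) (T := fun i => R (i + 1)) (fun i j x hx y hy => ?_)
    (by rw [h.top]; trivial) hy
  exact R_le_Np (i + j) (h.lie i (j + 1) x hx y hy)

lemma cp0_lie (h : Grd R cp) (x y : L) : cp 0 ⁅x, y⁆ = ⁅cp 0 x, cp 0 y⁆ := by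
  have e : ⁅x, y⁆ = ⁅cp 0 x, cp 0 y⁆ + (⁅cp 0 x, y - cp 0 y⁆ - ⁅y, x - cp 0 x⁆) := by
    rw [← lie_skew y (x - cp 0 x)]
    simp only [lie_sub, sub_lie]; abel
  rw [e, map_add, h.cp0_Np (Submodule.sub_mem _ (h.lie_Np _ (h.sub_mem_Np y))
    (h.lie_Np _ (h.sub_mem_Np x))), add_zero]
  exact h.self 0 _ (h.lie 0 0 _ (h.mem 0 x) _ (h.mem 0 y))

lemma Cm_le_Np (h : Grd R cp) : Cm (Np R) ≤ Np R := Cm_le fun u _ _ hv => h.lie_Np u hv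

lemma cp_Cm (h : Grd R cp) {n : ℕ} {Q : Submodule F L}
    (hQ : ∀ i j, i + j + 2 = n → ∀ a ∈ R (i + 1), ∀ b ∈ R (j + 1), ⁅a, b⁆ ∈ Q)
    {c : L} (hc : c ∈ Cm (Np R)) : cp n c ∈ Q := by
  have : Cm (Np R) ≤ Q.comap (cp n) := by
    refine Cm_le fun u hu v hv => ?_
    refine lie_sup (S := fun i => R (i + 1)) (T := fun i => R (i + 1)) ?_ hu hv
    intro i j a ha b hb
    change cp n ⁅a, b⁆ ∈ Q
    have hab := h.lie _ _ a ha b hb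
    by_cases hn : i + j + 2 = n
    · rw [show i + 1 + (j + 1) = n by omega] at hab
      rw [h.self n _ hab]
      exact hQ i j hn a ha b hb
    · rw [h.ne n _ (by omega) _ hab]; exact Submodule.zero_mem _
  exact this hc

end Grd
end Grading

section HG
variable {F : Type} [Field F] {W : Type}

open Classical in
theorem hg1 {R : ℕ → Submodule F (FreeLieAlgebra F W)}
    {cp : ℕ → FreeLieAlgebra F W →ₗ[F] FreeLieAlgebra F W} (h : Grd R cp) :
    ∃ (Y : Type) (x0 : Y → FreeLieAlgebra F W) (ι : ℕ → Type)
      (x1 : (Σ n, ι n) → FreeLieAlgebra F W),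
      (∀ i, x0 i ∈ R 0) ∧ Function.Injective (FreeLieAlgebra.lift F x0) ∧
      (∀ z ∈ R 0, ∃ g, FreeLieAlgebra.lift F x0 g = z) ∧ (∀ i, x1 i ∈ R (i.1 + 1)) ∧
      (∀ n, ∀ z ∈ R (n + 1),
        ∃ s ∈ Submodule.span F {y | ∃ a i, i.1 = n ∧ y = alpha F x0 a (x1 i)},
          z - s ∈ Cm (Np R)) ∧
      (∀ (s : Finset (Σ n, ι n)) (a : (Σ n, ι n) → FreeAlgebra F Y),
        ∑ i ∈ s, alpha F x0 (a i) (x1 i) ∈ Cm (Np R) → ∀ i ∈ s, a i = 0) := by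
  -- degree zero
  let G : LieSubalgebra F (FreeLieAlgebra F W) :=
    { R 0 with lie_mem' := fun {x y} hx hy => h.lie 0 0 x hx y hy }
  obtain ⟨Y, x0, hx0, hinj, hsurj⟩ := sw G
  have hx0' : ∀ i, x0 i ∈ R 0 := hx0
  have hsurj' : ∀ z ∈ R 0, ∃ g, FreeLieAlgebra.lift F x0 g = z := fun z hz => hsurj z hz
  have hlam : ∀ g, FreeLieAlgebra.lift F x0 g ∈ R 0 := fun g =>
    lsub_top (G.comap (FreeLieAlgebra.lift F x0)) (fun i => by simpa using hx0 i) g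
  -- the retraction
  choose s0 hs0 using fun w => hsurj' (cp 0 (FreeLieAlgebra.of F w)) (h.mem 0 _)
  let s : FreeLieAlgebra F W →ₗ⁅F⁆ FreeLieAlgebra F Y := FreeLieAlgebra.lift F s0
  have hs : ∀ z, FreeLieAlgebra.lift F x0 (s z) = cp 0 z := by
    intro z
    let p : FreeLieAlgebra F W →ₗ⁅F⁆ FreeLieAlgebra F W :=
      { cp 0 with map_lie' := fun {x y} => h.cp0_lie x y }
    have : (FreeLieAlgebra.lift F x0).comp s = p := by
      ext w : 1
      have : p (FreeLieAlgebra.of F w) = cp 0 (FreeLieAlgebra.of F w) := rfl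
      rw [this, ← hs0]
      simp [s]
    exact LieHom.congr_fun this z
  have hsN : ∀ z ∈ Np R, s z = 0 := by
    intro z hz
    apply hinj
    rw [hs, h.cp0_Np hz, map_zero]
  have hsx : ∀ i, s (x0 i) = FreeLieAlgebra.of F i := by
    intro i
    apply hinj
    rw [hs, h.self 0 _ (hx0' i), FreeLieAlgebra.lift_of_apply]
  let P : FreeLieAlgebra F W →ₗ⁅F⁆ FreeAlgebra F Y := (fl F Y).comp s
  have hP : ∀ z, P z = fl F Y (s z) := fun _ => rfl
  have hPN : ∀ z ∈ Np R, P z = 0 := fun z hz => by rw [hP, hsN z hz, map_zero]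
  obtain ⟨D, hDw, hDlie⟩ := exists_der P (fun w => (Finsupp.single w 1 : W →₀ FreeAlgebra F Y))
  have hstN : ∀ i, ∀ z ∈ Np R, ⁅x0 i, z⁆ ∈ Np R := fun i z hz => h.lie_Np _ hz
  have hstR : ∀ n i, ∀ z ∈ R n, ⁅x0 i, z⁆ ∈ R n := fun n i z hz => by
    simpa using h.lie 0 n _ (hx0' i) z hz
  have hDα : ∀ a, ∀ z ∈ Np R, D (alpha F x0 a z) = a • D z := by
    intro a z hz
    refine alpha_lin x0 (Np R) hstN D (fun i z hz => ?_) a z hz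
    rw [hDlie, hPN z hz, zero_smul, sub_zero, hP, hsx, fl_of]
  have hDC : ∀ z ∈ Cm (Np R), D z = 0 := by
    have : Cm (Np R) ≤ LinearMap.ker D := by
      refine Cm_le fun u hu v hv => ?_
      rw [LinearMap.mem_ker, hDlie, hPN u hu, hPN v hv]; simp
    exact fun z hz => this hz
  have hαP : ∀ x z, alpha F x0 (P x) z = ⁅cp 0 x, z⁆ := by
    intro x z
    rw [hP, alpha_fl, hs]
  -- the partial inverse
  let θ : (W →₀ FreeAlgebra F Y) →ₗ[F] FreeLieAlgebra F W := Finsupp.lsum F fun w =>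
    (LinearMap.applyₗ (FreeLieAlgebra.of F w - cp 0 (FreeLieAlgebra.of F w))) ∘ₗ
      (alpha F x0).toLinearMap
  have hθs : ∀ w a, θ (Finsupp.single w a) =
      alpha F x0 a (FreeLieAlgebra.of F w - cp 0 (FreeLieAlgebra.of F w)) := by
    intro w a
    simp [θ]
  have hθ : ∀ (a : FreeAlgebra F Y) (v : W →₀ FreeAlgebra F Y), θ (a • v) = alpha F x0 a (θ v) := by
    intro a v
    induction v using Finsupp.induction_linear with
    | zero => simp
    | add f g hf hg => rw [smul_add, map_add, map_add, hf, hg, map_add]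
    | single w b => rw [Finsupp.smul_single, hθs, hθs, smul_eq_mul, map_mul]; rfl
  have hstC : ∀ x, ∀ c ∈ Cm (Np R), ⁅x, c⁆ ∈ Cm (Np R) := fun x =>
    lie_Cm x (fun n hn => h.lie_Np x hn)
  have hθD : ∀ x, θ (D x) - (x - cp 0 x) ∈ Cm (Np R) := by
    let S : LieSubalgebra F (FreeLieAlgebra F W) :=
      { (Cm (Np R)).comap (θ ∘ₗ D - (LinearMap.id - cp 0)) with
        lie_mem' := by
          intro x y hx hy
          change θ (D x) - (x - cp 0 x) ∈ Cm (Np R) at hx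
          change θ (D y) - (y - cp 0 y) ∈ Cm (Np R) at hy
          change θ (D ⁅x, y⁆) - (⁅x, y⁆ - cp 0 ⁅x, y⁆) ∈ Cm (Np R)
          have e : θ (D ⁅x, y⁆) - (⁅x, y⁆ - cp 0 ⁅x, y⁆) =
              ⁅cp 0 x, θ (D y) - (y - cp 0 y)⁆ - ⁅cp 0 y, θ (D x) - (x - cp 0 x)⁆
              - ⁅x - cp 0 x, y - cp 0 y⁆ := by
            rw [hDlie, map_sub, hθ, hθ, hαP, hαP, h.cp0_lie]
            simp only [lie_sub, sub_lie]
            rw [← lie_skew (cp 0 y) x, ← lie_skew (cp 0 y) (cp 0 x)]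
            abel
          rw [e]
          exact Submodule.sub_mem _ (Submodule.sub_mem _ (hstC _ _ hy) (hstC _ _ hx))
            (lie_mem_Cm (h.sub_mem_Np x) (h.sub_mem_Np y)) }
    intro x
    refine lsub_top S (fun w => ?_) x
    change θ (D _) - (FreeLieAlgebra.of F w - cp 0 (FreeLieAlgebra.of F w)) ∈ Cm (Np R)
    rw [hDw, hθs, map_one, Module.End.one_apply, sub_self]
    exact Submodule.zero_mem _
  have hkerD : ∀ z ∈ Np R, D z = 0 → z ∈ Cm (Np R) := by
    intro z hz h0
    have := hθD z
    rw [h0, h.cp0_Np hz] at this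
    simpa using this
  -- choice of generators
  let M : ℕ → Submodule (FreeAlgebra F Y) (W →₀ FreeAlgebra F Y) := fun n =>
    { (R (n + 1)).map D with
      smul_mem' := by
        rintro a _ ⟨z, hz, rfl⟩
        exact ⟨alpha F x0 a z, alpha_stable x0 _ (hstR (n + 1)) a z hz,
          hDα a z (R_le_Np n hz)⟩ }
  choose ι ξ hξM hξli hξspan using fun n => submodule_free W (M n)
  have hξM' : ∀ n i, ∃ z ∈ R (n + 1), D z = ξ n i := fun n i => hξM n i
  choose x1 hx1R hx1D using hξM'
  have hαR : ∀ a (i : Σ n, ι n), alpha F x0 a (x1 i.1 i.2) ∈ R (i.1 + 1) := fun a i =>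
    alpha_stable x0 _ (hstR (i.1 + 1)) a _ (hx1R i.1 i.2)
  refine ⟨Y, x0, ι, fun i => x1 i.1 i.2, hx0', hinj, hsurj', fun i => hx1R i.1 i.2, ?_, ?_⟩
  · intro n z hz
    have h1 : D z ∈ Submodule.span (FreeAlgebra F Y) (Set.range (ξ n)) := by
      rw [hξspan]; exact ⟨z, hz, rfl⟩
    rw [Finsupp.mem_span_range_iff_exists_finsupp] at h1
    obtain ⟨c, hc⟩ := h1
    refine ⟨∑ i ∈ c.support, alpha F x0 (c i) (x1 n i), Submodule.sum_mem _ fun i _ =>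
      Submodule.subset_span ⟨c i, ⟨n, i⟩, rfl, rfl⟩, ?_⟩
    refine hkerD _ (Submodule.sub_mem _ (R_le_Np n hz) (Submodule.sum_mem _ fun i _ =>
      R_le_Np n (hαR (c i) ⟨n, i⟩))) ?_
    rw [map_sub, ← hc, map_sum, Finsupp.sum, sub_eq_zero]
    refine Finset.sum_congr rfl fun i _ => ?_
    rw [hDα _ _ (R_le_Np n (hx1R n i)), hx1D]
  · intro t a hsum i hi
    obtain ⟨n, j⟩ := i
    have hcp : cp (n + 1) (∑ i ∈ t, alpha F x0 (a i) (x1 i.1 i.2)) ∈ Cm (Np R) :=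
      h.cp_Cm (fun i j _ a ha b hb => lie_mem_Cm (R_le_Np i ha) (R_le_Np j hb)) hsum
    have h1 : ∑ k ∈ t.preimage (Sigma.mk n) (sigma_mk_injective.injOn),
        alpha F x0 (a ⟨n, k⟩) (x1 n k) = cp (n + 1) (∑ i ∈ t, alpha F x0 (a i) (x1 i.1 i.2)) := by
      rw [map_sum, ← Finset.sum_preimage (Sigma.mk n) t (sigma_mk_injective.injOn)]
      · refine Finset.sum_congr rfl fun k _ => ?_
        rw [h.self _ _ (hαR _ ⟨n, k⟩)]
      · intro i _ hi
        rw [h.ne (n + 1) (i.1 + 1) _ _ (hαR _ i)]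
        intro he
        have he' : n = i.1 := by omega
        subst he'
        exact hi ⟨i.2, rfl⟩
    rw [← h1] at hcp
    have h2 := hDC _ hcp
    rw [map_sum] at h2
    have h3 : ∑ k ∈ t.preimage (Sigma.mk n) (sigma_mk_injective.injOn), a ⟨n, k⟩ • ξ n k = 0 := by
      rw [← h2]
      refine Finset.sum_congr rfl fun k _ => ?_
      rw [hDα _ _ (R_le_Np n (hx1R n k)), hx1D]
    exact linearIndependent_iff'.1 (hξli n) _ _ h3 j (Finset.mem_preimage.2 hi)

end HG
end FreeLift

namespace FreeLift

attribute [local instance] LieRing.ofAssociativeRing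

section HG2
variable {F : Type} [Field F] {W : Type}

lemma hg2_surj {R : ℕ → Submodule F (FreeLieAlgebra F W)}
    {cp : ℕ → FreeLieAlgebra F W →ₗ[F] FreeLieAlgebra F W} (h : Grd R cp)
    {Y : Type} {x0 : Y → FreeLieAlgebra F W} {ι : ℕ → Type}
    {x1 : (Σ n, ι n) → FreeLieAlgebra F W} (hx0 : ∀ i, x0 i ∈ R 0)
    (hx1 : ∀ i, x1 i ∈ R (i.1 + 1))
    (hspan : ∀ n, ∀ z ∈ R (n + 1),
        ∃ s ∈ Submodule.span F {y | ∃ a i, i.1 = n ∧ y = alpha F x0 a (x1 i)},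
          z - s ∈ Cm (Np R))
    (S : LieSubalgebra F (FreeLieAlgebra F W)) (hS0 : R 0 ≤ S.toSubmodule)
    (hS1 : ∀ i, x1 i ∈ S) (z : FreeLieAlgebra F W) : z ∈ S := by
  have hall : ∀ n, R n ≤ S.toSubmodule := by
    intro n
    induction n using Nat.strong_induction_on with
    | _ n ih =>
      rcases n with _ | n
      · exact hS0
      intro z hz
      obtain ⟨s, hs, hzs⟩ := hspan n z hz
      have hsS : s ∈ S.toSubmodule := by
        refine Submodule.span_le.2 ?_ hs
        rintro _ ⟨a, i, -, rfl⟩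
        exact alpha_stable x0 S.toSubmodule (fun i z hz => S.lie_mem (hS0 (hx0 i)) hz) a _ (hS1 i)
      have hsR : s ∈ R (n + 1) := by
        refine Submodule.span_le.2 ?_ hs
        rintro _ ⟨a, i, rfl, rfl⟩
        refine alpha_stable x0 (R (i.1 + 1)) (fun j z hz => ?_) a _ (hx1 i)
        simpa using h.lie 0 _ _ (hx0 j) z hz
      have h1 : cp (n + 1) (z - s) ∈ S.toSubmodule := by
        refine h.cp_Cm (fun i j hij a ha b hb => ?_) hzs
        exact S.lie_mem (ih (i + 1) (by omega) ha) (ih (j + 1) (by omega) hb)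
      rw [h.self _ _ (Submodule.sub_mem _ hz hsR)] at h1
      have := Submodule.add_mem _ h1 hsS
      rwa [sub_add_cancel] at this
  have : z ∈ ⨆ n, R n := by rw [h.top]; trivial
  exact iSup_le hall this

/-- at least `m` letters from the right summand -/
noncomputable def Am (F : Type) [Field F] (Y I : Type) (m : ℕ) : Submodule F (FreeAlgebra F (Y ⊕ I)) :=
  sp F fun w : List (Y ⊕ I) => m ≤ (w.filter Sum.isRight).length

lemma Am_mul {Y I : Type} {m n k : ℕ} (hk : k ≤ m + n) {a b : FreeAlgebra F (Y ⊕ I)}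
    (ha : a ∈ Am F Y I m) (hb : b ∈ Am F Y I n) : a * b ∈ Am F Y I k :=
  sp_mul (fun v w hv hw => by rw [List.filter_append, List.length_append]; omega) ha hb

lemma Am_lie {Y I : Type} {m n k : ℕ} (hk : k ≤ m + n) {a b : FreeAlgebra F (Y ⊕ I)}
    (ha : a ∈ Am F Y I m) (hb : b ∈ Am F Y I n) : ⁅a, b⁆ ∈ Am F Y I k := by
  rw [LieRing.of_associative_ring_bracket]
  exact Submodule.sub_mem _ (Am_mul hk ha hb) (Am_mul (by omega) hb ha)

lemma Am_zero {Y I : Type} (a : FreeAlgebra F (Y ⊕ I)) : a ∈ Am F Y I 0 :=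
  sp_mono (fun _ _ => Nat.zero_le _) (sp_true a)

lemma Am_inf {Y I : Type} {a : FreeAlgebra F (Y ⊕ I)} (h : ∀ m, a ∈ Am F Y I m) : a = 0 :=
  eq_zero_of_wc fun w => wc_eq_zero
    (P := fun v : List (Y ⊕ I) => w.length + 1 ≤ (v.filter Sum.isRight).length)
    (by have := List.length_filter_le Sum.isRight w; omega) (h (w.length + 1))

theorem hg2 {R : ℕ → Submodule F (FreeLieAlgebra F W)}
    {cp : ℕ → FreeLieAlgebra F W →ₗ[F] FreeLieAlgebra F W} (h : Grd R cp) :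
    ∃ (X : Type) (x : X → FreeLieAlgebra F W) (d : X → ℕ),
      (∀ i, x i ∈ R (d i)) ∧ Function.Bijective (FreeLieAlgebra.lift F x) := by
  classical
  obtain ⟨Y, x0, ι, x1, hx0, hinj, hsurj, hx1, hspan, hli⟩ := hg1 h
  let I := Σ n, ι n
  let X := Y ⊕ I
  let x : X → FreeLieAlgebra F W := Sum.elim x0 x1
  let φ : FreeLieAlgebra F X →ₗ⁅F⁆ FreeLieAlgebra F W := FreeLieAlgebra.lift F x
  let o0 : Y → FreeLieAlgebra F X := fun i => FreeLieAlgebra.of F (Sum.inl i)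
  let o1 : I → FreeLieAlgebra F X := fun i => FreeLieAlgebra.of F (Sum.inr i)
  have hφ0 : ∀ i, φ (o0 i) = x0 i := fun i => by simp [φ, o0, x]
  have hφ1 : ∀ i, φ (o1 i) = x1 i := fun i => by simp [φ, o1, x]
  let μ : FreeLieAlgebra F Y →ₗ⁅F⁆ FreeLieAlgebra F X := FreeLieAlgebra.lift F o0
  have hφμ : ∀ g, φ (μ g) = FreeLieAlgebra.lift F x0 g := by
    intro g
    have : φ.comp μ = FreeLieAlgebra.lift F x0 := by
      ext i : 1
      simp [μ, hφ0]
    exact LieHom.congr_fun this g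
  have hsur : Function.Surjective φ := by
    intro z
    refine (LieHom.mem_range φ z).1 (hg2_surj h hx0 hx1 hspan φ.range ?_ ?_ z)
    · intro z hz
      obtain ⟨g, rfl⟩ := hsurj z hz
      exact (LieHom.mem_range φ _).2 ⟨μ g, hφμ g⟩
    · intro i
      exact (LieHom.mem_range φ _).2 ⟨o1 i, hφ1 i⟩
  refine ⟨X, x, Sum.elim (fun _ => 0) (fun i => i.1 + 1), ?_, ?_, hsur⟩
  · rintro (i | i)
    · exact hx0 i
    · exact hx1 i
  have hlam : ∀ g, FreeLieAlgebra.lift F x0 g ∈ R 0 := fun g =>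
    lsub_top (LieSubalgebra.comap (FreeLieAlgebra.lift F x0)
      { R 0 with lie_mem' := fun {x y} hx hy => h.lie 0 0 x hx y hy })
      (fun i => by
        change FreeLieAlgebra.lift F x0 (FreeLieAlgebra.of F i) ∈ R 0
        rw [FreeLieAlgebra.lift_of_apply]; exact hx0 i) g
  let N : Submodule F (FreeLieAlgebra F X) :=
    (Np R).comap φ.toLinearMap ⊓ (Am F Y I 1).comap (fl F X).toLinearMap
  have hN : ∀ z, z ∈ N ↔ φ z ∈ Np R ∧ fl F X z ∈ Am F Y I 1 := fun z => Iff.rfl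
  have hNlie : ∀ z : FreeLieAlgebra F X, ∀ n ∈ N, ⁅z, n⁆ ∈ N := by
    intro z n hn
    rw [hN] at hn ⊢
    rw [LieHom.map_lie, LieHom.map_lie]
    exact ⟨h.lie_Np _ hn.1, Am_lie (m := 0) (by omega) (Am_zero _) hn.2⟩
  have hCN : Cm N ≤ N := Cm_le fun u _ v hv => hNlie u v hv
  have hClie : ∀ z : FreeLieAlgebra F X, ∀ c ∈ Cm N, ⁅z, c⁆ ∈ Cm N := fun z => lie_Cm z (hNlie z)
  have hφC : ∀ c ∈ Cm N, φ c ∈ Cm (Np R) := by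
    have : Cm N ≤ (Cm (Np R)).comap φ.toLinearMap := by
      refine Cm_le fun u hu v hv => ?_
      change φ ⁅u, v⁆ ∈ Cm (Np R)
      rw [LieHom.map_lie]
      exact lie_mem_Cm ((hN u).1 hu).1 ((hN v).1 hv).1
    exact fun c hc => this hc
  have hoN : ∀ i, o1 i ∈ N := by
    intro i
    rw [hN, hφ1, fl_of]
    refine ⟨R_le_Np _ (hx1 i), ?_⟩
    rw [← bw_single]
    exact bw_mem (P := fun w : List (Y ⊕ I) => 1 ≤ (w.filter Sum.isRight).length)
      (w := [Sum.inr i]) (le_refl 1)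
  -- the span of the new generators
  let θ : (I →₀ FreeAlgebra F Y) →ₗ[F] FreeLieAlgebra F X := Finsupp.lsum F fun i =>
    (LinearMap.applyₗ (o1 i)) ∘ₗ (alpha F o0).toLinearMap
  have hθs : ∀ i a, θ (Finsupp.single i a) = alpha F o0 a (o1 i) := by
    intro w a
    simp [θ]
  have hθsum : ∀ f, θ f = ∑ i ∈ f.support, alpha F o0 (f i) (o1 i) := by
    intro f
    simp [θ, Finsupp.sum]
  have hθ : ∀ (a : FreeAlgebra F Y) (v : I →₀ FreeAlgebra F Y), θ (a • v) = alpha F o0 a (θ v) := by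
    intro a v
    induction v using Finsupp.induction_linear with
    | zero => simp
    | add f g hf hg => rw [smul_add, map_add, map_add, hf, hg, map_add]
    | single w b => rw [Finsupp.smul_single, hθs, hθs, smul_eq_mul, map_mul]; rfl
  have hθN : ∀ f, θ f ∈ N := by
    intro f
    rw [hθsum]
    exact Submodule.sum_mem _ fun i _ => alpha_stable o0 N (fun i z hz => hNlie _ z hz) _ _ (hoN i)
  let M : Submodule F (FreeLieAlgebra F X) := LinearMap.range θ ⊔ Cm N
  have hMN : M ≤ N := sup_le (by rintro _ ⟨f, rfl⟩; exact hθN f) hCN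
  have hMμ : ∀ g, ∀ m ∈ M, ⁅μ g, m⁆ ∈ M := by
    intro g m hm
    obtain ⟨_, ⟨f, rfl⟩, c, hc, rfl⟩ := Submodule.mem_sup.1 hm
    rw [lie_add]
    refine Submodule.add_mem_sup ?_ (hClie _ c hc)
    have : ⁅μ g, θ f⁆ = θ (fl F Y g • f) := by rw [hθ, alpha_fl]
    rw [this]
    exact ⟨_, rfl⟩
  let Z : LieSubalgebra F (FreeLieAlgebra F X) :=
    { LinearMap.range μ.toLinearMap ⊔ M with
      lie_mem' := by
        intro a b ha hb
        obtain ⟨_, ⟨g, rfl⟩, m, hm, rfl⟩ := Submodule.mem_sup.1 ha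
        obtain ⟨_, ⟨g', rfl⟩, m', hm', rfl⟩ := Submodule.mem_sup.1 hb
        have e : ⁅μ g + m, μ g' + m'⁆ = μ ⁅g, g'⁆ + (⁅μ g, m'⁆ - ⁅μ g', m⁆ + ⁅m, m'⁆) := by
          rw [LieHom.map_lie, ← lie_skew (μ g') m]
          simp only [lie_add, add_lie]; abel
        change ⁅μ g + m, μ g' + m'⁆ ∈ LinearMap.range μ.toLinearMap ⊔ M
        rw [e]
        refine Submodule.add_mem_sup ⟨_, rfl⟩ (Submodule.add_mem _ (Submodule.sub_mem _
          (hMμ g m' hm') (hMμ g' m hm)) ?_)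
        exact Submodule.mem_sup_right (lie_mem_Cm (hMN hm) (hMN hm')) }
  have hZ : ∀ z, ∃ g f, ∃ c ∈ Cm N, z = μ g + (θ f + c) := by
    intro z
    have hz : z ∈ LinearMap.range μ.toLinearMap ⊔ M := by
      refine lsub_top Z ?_ z
      rintro (i | i)
      · refine Submodule.mem_sup_left ⟨FreeLieAlgebra.of F i, ?_⟩
        change μ (FreeLieAlgebra.of F i) = _
        rw [FreeLieAlgebra.lift_of_apply]
      · refine Submodule.mem_sup_right (Submodule.mem_sup_left ⟨Finsupp.single i 1, ?_⟩)
        rw [hθs, map_one]; rfl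
    obtain ⟨_, ⟨g, rfl⟩, m, hm, rfl⟩ := Submodule.mem_sup.1 hz
    obtain ⟨_, ⟨f, rfl⟩, c, hc, rfl⟩ := Submodule.mem_sup.1 hm
    exact ⟨g, f, c, hc, rfl⟩
  have hkerC : ∀ k, φ k = 0 → k ∈ Cm N := by
    intro k hk
    obtain ⟨g, f, c, hc, rfl⟩ := hZ k
    have hg : g = 0 := by
      apply hinj
      have := congrArg (cp 0) hk
      rw [map_add, map_add, hφμ, h.self 0 _ (hlam g),
        h.cp0_Np ((hN _).1 (Submodule.add_mem _ (hθN f) (hCN hc))).1, add_zero, map_zero] at this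
      rw [this, map_zero]
    rw [hg, map_zero, zero_add] at hk ⊢
    have h1 : ∑ i ∈ f.support, alpha F x0 (f i) (x1 i) ∈ Cm (Np R) := by
      have e : ∑ i ∈ f.support, alpha F x0 (f i) (x1 i) = φ (θ f) := by
        rw [hθsum, map_sum]
        refine Finset.sum_congr rfl fun i _ => ?_
        rw [alpha_map φ o0 x0 hφ0, hφ1]
      rw [e]
      rw [map_add] at hk
      rw [eq_neg_of_add_eq_zero_left hk]
      exact Submodule.neg_mem _ (hφC c hc)
    have h2 : f = 0 := by
      ext i
      by_cases hi : i ∈ f.support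
      · rw [hli _ _ h1 i hi]; rfl
      · simpa using hi
    rw [h2, map_zero, zero_add]
    exact hc
  -- a section
  choose sec hsec using hsur
  let ψ : FreeLieAlgebra F W →ₗ⁅F⁆ FreeLieAlgebra F X :=
    FreeLieAlgebra.lift F fun w => sec (FreeLieAlgebra.of F w)
  have hφψ : ∀ z, φ (ψ z) = z := by
    intro z
    have : φ.comp ψ = LieHom.id := by
      ext w : 1
      simp [ψ, hsec]
    exact LieHom.congr_fun this z
  let Ψ : FreeLieAlgebra F X →ₗ⁅F⁆ FreeLieAlgebra F X := ψ.comp φ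
  have hΨ : ∀ z, φ (z - Ψ z) = 0 := by
    intro z
    have : Ψ z = ψ (φ z) := rfl
    rw [map_sub, this, hφψ, sub_self]
  have hΨN : ∀ u ∈ N, Ψ u ∈ N := by
    intro u hu
    have := Submodule.sub_mem _ hu (hCN (hkerC _ (hΨ u)))
    rwa [sub_sub_cancel] at this
  have hA : ∀ m k, φ k = 0 → fl F X k ∈ Am F Y I m := by
    intro m
    induction m with
    | zero => exact fun k _ => Am_zero _
    | succ m ih =>
      intro k hk
      have hC : Cm N ≤ (Am F Y I (m + 1)).comap ((fl F X).toLinearMap ∘ₗ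
          (LinearMap.id - Ψ.toLinearMap)) := by
        refine Cm_le fun u hu v hv => ?_
        change fl F X (⁅u, v⁆ - Ψ ⁅u, v⁆) ∈ Am F Y I (m + 1)
        have e : ⁅u, v⁆ - Ψ ⁅u, v⁆ = ⁅u - Ψ u, v⁆ + ⁅Ψ u, v - Ψ v⁆ := by
          rw [LieHom.map_lie]
          simp only [lie_sub, sub_lie]; abel
        rw [e, map_add, LieHom.map_lie, LieHom.map_lie]
        exact Submodule.add_mem _ (Am_lie le_rfl (ih _ (hΨ u)) ((hN v).1 hv).2)
          (Am_lie (by omega) ((hN _).1 (hΨN u hu)).2 (ih _ (hΨ v)))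
      have h1 : fl F X (k - Ψ k) ∈ Am F Y I (m + 1) := hC (hkerC k hk)
      have h2 : Ψ k = 0 := by
        change ψ (φ k) = 0
        rw [hk, map_zero]
      rwa [h2, sub_zero] at h1
  refine (injective_iff_map_eq_zero φ).2 fun k hk => ?_
  apply fl_injective
  rw [map_zero]
  exact Am_inf fun m => hA m k hk

end HG2
end FreeLift

namespace FreeLift

lemma exists_cp {F : Type} [Field F] {ι : Type} [DecidableEq ι] {M : Type} [AddCommGroup M]
    [Module F M] (S : ι → Submodule F M) (h : DirectSum.IsInternal S) :
    ∃ cp : ι → M →ₗ[F] M, (∀ n x, cp n x ∈ S n) ∧ (∀ n, ∀ x ∈ S n, cp n x = x) ∧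
      (∀ m n, m ≠ n → ∀ x ∈ S n, cp m x = 0) ∧ (∀ x, (∀ n, cp n x = 0) → x = 0) := by
  let E := LinearEquiv.ofBijective (DirectSum.coeLinearMap S) h
  have hE : ∀ n (x : S n), E.symm (x : M) = DirectSum.lof F ι (fun i => S i) n x := by
    intro n x
    rw [LinearEquiv.symm_apply_eq]
    exact (DirectSum.coeLinearMap_lof S n x).symm
  refine ⟨fun n => (S n).subtype ∘ₗ DirectSum.component F ι (fun i => S i) n ∘ₗ
    E.symm.toLinearMap, fun n x => (DirectSum.component F ι (fun i => S i) n (E.symm x)).2,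
    fun n x hx => ?_, fun m n hmn x hx => ?_, fun x hx => ?_⟩
  · have := hE n ⟨x, hx⟩
    change ((DirectSum.component F ι (fun i => S i) n (E.symm x) : S n) : M) = x
    rw [this, DirectSum.component.lof_self]
  · have := hE n ⟨x, hx⟩
    change ((DirectSum.component F ι (fun i => S i) m (E.symm x) : S m) : M) = 0
    rw [this, DirectSum.component.of, dif_neg (Ne.symm hmn)]; rfl
  · apply E.symm.injective
    rw [map_zero]
    refine DirectSum.ext_component F fun n => ?_
    rw [map_zero]
    exact Subtype.ext (hx n)

end FreeLift

open FreeLift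

/-- Let J be a Lie algebra over a field with an exhaustive increasing filtration
{FₖJ} by submodules, bounded below (Fₖ = 0 for k < 0) and compatible with the bracket
([FₘJ, FₙJ] ⊆ Fₘ₊ₙJ).  If the associated graded Lie algebra gr(J) = ⊕ₖ FₖJ/Fₖ₋₁J is a free
Lie algebra, then J is a free Lie algebra.

The associated graded Lie algebra is presented by a Lie algebra `Gr` together with, for each
k, a linear map πₖ : FₖJ → Gr whose kernel is Fₖ₋₁J, such that Gr is the internal direct sum
of the images and the bracket of Gr is induced by that of J. -/
theorem stmt2 (F : Type) [Field F] (J : Type) [LieRing J] [LieAlgebra F J]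
    (Filt : ℤ → Submodule F J)
    (hmono : Monotone Filt)
    (hexh : (⨆ k, Filt k) = ⊤)
    (hbot : ∀ k : ℤ, k < 0 → Filt k = ⊥)
    (hbr : ∀ m n : ℤ, ∀ x ∈ Filt m, ∀ y ∈ Filt n, ⁅x, y⁆ ∈ Filt (m + n))
    (Gr : Type) [LieRing Gr] [LieAlgebra F Gr]
    (π : ∀ k : ℤ, Filt k →ₗ[F] Gr)
    (hker : ∀ (k : ℤ) (x : Filt k), π k x = 0 ↔ (x : J) ∈ Filt (k - 1))
    (hinternal : DirectSum.IsInternal fun k : ℤ => LinearMap.range (π k))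
    (hbrcompat : ∀ (m n : ℤ) (x : Filt m) (y : Filt n),
      π (m + n) ⟨⁅(x : J), (y : J)⁆, hbr m n x x.2 y y.2⟩ = ⁅π m x, π n y⁆)
    -- hypothesis: gr(J) is a free Lie algebra
    (W : Type) (e : Gr ≃ₗ⁅F⁆ FreeLieAlgebra F W) :
    -- conclusion: J is a free Lie algebra
    ∃ V : Type, Nonempty (J ≃ₗ⁅F⁆ FreeLieAlgebra F V) := by
  obtain ⟨cp, cmem, cself, cne, cz⟩ := exists_cp _ hinternal
  have htop : ∀ g : Gr, g ∈ ⨆ k : ℤ, LinearMap.range (π k) := by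
    intro g; rw [hinternal.submodule_iSup_eq_top]; trivial
  have hneg : ∀ k : ℤ, k < 0 → ∀ g ∈ LinearMap.range (π k), g = 0 := by
    rintro k hk _ ⟨x, rfl⟩
    have : (x : J) ∈ (⊥ : Submodule F J) := by rw [← hbot k hk]; exact x.2
    have hx : x = 0 := Subtype.ext ((Submodule.mem_bot F).1 this)
    rw [hx, map_zero]
  -- the grading on the free Lie algebra
  let R : ℕ → Submodule F (FreeLieAlgebra F W) := fun n =>
    (LinearMap.range (π n)).comap (e.symm : FreeLieAlgebra F W →ₗ⁅F⁆ Gr).toLinearMap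
  have hR : ∀ n z, z ∈ R n ↔ e.symm z ∈ LinearMap.range (π n) := fun n z => Iff.rfl
  let cq : ℕ → FreeLieAlgebra F W →ₗ[F] FreeLieAlgebra F W := fun n =>
    (e : Gr →ₗ⁅F⁆ FreeLieAlgebra F W).toLinearMap ∘ₗ cp n ∘ₗ
      (e.symm : FreeLieAlgebra F W →ₗ⁅F⁆ Gr).toLinearMap
  have hcq : ∀ n z, cq n z = e (cp n (e.symm z)) := fun n z => rfl
  have hgrd : Grd R cq := by
    refine ⟨fun n x => ?_, fun n x hx => ?_, fun m n hmn x hx => ?_, ?_, fun m n x hx y hy => ?_⟩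
    · rw [hR, hcq, LieEquiv.symm_apply_apply]; exact cmem n _
    · rw [hcq, cself n _ ((hR n x).1 hx), LieEquiv.apply_symm_apply]
    · rw [hcq, cne m n (by exact_mod_cast hmn) _ ((hR n x).1 hx)]
      exact map_zero (e : Gr →ₗ⁅F⁆ FreeLieAlgebra F W)
    · refine eq_top_iff.2 fun z _ => ?_
      have h1 : (⨆ k : ℤ, LinearMap.range (π k)) ≤
          (⨆ n, R n).comap (e : Gr →ₗ⁅F⁆ FreeLieAlgebra F W).toLinearMap := by
        refine iSup_le fun k g hg => ?_
        change e g ∈ ⨆ n, R n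
        rcases lt_or_ge k 0 with hk | hk
        · rw [hneg k hk g hg]
          have : e 0 = 0 := map_zero (e : Gr →ₗ⁅F⁆ FreeLieAlgebra F W)
          rw [this]; exact Submodule.zero_mem _
        · obtain ⟨n, rfl⟩ := Int.eq_ofNat_of_zero_le hk
          refine Submodule.mem_iSup_of_mem n ?_
          rw [hR, LieEquiv.symm_apply_apply]; exact hg
      have h2 : e (e.symm z) ∈ ⨆ n, R n := h1 (htop (e.symm z))
      rwa [LieEquiv.apply_symm_apply] at h2
    · rw [hR] at hx hy ⊢
      obtain ⟨a, ha⟩ := hx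
      obtain ⟨b, hb⟩ := hy
      rw [LieEquiv.map_lie, ← ha, ← hb, Nat.cast_add, ← hbrcompat]
      exact ⟨_, rfl⟩
  obtain ⟨X, x, d, hxR, hbij⟩ := hg2 hgrd
  have hxR' : ∀ i, ∃ y : Filt (d i), π (d i) y = e.symm (x i) := fun i => hxR i
  choose y hy using hxR'
  let Φ : FreeLieAlgebra F X ≃ₗ⁅F⁆ Gr :=
    (LieEquiv.ofBijective (FreeLieAlgebra.lift F x) hbij).trans e.symm
  let φ : FreeLieAlgebra F X →ₗ⁅F⁆ Gr := Φ
  have hφo : ∀ i, φ (FreeLieAlgebra.of F i) = π (d i) (y i) := by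
    intro i
    rw [hy]
    change e.symm (FreeLieAlgebra.lift F x (FreeLieAlgebra.of F i)) = _
    rw [FreeLieAlgebra.lift_of_apply]
  have hφinj : ∀ z, φ z = 0 → z = 0 := by
    intro z hz
    refine Φ.injective ?_
    change φ z = φ 0
    rw [hz, map_zero]
  have hφsymm : ∀ g, φ (Φ.symm g) = g := fun g => Φ.apply_symm_apply g
  let ψ : FreeLieAlgebra F X →ₗ⁅F⁆ J := FreeLieAlgebra.lift F fun i => (y i : J)
  have hψo : ∀ i, ψ (FreeLieAlgebra.of F i) = y i := fun i => by simp [ψ]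
  let T : ℤ → Submodule F (FreeLieAlgebra F X) := fun k =>
    { carrier := {z | ∃ u : Filt k, (u : J) = ψ z ∧ π k u = φ z}
      add_mem' := by
        rintro a b ⟨u, hu, hu'⟩ ⟨v, hv, hv'⟩
        exact ⟨u + v, by rw [map_add, ← hu, ← hv]; rfl, by rw [map_add, map_add, hu', hv']⟩
      zero_mem' := ⟨0, by rw [map_zero]; rfl, by rw [map_zero, map_zero]⟩
      smul_mem' := by
        rintro r a ⟨u, hu, hu'⟩
        exact ⟨r • u, by rw [map_smul, ← hu]; rfl, by rw [map_smul, map_smul, hu']⟩ }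
  have hT : ∀ k z, z ∈ T k ↔ ∃ u : Filt k, (u : J) = ψ z ∧ π k u = φ z := fun k z => Iff.rfl
  have hTlie : ∀ m n, ∀ a ∈ T m, ∀ b ∈ T n, ⁅a, b⁆ ∈ T (m + n) := by
    rintro m n a ⟨u, hu, hu'⟩ b ⟨v, hv, hv'⟩
    refine ⟨⟨⁅(u : J), (v : J)⁆, hbr m n u u.2 v v.2⟩, ?_, ?_⟩
    · rw [LieHom.map_lie, ← hu, ← hv]
    · rw [hbrcompat, LieHom.map_lie, hu', hv']
  have hTtop : ∀ z, z ∈ ⨆ k, T k := by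
    intro z
    rw [← mem_gsub T hTlie]
    refine lsub_top _ (fun i => ?_) z
    rw [mem_gsub]
    exact Submodule.mem_iSup_of_mem (d i : ℤ) ⟨y i, (hψo i).symm, (hφo i).symm⟩
  -- homogeneous components
  let σ : Gr →ₗ⁅F⁆ FreeLieAlgebra F X := Φ.symm
  have hφσ : ∀ g, φ (σ g) = g := hφsymm
  have hσφ : ∀ z, σ (φ z) = z := fun z => Φ.symm_apply_apply z
  have hq : ∀ k z, σ (cp k (φ z)) ∈ T k := by
    intro k z
    have : (⨆ j, T j) ≤ (T k).comap (σ.toLinearMap ∘ₗ cp k ∘ₗ φ.toLinearMap) := by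
      refine iSup_le fun j z hz => ?_
      change σ (cp k (φ z)) ∈ T k
      have hr : φ z ∈ LinearMap.range (π j) := by
        obtain ⟨u, -, hu⟩ := hz
        exact ⟨u, hu⟩
      by_cases hkj : k = j
      · subst hkj
        rw [cself k _ hr, hσφ]; exact hz
      · rw [cne k j hkj _ hr, map_zero]; exact Submodule.zero_mem _
    exact this (hTtop z)
  have hfin : ∀ g : Gr, ∃ n : ℕ, ∀ k : ℤ, (n : ℤ) ≤ k → cp k g = 0 := by
    intro g
    refine Submodule.iSup_induction (fun k : ℤ => LinearMap.range (π k))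
      (motive := fun g => ∃ n : ℕ, ∀ k : ℤ, (n : ℤ) ≤ k → cp k g = 0) (htop g) ?_ ?_ ?_
    · intro j g hg
      refine ⟨(j + 1).toNat, fun k hk => cne k j ?_ g hg⟩
      omega
    · exact ⟨0, fun k _ => map_zero _⟩
    · rintro a b ⟨m, hm⟩ ⟨n, hn⟩
      refine ⟨max m n, fun k hk => ?_⟩
      rw [map_add, hm k (by omega), hn k (by omega), add_zero]
  have hmain : ∀ (n : ℕ) z, (∀ k : ℤ, (n : ℤ) ≤ k → cp k (φ z) = 0) →
      ψ z ∈ Filt ((n : ℤ) - 1) ∧ (ψ z = 0 → z = 0) := by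
    intro n
    induction n with
    | zero =>
      intro z hz
      have : z = 0 := by
        refine hφinj z (cz _ fun k => ?_)
        rcases lt_or_ge k 0 with hk | hk
        · exact hneg k hk _ (cmem k _)
        · exact hz k (by simpa using hk)
      subst this
      exact ⟨by rw [map_zero]; exact Submodule.zero_mem _, fun _ => rfl⟩
    | succ n ih =>
      intro z hz
      obtain ⟨u, hu, hu'⟩ := hq n z
      obtain ⟨h1, h2⟩ := ih (z - σ (cp n (φ z))) (by
        intro k hk
        rw [map_sub, hφσ, map_sub]
        by_cases hkn : k = n
        · rw [hkn, cself n _ (cmem n _), sub_self]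
        · rw [cne k n hkn _ (cmem n _), hz k (by push_cast; omega), sub_zero])
      rw [map_sub] at h1 h2
      rw [hφσ] at hu'
      constructor
      · have h3 := Submodule.add_mem _ (hmono (show (n : ℤ) - 1 ≤ n by omega) h1) u.2
        rw [hu, sub_add_cancel] at h3
        rwa [Nat.cast_add, Nat.cast_one, add_sub_cancel_right]
      · intro h0
        have h4 : π n u = 0 := by
          rw [hker, hu]
          rw [h0, zero_sub] at h1
          simpa using h1
        rw [← hu', h4, map_zero, map_zero, sub_zero, sub_zero] at h2
        exact h2 h0
  have hinj : Function.Injective ψ := by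
    refine (injective_iff_map_eq_zero ψ).2 fun z hz => ?_
    obtain ⟨n, hn⟩ := hfin (φ z)
    exact (hmain n z hn).2 hz
  have hrange : ∀ n : ℕ, Filt ((n : ℤ) - 1) ≤ LinearMap.range ψ.toLinearMap := by
    intro n
    induction n with
    | zero => rw [hbot _ (by simp)]; exact bot_le
    | succ n ih =>
      rw [Nat.cast_add, Nat.cast_one, add_sub_cancel_right]
      intro w hw
      have hz := hq n (σ (π n ⟨w, hw⟩))
      rw [hφσ, cself n _ ⟨_, rfl⟩, hT, hφσ] at hz
      obtain ⟨u, hu, hu'⟩ := hz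
      have h1 : π n (⟨w, hw⟩ - u) = 0 := by rw [map_sub, hu', sub_self]
      rw [hker] at h1
      have h2 := Submodule.add_mem _ (ih h1)
        (show (u : J) ∈ LinearMap.range ψ.toLinearMap from ⟨_, hu.symm⟩)
      have h3 : ((⟨w, hw⟩ - u : Filt n) : J) + u = w := by
        rw [Submodule.coe_sub, sub_add_cancel]
      rwa [h3] at h2
  have hsurj : Function.Surjective ψ := by
    intro w
    have h1 : (⨆ k, Filt k) ≤ LinearMap.range ψ.toLinearMap := by
      refine iSup_le fun k => ?_
      refine (hmono ?_).trans (hrange (k + 1).toNat)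
      omega
    obtain ⟨z, hz⟩ := h1 (show w ∈ ⨆ k, Filt k by rw [hexh]; trivial)
    exact ⟨z, hz⟩
  exact ⟨X, ⟨(LieEquiv.ofBijective ψ ⟨hinj, hsurj⟩).symm⟩⟩
end

section
/- In the free graded Lie algebra 𝕃⟨v₁,…,v_n⟩ over ℚ with |v_k| = 2k − 1 and differential d v_k = ½ Σ_{i+j=k} [v_i, v_j], the element u_n := Σ_{i+j=n+1, i,j≥1} [v_i, v_j] · (appropriate coefficients making u_n a cycle in degree 2n) given by u_n = [v₁, v_n] modulo decomposables from lower stages is a cycle, and the homology H(𝕃⟨v₁,…,v_n⟩, d) is isomorphic as a graded vector space to ℚ in degrees 1 and 2n (spanned by [v₁] and a class u_n), and zero in all other degrees. -/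
/-- A (ℤ-)graded Lie algebra over ℚ: a ℚ-module which is the internal direct sum of
graded pieces `G i`, with a bilinear bracket that adds degrees and satisfies graded
antisymmetry and the graded Jacobi identity on homogeneous elements. -/
structure GLA where
  L : Type
  [acg : AddCommGroup L]
  [mod : Module ℚ L]
  G : ℤ → Submodule ℚ L
  internal : DirectSum.IsInternal G
  br : L →ₗ[ℚ] L →ₗ[ℚ] L
  br_grade : ∀ i j : ℤ, ∀ x ∈ G i, ∀ y ∈ G j, br x y ∈ G (i + j)
  br_antisymm : ∀ i j : ℤ, ∀ x ∈ G i, ∀ y ∈ G j,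
    br y x = (-((-1 : ℚ) ^ (i * j))) • br x y
  br_jacobi : ∀ i j l : ℤ, ∀ x ∈ G i, ∀ y ∈ G j, ∀ z ∈ G l,
    ((-1 : ℚ) ^ (l * i)) • br x (br y z) + ((-1 : ℚ) ^ (i * j)) • br y (br z x)
      + ((-1 : ℚ) ^ (j * l)) • br z (br x y) = 0

attribute [instance] GLA.acg GLA.mod

/-- A morphism of graded Lie algebras: a linear map preserving brackets and degrees. -/
structure GLAHom (A B : GLA) where
  toFun : A.L →ₗ[ℚ] B.L
  map_br : ∀ x y : A.L, toFun (A.br x y) = B.br (toFun x) (toFun y)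
  map_grade : ∀ i : ℤ, ∀ x ∈ A.G i, toFun x ∈ B.G i

/-- `A` is the free graded Lie algebra on generators `gen x` of degree `deg x` (x : X):
the generators are homogeneous of the indicated degrees and every degree-preserving map
from the generators to a graded Lie algebra extends uniquely to a morphism. -/
def GLA.IsFreeOn (A : GLA) (X : Type) (deg : X → ℤ) (gen : X → A.L) : Prop :=
  (∀ x : X, gen x ∈ A.G (deg x)) ∧
  ∀ (B : GLA) (f : X → B.L), (∀ x : X, f x ∈ B.G (deg x)) →
    ∃! φ : GLAHom A B, ∀ x : X, φ.toFun (gen x) = f x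

/-- A differential graded Lie algebra (over ℚ): a graded Lie algebra with a degree −1
differential which squares to zero and is a graded derivation of the bracket. -/
structure DGLA extends GLA where
  d : L →ₗ[ℚ] L
  d_grade : ∀ i : ℤ, ∀ x ∈ G i, d x ∈ G (i - 1)
  d_sq : ∀ x : L, d (d x) = 0
  d_leibniz : ∀ i : ℤ, ∀ x ∈ G i, ∀ y : L,
    d (br x y) = br (d x) y + ((-1 : ℚ) ^ i) • br x (d y)

namespace CPn
set_option linter.unusedSimpArgs false

lemma indep_prod {M M' : Type} [AddCommGroup M] [Module ℚ M] [AddCommGroup M'] [Module ℚ M']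
    {G : ℤ → Submodule ℚ M} {G' : ℤ → Submodule ℚ M'}
    (h : DirectSum.IsInternal G) (h' : DirectSum.IsInternal G') :
    DirectSum.IsInternal (fun i => (G i).prod (G' i)) := by
  rw [DirectSum.isInternal_submodule_iff_iSupIndep_and_iSup_eq_top] at h h' ⊢
  obtain ⟨h1, h2⟩ := h
  obtain ⟨h1', h2'⟩ := h'
  constructor
  · intro i
    have hle : (⨆ j, ⨆ (_ : j ≠ i), (G j).prod (G' j)) ≤
        (⨆ j, ⨆ (_ : j ≠ i), G j).prod (⨆ j, ⨆ (_ : j ≠ i), G' j) := by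
      refine iSup₂_le fun j hj => Submodule.prod_mono ?_ ?_
      · exact le_iSup₂_of_le j hj le_rfl
      · exact le_iSup₂_of_le j hj le_rfl
    refine Disjoint.mono_right hle ?_
    rw [Submodule.disjoint_def]
    rintro ⟨x, y⟩ ⟨hx, hy⟩ ⟨hx', hy'⟩
    have a := (Submodule.disjoint_def.1 (h1 i)) x hx hx'
    have b := (Submodule.disjoint_def.1 (h1' i)) y hy hy'
    simp [a, b]
  · have e1 : (⊤ : Submodule ℚ M) ≤ Submodule.comap (LinearMap.inl ℚ M M')
        (⨆ i, (G i).prod (G' i)) := by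
      rw [← h2]
      refine iSup_le fun i x hx => ?_
      exact Submodule.mem_iSup_of_mem i ⟨hx, Submodule.zero_mem _⟩
    have e2 : (⊤ : Submodule ℚ M') ≤ Submodule.comap (LinearMap.inr ℚ M M')
        (⨆ i, (G i).prod (G' i)) := by
      rw [← h2']
      refine iSup_le fun i x hx => ?_
      exact Submodule.mem_iSup_of_mem i ⟨Submodule.zero_mem _, hx⟩
    rw [eq_top_iff]
    rintro ⟨x, y⟩ -
    have a := e1 (Submodule.mem_top (x := x))
    have b := e2 (Submodule.mem_top (x := y))
    rw [Submodule.mem_comap] at a b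
    have := Submodule.add_mem _ a b
    simpa using this

lemma internal_shift {M : Type} [AddCommGroup M] [Module ℚ M]
    {G : ℤ → Submodule ℚ M} (h : DirectSum.IsInternal G) (e : ℤ) :
    DirectSum.IsInternal (fun i => G (i + e)) := by
  rw [DirectSum.isInternal_submodule_iff_iSupIndep_and_iSup_eq_top] at h ⊢
  obtain ⟨h1, h2⟩ := h
  refine ⟨h1.comp (f := fun i : ℤ => i + e) (add_left_injective e), ?_⟩
  rw [← h2]
  exact (Equiv.addRight e).iSup_comp (g := G)

/-- The parity involution. -/
lemma exists_sigma (A : GLA) : ∃ σ : A.L →ₗ[ℚ] A.L, ∀ i, ∀ x ∈ A.G i, σ x = ((-1 : ℚ) ^ i) • x := by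
  let E := LinearEquiv.ofBijective (DirectSum.coeLinearMap A.G) A.internal
  refine ⟨(DirectSum.toModule ℚ ℤ A.L (fun i => ((-1 : ℚ) ^ i) • (A.G i).subtype)) ∘ₗ
    E.symm.toLinearMap, ?_⟩
  intro i x hx
  have : E.symm x = DirectSum.lof ℚ ℤ (fun i => A.G i) i ⟨x, hx⟩ := by
    rw [LinearEquiv.symm_apply_eq]
    exact (DirectSum.coeLinearMap_lof A.G i ⟨x, hx⟩).symm
  simp [this]

/-- The abelian graded Lie algebra ℚ in degree 1. -/
noncomputable def abQ : GLA where
  L := ℚ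
  G := fun i => if i = 1 then ⊤ else ⊥
  internal := by
    rw [DirectSum.isInternal_submodule_iff_iSupIndep_and_iSup_eq_top]
    constructor
    · intro i
      by_cases hi : i = 1
      · have : (⨆ j, ⨆ (_ : j ≠ i), (if j = 1 then (⊤ : Submodule ℚ ℚ) else ⊥)) = ⊥ := by
          simp only [iSup_eq_bot]
          intro j hj
          simp [show j ≠ 1 from hi ▸ hj]
        rw [this]
        exact disjoint_bot_right
      · simp [hi]
    · rw [eq_top_iff]
      exact le_iSup_of_le 1 (by simp)
  br := 0
  br_grade := by intros; simp
  br_antisymm := by intros; simp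
  br_jacobi := by intros; simp

lemma exists_p (A : GLA) {X : Type} {deg : X → ℤ} {gen : X → A.L} (hf : A.IsFreeOn X deg gen)
    (x0 : X) (h0 : deg x0 = 1) : ∃ p : A.L →ₗ[ℚ] ℚ, p (gen x0) = 1 ∧
      (∀ x, x ≠ x0 → p (gen x) = 0) ∧
      (∀ x y, p (A.br x y) = 0) ∧ ∀ i, ∀ x ∈ A.G i, i ≠ 1 → p x = 0 := by
  classical
  let f : X → ℚ := fun x => if x = x0 then (1 : ℚ) else (0 : ℚ)
  have hf1 : f x0 = 1 := by simp [f]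
  have hf0 : ∀ x, x ≠ x0 → f x = 0 := fun x hx => by simp [f, hx]
  have hfg : ∀ x, f x ∈ (if deg x = 1 then (⊤ : Submodule ℚ ℚ) else ⊥) := by
    intro x
    by_cases h : x = x0
    · subst h
      simp [h0]
    · rw [hf0 x h]
      exact Submodule.zero_mem _
  obtain ⟨φ, hφ, -⟩ := hf.2 abQ f hfg
  let p : A.L →ₗ[ℚ] ℚ := φ.toFun
  refine ⟨p, ?_, ?_, ?_, ?_⟩
  · exact (hφ x0).trans hf1
  · intro x hx
    exact (hφ x).trans (hf0 x hx)
  · intro x y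
    exact φ.map_br x y
  · intro i x hx hi
    have h1 : p x ∈ (if i = 1 then (⊤ : Submodule ℚ ℚ) else ⊥) := φ.map_grade i x hx
    simpa [hi] using h1

/-- A bracket-closed homogeneous subspace containing the generators is everything. -/
lemma gen_top (A : GLA) {X : Type} {deg : X → ℤ} {gen : X → A.L} (hf : A.IsFreeOn X deg gen)
    (Y : Set A.L) (hY : ∀ y ∈ Y, ∃ i, y ∈ A.G i)
    (hbr : ∀ x ∈ Y, ∀ y ∈ Y, A.br x y ∈ Submodule.span ℚ Y)
    (hgen : ∀ x, gen x ∈ Submodule.span ℚ Y) : Submodule.span ℚ Y = ⊤ := by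
  set S := Submodule.span ℚ Y with hS
  have hclosed : ∀ x ∈ S, ∀ y ∈ S, A.br x y ∈ S := by
    intro x hx y hy
    induction hx using Submodule.span_induction with
    | mem x hx =>
      induction hy using Submodule.span_induction with
      | mem y hy => exact hbr x hx y hy
      | zero => simp
      | add a b _ _ ha hb => rw [map_add]; exact S.add_mem ha hb
      | smul c a _ ha => rw [map_smul]; exact S.smul_mem c ha
    | zero => simp
    | add a b _ _ ha hb => rw [map_add]; exact S.add_mem ha hb
    | smul c a _ ha => rw [map_smul]; exact S.smul_mem c ha
  have hint := A.internal
  rw [DirectSum.isInternal_submodule_iff_iSupIndep_and_iSup_eq_top] at hint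
  let B : GLA :=
    { L := S
      G := fun i => (A.G i).comap S.subtype
      internal := by
        rw [DirectSum.isInternal_submodule_iff_iSupIndep_and_iSup_eq_top]
        constructor
        · intro i
          rw [Submodule.disjoint_def]
          intro x hx hx'
          have : (⨆ j, ⨆ (_ : j ≠ i), (A.G j).comap S.subtype) ≤
              (⨆ j, ⨆ (_ : j ≠ i), A.G j).comap S.subtype :=
            iSup₂_le fun j hj => Submodule.comap_mono (le_iSup₂_of_le j hj le_rfl)
          exact Subtype.ext ((Submodule.disjoint_def.1 (hint.1 i)) x.1 hx (this hx'))
        · rw [eq_top_iff]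
          rintro ⟨x, hx⟩ -
          have key : ∀ x (hx : x ∈ S), (⟨x, hx⟩ : S) ∈ ⨆ i, (A.G i).comap S.subtype := by
            intro x hx
            induction hx using Submodule.span_induction with
            | mem x hx =>
              obtain ⟨i, hi⟩ := hY x hx
              exact Submodule.mem_iSup_of_mem i hi
            | zero => exact Submodule.zero_mem _
            | add a b _ _ ha hb => exact Submodule.add_mem _ ha hb
            | smul c a _ ha => exact Submodule.smul_mem _ c ha
          exact key x hx
      br := LinearMap.mk₂ ℚ (fun x y => (⟨A.br x.1 y.1, hclosed _ x.2 _ y.2⟩ : S))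
        (by intros; ext; simp) (by intros; ext; simp) (by intros; ext; simp) (by intros; ext; simp)
      br_grade := by
        intro i j x hx y hy
        exact A.br_grade i j x.1 hx y.1 hy
      br_antisymm := by
        intro i j x hx y hy
        exact Subtype.ext (A.br_antisymm i j x.1 hx y.1 hy)
      br_jacobi := by
        intro i j l x hx y hy z hz
        exact Subtype.ext (A.br_jacobi i j l x.1 hx y.1 hy z.1 hz) }
  obtain ⟨φ, hφ, -⟩ := hf.2 B (fun x => (⟨gen x, hgen x⟩ : S)) (fun x => hf.1 x)
  let ι : GLAHom A A :=
    { toFun := S.subtype ∘ₗ φ.toFun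
      map_br := by
        intro x y
        have := φ.map_br x y
        exact congrArg Subtype.val this
      map_grade := fun i x hx => φ.map_grade i x hx }
  let idh : GLAHom A A := ⟨LinearMap.id, fun _ _ => rfl, fun _ _ h => h⟩
  have heq : ι = idh := (hf.2 A gen hf.1).unique
    (fun x => congrArg Subtype.val (hφ x)) (fun x => rfl)
  rw [eq_top_iff]
  intro x _
  have h1 : ι.toFun x = x := by rw [heq]; rfl
  rw [← h1]
  exact (φ.toFun x).2

lemma neg_one_zpow_cases (i : ℤ) : (Even i ∧ (-1 : ℚ) ^ i = 1) ∨ (Odd i ∧ (-1 : ℚ) ^ i = -1) := by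
  rcases Int.even_or_odd i with h | h
  · exact Or.inl ⟨h, h.neg_one_zpow⟩
  · exact Or.inr ⟨h, h.neg_one_zpow⟩

section ext
variable (A : GLA) (σ : A.L →ₗ[ℚ] A.L) (p : A.L →ₗ[ℚ] ℚ)

/-- The bracket of the twisted extension. -/
noncomputable def extBr : (A.L × A.L × A.L) →ₗ[ℚ] (A.L × A.L × A.L) →ₗ[ℚ] (A.L × A.L × A.L) :=
  LinearMap.mk₂ ℚ (fun X Y => (A.br X.1 Y.1,
      A.br X.2.1 Y.1 + A.br (σ X.1) Y.2.1 + p X.1 • Y.2.2 - p Y.1 • σ X.2.2,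
      A.br X.2.2 Y.1 + A.br X.1 Y.2.2))
    (by
      intro a b c
      ext
      · simp
      · simp; module
      · simp; abel)
    (by
      intro r a b
      ext
      · simp
      · simp; module
      · simp)
    (by
      intro a b c
      ext
      · simp
      · simp; module
      · simp; abel)
    (by
      intro r a b
      ext
      · simp
      · simp; module
      · simp)

lemma extBr_apply (x y z x' y' z' : A.L) : extBr A σ p (x, y, z) (x', y', z') =
    (A.br x x', A.br y x' + A.br (σ x) y' + p x • z' - p x' • σ z, A.br z x' + A.br x z') := rfl

variable (hσ : ∀ i, ∀ x ∈ A.G i, σ x = ((-1 : ℚ) ^ i) • x)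
  (hp : ∀ x y, p (A.br x y) = 0) (hp1 : ∀ i, ∀ x ∈ A.G i, i ≠ 1 → p x = 0)
  (e : ℤ) (he : Odd e)

/-- The twisted extension of `A` by two shifted copies of `A`. -/
noncomputable def extGLA : GLA where
  L := A.L × A.L × A.L
  G := fun i => (A.G i).prod ((A.G (i + e)).prod (A.G (i + (e + 1))))
  internal := indep_prod A.internal
    (indep_prod (internal_shift A.internal e) (internal_shift A.internal (e + 1)))
  br := extBr A σ p
  br_grade := by
    rintro i j ⟨x, y, z⟩ ⟨hx, hy, hz⟩ ⟨x', y', z'⟩ ⟨hx', hy', hz'⟩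
    simp only at hx hy hz hx' hy' hz'
    rw [extBr_apply]
    refine ⟨A.br_grade i j x hx x' hx', ?_, ?_⟩
    · refine Submodule.sub_mem _ (Submodule.add_mem _ (Submodule.add_mem _ ?_ ?_) ?_) ?_
      · have := A.br_grade _ _ _ hy _ hx'
        convert this using 2; ring
      · rw [hσ i x hx, map_smul, LinearMap.smul_apply]
        have := A.br_grade _ _ _ hx _ hy'
        refine Submodule.smul_mem _ _ ?_
        convert this using 2; ring
      · by_cases hi : i = 1
        · subst hi
          refine Submodule.smul_mem _ _ ?_
          have h9 : 1 + j + e = j + (e + 1) := by ring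
          rw [h9]
          exact hz'
        · simp [hp1 i x hx hi]
      · by_cases hi : j = 1
        · subst hi
          rw [hσ _ z hz]
          refine Submodule.smul_mem _ _ (Submodule.smul_mem _ _ ?_)
          have h9 : i + 1 + e = i + (e + 1) := by ring
          rw [h9]
          exact hz
        · simp [hp1 j x' hx' hi]
    · refine Submodule.add_mem _ ?_ ?_
      · have := A.br_grade _ _ _ hz _ hx'
        convert this using 2; ring
      · have := A.br_grade _ _ _ hx _ hz'
        convert this using 2; ring
  br_antisymm := by
    rintro i j ⟨x, y, z⟩ ⟨hx, hy, hz⟩ ⟨x', y', z'⟩ ⟨hx', hy', hz'⟩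
    simp only at hx hy hz hx' hy' hz'
    rw [extBr_apply, extBr_apply, hσ i x hx, hσ j x' hx', hσ _ z hz, hσ _ z' hz']
    have h1 := A.br_antisymm _ _ _ hx _ hx'
    have h2 := A.br_antisymm _ _ _ hx _ hy'
    have h3 := A.br_antisymm _ _ _ hy _ hx'
    have h4 := A.br_antisymm _ _ _ hz _ hx'
    have h5 := A.br_antisymm _ _ _ hx _ hz'
    have pi : p x = 0 ∨ i = 1 := by
      by_cases h : i = 1
      · exact Or.inr h
      · exact Or.inl (hp1 i x hx h)
    have pj : p x' = 0 ∨ j = 1 := by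
      by_cases h : j = 1
      · exact Or.inr h
      · exact Or.inl (hp1 j x' hx' h)
    have n1 := he.neg_one_zpow (α := ℚ)
    have m1 : (-1 : ℚ) ≠ 0 := by norm_num
    ext
    · exact h1
    · rcases pi with pi | rfl <;> rcases pj with pj | rfl <;>
      [(rcases neg_one_zpow_cases i with ⟨-, si⟩ | ⟨-, si⟩ <;>
        rcases neg_one_zpow_cases j with ⟨-, sj⟩ | ⟨-, sj⟩);
       (rcases neg_one_zpow_cases i with ⟨-, si⟩ | ⟨-, si⟩);
       (rcases neg_one_zpow_cases j with ⟨-, sj⟩ | ⟨-, sj⟩);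
       skip] <;>
      simp only [h2, h3, add_mul, mul_add, zpow_add₀ m1, zpow_mul, map_smul, LinearMap.smul_apply,
        Prod.smul_fst, Prod.smul_snd, zpow_one, one_zpow, *] <;>
      module
    · rcases neg_one_zpow_cases i with ⟨-, si⟩ | ⟨-, si⟩ <;>
      rcases neg_one_zpow_cases j with ⟨-, sj⟩ | ⟨-, sj⟩ <;>
      simp only [h4, h5, add_mul, mul_add, zpow_add₀ m1, zpow_mul, map_smul, LinearMap.smul_apply,
        Prod.smul_fst, Prod.smul_snd, zpow_one, one_zpow, n1, si, sj] <;>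
      module
  br_jacobi := by
    rintro i j l ⟨x, y, z⟩ ⟨hx, hy, hz⟩ ⟨x', y', z'⟩ ⟨hx', hy', hz'⟩ ⟨x'', y'', z''⟩ ⟨hx'', hy'', hz''⟩
    simp only at hx hy hz hx' hy' hz' hx'' hy'' hz''
    simp only [extBr_apply, hp, hσ i x hx, hσ j x' hx', hσ l x'' hx'', hσ _ z hz, hσ _ z' hz',
      hσ _ z'' hz'']
    have Jx := A.br_jacobi _ _ _ _ hx _ hx' _ hx''
    have Jy := A.br_jacobi _ _ _ _ hy _ hx' _ hx''
    have Jy' := A.br_jacobi _ _ _ _ hx _ hy' _ hx''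
    have Jy'' := A.br_jacobi _ _ _ _ hx _ hx' _ hy''
    have Jz := A.br_jacobi _ _ _ _ hz _ hx' _ hx''
    have Jz' := A.br_jacobi _ _ _ _ hx _ hz' _ hx''
    have Jz'' := A.br_jacobi _ _ _ _ hx _ hx' _ hz''
    have a1 := A.br_antisymm _ _ _ hx _ hz'
    have a2 := A.br_antisymm _ _ _ hx _ hz''
    have a3 := A.br_antisymm _ _ _ hx' _ hz
    have a4 := A.br_antisymm _ _ _ hx' _ hz''
    have a5 := A.br_antisymm _ _ _ hx'' _ hz
    have a6 := A.br_antisymm _ _ _ hx'' _ hz'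
    have par : ∀ i, ∀ x ∈ A.G i, (-1 : ℚ) ^ i = -1 ∨ ((-1 : ℚ) ^ i = 1 ∧ p x = 0) := by
      intro i x hx
      rcases neg_one_zpow_cases i with ⟨hi, si⟩ | ⟨-, si⟩
      · refine Or.inr ⟨si, hp1 i x hx ?_⟩
        rintro rfl
        simp at hi
      · exact Or.inl si
    have qi := par i x hx
    have qj := par j x' hx'
    have ql := par l x'' hx''
    have n1 := he.neg_one_zpow (α := ℚ)
    have m1 : (-1 : ℚ) ≠ 0 := by norm_num
    have s1 : ∀ i j : ℤ, (-1 : ℚ) ^ (i * j) = ((-1 : ℚ) ^ i) ^ j := fun i j => zpow_mul _ _ _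
    have s2 : ∀ i j : ℤ, (-1 : ℚ) ^ (i + j) = (-1 : ℚ) ^ i * (-1 : ℚ) ^ j :=
      fun i j => zpow_add₀ m1 _ _
    simp only [add_mul, mul_add, s1, s2, n1, zpow_one, one_mul, mul_one]
      at Jx Jy Jy' Jy'' Jz Jz' Jz'' a1 a2 a3 a4 a5 a6 ⊢
    refine Prod.ext ?_ (Prod.ext ?_ ?_)
    · exact Jx
    · rcases qi with si | ⟨si, pi⟩ <;> rcases qj with sj | ⟨sj, pj⟩ <;>
      rcases ql with sl | ⟨sl, pl⟩ <;>
      linear_combination (norm := (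
        simp only [map_add, map_sub, map_smul, LinearMap.smul_apply, LinearMap.add_apply,
          LinearMap.sub_apply, Prod.smul_fst, Prod.smul_snd, Prod.fst_add, Prod.snd_add,
          Prod.fst_zero, Prod.snd_zero, one_zpow, *]
        module)) ((-1 : ℚ) ^ l) • Jy + ((-1 : ℚ) ^ i) • Jy' + ((-1 : ℚ) ^ j) • Jy''
    · linear_combination (norm := skip) Jz + Jz' + Jz''
      rcases qi with si | ⟨si, pi⟩ <;> rcases qj with sj | ⟨sj, pj⟩ <;>
      rcases ql with sl | ⟨sl, pl⟩ <;>
      · simp only [map_add, map_sub, map_smul, LinearMap.smul_apply, LinearMap.add_apply,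
          LinearMap.sub_apply, Prod.smul_fst, Prod.smul_snd, Prod.fst_add, Prod.snd_add,
          Prod.fst_zero, Prod.snd_zero, one_zpow, si, sj, sl, n1]
        module
end ext

lemma exists_h (A : GLA) {X : Type} {deg : X → ℤ} {gen : X → A.L} (hf : A.IsFreeOn X deg gen)
    (p : A.L →ₗ[ℚ] ℚ) (hp : ∀ x y, p (A.br x y) = 0)
    (hp1 : ∀ i, ∀ x ∈ A.G i, i ≠ 1 → p x = 0) (e : ℤ) (he : Odd e)
    (t : X → A.L) (ht : ∀ x, t x ∈ A.G (deg x + (e + 1))) :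
    ∃ h g : A.L →ₗ[ℚ] A.L, (∀ x, h (gen x) = 0) ∧ (∀ x, g (gen x) = t x) ∧
      (∀ i, ∀ x ∈ A.G i, h x ∈ A.G (i + e)) ∧
      (∀ i, ∀ x ∈ A.G i, ∀ y, h (A.br x y) = A.br (h x) y + ((-1 : ℚ) ^ i) • A.br x (h y)
        + p x • g y - (p y * (-1 : ℚ) ^ i) • g x) := by
  obtain ⟨σ, hσ⟩ := exists_sigma A
  let B := extGLA A σ p hσ hp hp1 e he
  let f : X → A.L × A.L × A.L := fun x => (gen x, 0, t x)
  obtain ⟨φ, hφ, -⟩ := hf.2 B f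
    (fun x => ⟨hf.1 x, Submodule.zero_mem _, ht x⟩)
  let F : A.L →ₗ[ℚ] A.L × A.L × A.L := φ.toFun
  have hF : ∀ x, F (gen x) = (gen x, 0, t x) := hφ
  have hFbr : ∀ x y, F (A.br x y) = extBr A σ p (F x) (F y) := φ.map_br
  have hFg : ∀ i, ∀ x ∈ A.G i, F x ∈ (A.G i).prod ((A.G (i + e)).prod (A.G (i + (e + 1)))) :=
    φ.map_grade
  let ι : GLAHom A A :=
    { toFun := LinearMap.fst ℚ _ _ ∘ₗ F
      map_br := fun x y => by
        simp only [LinearMap.comp_apply, hFbr]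
        rfl
      map_grade := fun i x hx => (hFg i x hx).1 }
  let idh : GLAHom A A := ⟨LinearMap.id, fun _ _ => rfl, fun _ _ h => h⟩
  have heq : ι = idh := (hf.2 A gen hf.1).unique
    (fun x => congrArg Prod.fst (hF x)) (fun x => rfl)
  have h1 : ∀ x, (F x).1 = x := fun x => by
    have : ι.toFun x = x := by rw [heq]; rfl
    exact this
  refine ⟨LinearMap.fst ℚ _ _ ∘ₗ LinearMap.snd ℚ _ _ ∘ₗ F,
    LinearMap.snd ℚ _ _ ∘ₗ LinearMap.snd ℚ _ _ ∘ₗ F, ?_, ?_, ?_, ?_⟩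
  · intro x; simp [hF]
  · intro x; simp [hF]
  · intro i x hx; exact (hFg i x hx).2.1
  · intro i x hx y
    have h2 := congrArg (fun X => X.2.1) (hFbr x y)
    simp only [LinearMap.comp_apply, LinearMap.fst_apply, LinearMap.snd_apply]
    rw [h2]
    have h3 : extBr A σ p (F x) (F y) =
      extBr A σ p ((F x).1, (F x).2.1, (F x).2.2) ((F y).1, (F y).2.1, (F y).2.2) := rfl
    rw [h3, extBr_apply, h1, h1, hσ i x hx, hσ _ _ (hFg i x hx).2.2]
    have : (-1 : ℚ) ^ (i + (e + 1)) = (-1 : ℚ) ^ i := by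
      rw [zpow_add₀ (by norm_num), he.add_one.neg_one_zpow, mul_one]
    simp only [this, map_smul, LinearMap.smul_apply, mul_smul]

/-- Half the quadratic sum of brackets. -/
noncomputable def cc (A : GLA) (w : ℕ → A.L) (k : ℕ) : A.L :=
  (1 / 2 : ℚ) • ∑ ij ∈ Finset.HasAntidiagonal.antidiagonal k, A.br (w ij.1) (w ij.2)

lemma cc_mem (A : GLA) (w : ℕ → A.L) (hw : ∀ k : ℕ, w k ∈ A.G (2 * (k : ℤ) - 1)) (k : ℕ) :
    cc A w k ∈ A.G (2 * (k : ℤ) - 2) := by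
  refine Submodule.smul_mem _ _ (Submodule.sum_mem _ fun ij hij => ?_)
  have := A.br_grade _ _ _ (hw ij.1) _ (hw ij.2)
  rw [Finset.HasAntidiagonal.mem_antidiagonal] at hij
  have e : 2 * (k : ℤ) - 2 = 2 * (ij.1 : ℤ) - 1 + (2 * (ij.2 : ℤ) - 1) := by
    rw [← hij]; push_cast; ring
  rw [e]; exact this

lemma odd_zpow (k : ℕ) : (-1 : ℚ) ^ (2 * (k : ℤ) - 1) = -1 :=
  Odd.neg_one_zpow ⟨(k : ℤ) - 1, by ring⟩

lemma odd_jac (A : GLA) (w : ℕ → A.L) (hw : ∀ k : ℕ, w k ∈ A.G (2 * (k : ℤ) - 1)) (a b c : ℕ) :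
    A.br (w a) (A.br (w b) (w c)) + A.br (w b) (A.br (w c) (w a))
      + A.br (w c) (A.br (w a) (w b)) = 0 := by
  have := A.br_jacobi _ _ _ _ (hw a) _ (hw b) _ (hw c)
  have o : ∀ a b : ℕ, (-1 : ℚ) ^ ((2 * (a : ℤ) - 1) * (2 * (b : ℤ) - 1)) = -1 := by
    intro a b
    rw [zpow_mul, odd_zpow, odd_zpow]
  simp only [o] at this
  linear_combination (norm := module) (-1 : ℚ) • this

lemma odd_symm (A : GLA) (w : ℕ → A.L) (hw : ∀ k : ℕ, w k ∈ A.G (2 * (k : ℤ) - 1)) (a b : ℕ) :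
    A.br (w b) (w a) = A.br (w a) (w b) := by
  rw [A.br_antisymm _ _ _ (hw a) _ (hw b), zpow_mul, odd_zpow, odd_zpow]
  simp

lemma cyc_sum {M : Type} [AddCommGroup M] (f : ℕ → ℕ → ℕ → M) (k : ℕ) :
    ∑ p ∈ Finset.HasAntidiagonal.antidiagonal k, ∑ q ∈ Finset.HasAntidiagonal.antidiagonal p.2, f p.1 q.1 q.2 =
    ∑ p ∈ Finset.HasAntidiagonal.antidiagonal k, ∑ q ∈ Finset.HasAntidiagonal.antidiagonal p.2, f q.1 q.2 p.1 := by
  rw [Finset.sum_sigma', Finset.sum_sigma']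
  refine Finset.sum_nbij' (fun x => ⟨(x.2.2, x.1.1 + x.2.1), (x.1.1, x.2.1)⟩)
    (fun x => ⟨(x.2.1, x.2.2 + x.1.1), (x.2.2, x.1.1)⟩) ?_ ?_ ?_ ?_ ?_
  · rintro ⟨⟨a, b⟩, ⟨c, d⟩⟩ h
    simp at h ⊢
    omega
  · rintro ⟨⟨a, b⟩, ⟨c, d⟩⟩ h
    simp at h ⊢
    omega
  · rintro ⟨⟨a, b⟩, ⟨c, d⟩⟩ h
    simp at h ⊢
    exact h.2
  · rintro ⟨⟨a, b⟩, ⟨c, d⟩⟩ h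
    simp at h ⊢
    exact h.2
  · rintro ⟨⟨a, b⟩, ⟨c, d⟩⟩ h
    rfl

lemma jac_sum (A : GLA) (w : ℕ → A.L) (hw : ∀ k : ℕ, w k ∈ A.G (2 * (k : ℤ) - 1)) (k : ℕ) :
    ∑ p ∈ Finset.HasAntidiagonal.antidiagonal k, A.br (w p.1) (cc A w p.2) = 0 := by
  set f : ℕ → ℕ → ℕ → A.L := fun a b c => A.br (w a) (A.br (w b) (w c)) with hfdef
  have e1 : ∑ p ∈ Finset.HasAntidiagonal.antidiagonal k, A.br (w p.1) (cc A w p.2) =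
      (1 / 2 : ℚ) • ∑ p ∈ Finset.HasAntidiagonal.antidiagonal k, ∑ q ∈ Finset.HasAntidiagonal.antidiagonal p.2, f p.1 q.1 q.2 := by
    simp only [cc, map_smul, map_sum, Finset.smul_sum, hfdef]
  have e2 := cyc_sum f k
  have e3 := cyc_sum (fun a b c => f b c a) k
  have e4 : ∑ p ∈ Finset.HasAntidiagonal.antidiagonal k, ∑ q ∈ Finset.HasAntidiagonal.antidiagonal p.2,
      (f p.1 q.1 q.2 + f q.1 q.2 p.1 + f q.2 p.1 q.1) = 0 :=
    Finset.sum_eq_zero fun p _ => Finset.sum_eq_zero fun q _ => odd_jac A w hw _ _ _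
  simp only [Finset.sum_add_distrib] at e4
  rw [e1]
  linear_combination (norm := module) (1 / 6 : ℚ) • e4 + (1 / 3 : ℚ) • e2 + (1 / 6 : ℚ) • e3

lemma ad_leib (A : GLA) {i j l : ℤ} {x y z : A.L} (hx : x ∈ A.G i) (hy : y ∈ A.G j)
    (hz : z ∈ A.G l) :
    A.br x (A.br y z) = A.br (A.br x y) z + ((-1 : ℚ) ^ (i * j)) • A.br y (A.br x z) := by
  have J := A.br_jacobi _ _ _ _ hx _ hy _ hz
  have a1 := A.br_antisymm _ _ _ hx _ hz
  have a2 := A.br_antisymm _ _ _ (A.br_grade _ _ _ hx _ hy) _ hz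
  rw [a1, a2] at J
  have m1 : (-1 : ℚ) ≠ 0 := by norm_num
  rcases neg_one_zpow_cases i with ⟨-, si⟩ | ⟨-, si⟩ <;>
  rcases neg_one_zpow_cases j with ⟨-, sj⟩ | ⟨-, sj⟩ <;>
  rcases neg_one_zpow_cases l with ⟨-, sl⟩ | ⟨-, sl⟩ <;>
  simp only [add_mul, mul_add, zpow_mul, zpow_add₀ m1, si, sj, sl, one_zpow, map_smul] at J ⊢ <;>
  first
  | linear_combination (norm := module) J
  | linear_combination (norm := module) (-1 : ℚ) • J

/-- Monomials in the ideal, with weight and degree. -/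
inductive KM (A : GLA) (n : ℕ) (w : ℕ → A.L) : ℕ → ℤ → A.L → Prop
  | b (k : ℕ) (hk : 2 ≤ k) : KM A n w 1 (2 * (k : ℤ) - 1) (w k)
  | c (k : ℕ) (hk : 2 ≤ k) (hk' : k ≤ n) : KM A n w 1 (2 * (k : ℤ) - 2) (cc A w k)
  | u : KM A n w 0 (2 * ((n + 1 : ℕ) : ℤ) - 2) (cc A w (n + 1))
  | br {a b : ℕ} {i j : ℤ} {x y : A.L} (hx : KM A n w a i x) (hy : KM A n w b j y) :
      KM A n w (a + b) (i + j) (A.br x y)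

/-- The span of the monomials. -/
def TT (A : GLA) (n : ℕ) (w : ℕ → A.L) : Submodule ℚ A.L :=
  Submodule.span ℚ {x | ∃ a i, KM A n w a i x}

lemma KM.memTT {A : GLA} {n : ℕ} {w : ℕ → A.L} {a : ℕ} {i : ℤ} {x : A.L} (h : KM A n w a i x) :
    x ∈ TT A n w := Submodule.subset_span ⟨a, i, h⟩

lemma TT_br {A : GLA} {n : ℕ} {w : ℕ → A.L} {x y : A.L} (hx : x ∈ TT A n w) (hy : y ∈ TT A n w) :
    A.br x y ∈ TT A n w := by
  unfold TT at hx hy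
  induction hx using Submodule.span_induction with
  | mem x hx =>
    induction hy using Submodule.span_induction with
    | mem y hy =>
      obtain ⟨a, i, hx⟩ := hx
      obtain ⟨b, j, hy⟩ := hy
      exact (KM.br hx hy).memTT
    | zero => simp
    | add a b _ _ ha hb => rw [map_add]; exact Submodule.add_mem _ ha hb
    | smul c a _ ha => rw [map_smul]; exact Submodule.smul_mem _ c ha
  | zero => simp
  | add a b _ _ ha hb => rw [map_add]; exact Submodule.add_mem _ ha hb
  | smul c a _ ha => rw [map_smul]; exact Submodule.smul_mem _ c ha

lemma KM.deg {A : GLA} {n : ℕ} {w : ℕ → A.L} (hw : ∀ k : ℕ, w k ∈ A.G (2 * (k : ℤ) - 1))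
    {a : ℕ} {i : ℤ} {x : A.L} (h : KM A n w a i x) : x ∈ A.G i := by
  induction h with
  | b k hk => exact hw k
  | c k hk hk' => exact cc_mem A w hw k
  | u => exact cc_mem A w hw (n + 1)
  | br hx hy ihx ihy => exact A.br_grade _ _ _ ihx _ ihy

lemma cc_zero (A : GLA) (w : ℕ → A.L) (h0 : w 0 = 0) : cc A w 0 = 0 := by simp [cc, h0]

lemma cc_one (A : GLA) (w : ℕ → A.L) (h0 : w 0 = 0) : cc A w 1 = 0 := by
  simp [cc, h0, Finset.HasAntidiagonal.antidiagonal, Finset.Nat.antidiagonal_succ]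

lemma cc_two (A : GLA) (w : ℕ → A.L) (h0 : w 0 = 0) :
    A.br (w 1) (w 1) = (2 : ℚ) • cc A w 2 := by
  simp [cc, h0, Finset.HasAntidiagonal.antidiagonal, Finset.Nat.antidiagonal_succ]

/-- Splitting off the terms with an index one. -/
lemma cc_split (A : GLA) (w : ℕ → A.L) (h0 : w 0 = 0)
    (hw : ∀ k : ℕ, w k ∈ A.G (2 * (k : ℤ) - 1)) (k : ℕ) (hk : 2 ≤ k) :
    cc A w (k + 1) - A.br (w 1) (w k) ∈ Submodule.span ℚ
      {x : A.L | ∃ i j : ℕ, 2 ≤ i ∧ 2 ≤ j ∧ i + j = k + 1 ∧ x = A.br (w i) (w j)} := by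
  set S := Submodule.span ℚ
      {x : A.L | ∃ i j : ℕ, 2 ≤ i ∧ 2 ≤ j ∧ i + j = k + 1 ∧ x = A.br (w i) (w j)}
  have key : ∑ ij ∈ Finset.HasAntidiagonal.antidiagonal (k + 1), (A.br (w ij.1) (w ij.2)
      - (if ij = (1, k) then A.br (w 1) (w k) else 0)
      - (if ij = (k, 1) then A.br (w 1) (w k) else 0)) ∈ S := by
    refine Submodule.sum_mem _ ?_
    rintro ⟨i, j⟩ hij
    rw [Finset.HasAntidiagonal.mem_antidiagonal] at hij
    simp only at hij
    by_cases h1 : i = 1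
    · obtain rfl : j = k := by omega
      subst h1
      have : ¬ ((1, j) = (j, 1)) := by simp; omega
      simp [this]
    by_cases h2 : j = 1
    · obtain rfl : i = k := by omega
      subst h2
      have : ¬ ((i, 1) = (1, i)) := by simp; omega
      simp only [this, if_false, if_true, odd_symm A w hw 1 i]
      simp
    have n1 : ¬ ((i, j) = (1, k)) := by simp; omega
    have n2 : ¬ ((i, j) = (k, 1)) := by simp; omega
    simp only [n1, n2, if_false, sub_zero]
    by_cases h3 : i = 0
    · simp [h3, h0]
    by_cases h4 : j = 0
    · simp [h4, h0]
    exact Submodule.subset_span ⟨i, j, by omega, by omega, hij, rfl⟩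
  have m1 : (1, k) ∈ Finset.HasAntidiagonal.antidiagonal (k + 1) := by simp; omega
  have m2 : (k, 1) ∈ Finset.HasAntidiagonal.antidiagonal (k + 1) := by simp
  simp only [Finset.sum_sub_distrib, Finset.sum_ite_eq', m1, m2, if_true] at key
  have := S.smul_mem (1 / 2 : ℚ) key
  convert this using 1
  rw [cc]
  module


lemma d_cc
    (A : DGLA) (n : ℕ) (w : ℕ → A.L) (h0 : w 0 = 0) (hbig : ∀ k, n < k → w k = 0)
    (hw : ∀ k : ℕ, w k ∈ A.G (2 * (k : ℤ) - 1))
    (hdw : ∀ k, 1 ≤ k → k ≤ n → A.d (w k) = cc A.toGLA w k)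
    (k : ℕ) (hk : k ≤ n + 1) : A.d (cc A.toGLA w k) = 0 := by
  have hd : ∀ a b, a + b = k → A.br (A.d (w a)) (w b) = - A.br (w b) (cc A.toGLA w a) := by
    intro a b hab
    by_cases hb : b = 0
    · simp [hb, h0]
    by_cases ha : a = 0
    · simp [ha, h0, cc_zero]
    rw [hdw a (by omega) (by omega), A.br_antisymm _ _ _ (hw b) _ (cc_mem _ w hw a),
      Even.neg_one_zpow]
    · simp
    · exact Even.mul_left ⟨(a : ℤ) - 1, by ring⟩ _
  have hd' : ∀ a b, a + b = k → A.br (w a) (A.d (w b)) = A.br (w a) (cc A.toGLA w b) := by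
    intro a b hab
    by_cases ha : a = 0
    · simp [ha, h0]
    by_cases hb : b = 0
    · simp [hb, h0, cc_zero]
    rw [hdw b (by omega) (by omega)]
  have J := jac_sum A.toGLA w hw k
  have J' := J
  rw [← Finset.Nat.sum_antidiagonal_swap] at J'
  rw [cc, map_smul, map_sum]
  have : ∑ x ∈ Finset.HasAntidiagonal.antidiagonal k, A.d (A.br (w x.1) (w x.2)) =
      ∑ x ∈ Finset.HasAntidiagonal.antidiagonal k, (- A.br (w x.2) (cc A.toGLA w x.1)
        - A.br (w x.1) (cc A.toGLA w x.2)) := by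
    refine Finset.sum_congr rfl fun x hx => ?_
    rw [Finset.HasAntidiagonal.mem_antidiagonal] at hx
    rw [A.d_leibniz _ _ (hw _), odd_zpow, hd _ _ hx, hd' _ _ hx]
    module
  rw [this, Finset.sum_sub_distrib, J, Finset.sum_neg_distrib]
  simp only [Prod.fst_swap, Prod.snd_swap] at J'
  rw [J']
  simp

lemma TT_c
    (A : DGLA) (n : ℕ) (w : ℕ → A.L) (h0 : w 0 = 0)
    (k : ℕ) (hk : k ≤ n + 1) : cc A.toGLA w k ∈ TT A.toGLA n w := by
  rcases Nat.lt_or_ge k 2 with h | h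
  · interval_cases k
    · rw [cc_zero _ _ h0]; exact Submodule.zero_mem _
    · rw [cc_one _ _ h0]; exact Submodule.zero_mem _
  · rcases Nat.lt_or_ge n k with h' | h'
    · obtain rfl : k = n + 1 := by omega
      exact KM.u.memTT
    · exact (KM.c k h h').memTT

lemma ad_w1
    (A : DGLA) (n : ℕ) (w : ℕ → A.L) (h0 : w 0 = 0) (hbig : ∀ k, n < k → w k = 0)
    (hw : ∀ k : ℕ, w k ∈ A.G (2 * (k : ℤ) - 1))
    {a : ℕ} {i : ℤ} {x : A.L} (h : KM A.toGLA n w a i x) :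
    A.br (w 1) x ∈ TT A.toGLA n w := by
  have hc : ∀ k, 2 ≤ k → k ≤ n + 1 → A.br (w 1) (cc A.toGLA w k) ∈ TT A.toGLA n w := by
    intro k hk hk'
    have J := jac_sum A.toGLA w hw (k + 1)
    have m : (1, k) ∈ Finset.HasAntidiagonal.antidiagonal (k + 1) := by simp; omega
    rw [← Finset.add_sum_erase _ _ m] at J
    rw [eq_neg_of_add_eq_zero_left J]
    refine Submodule.neg_mem _ (Submodule.sum_mem _ ?_)
    rintro ⟨a, b⟩ hab
    rw [Finset.mem_erase, Finset.HasAntidiagonal.mem_antidiagonal] at hab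
    obtain ⟨hne, hab⟩ := hab
    simp only at hab
    by_cases ha : a = 0
    · simp [ha, h0]
    have ha1 : a ≠ 1 := by
      rintro rfl
      apply hne
      simp; omega
    exact TT_br (KM.b a (by omega)).memTT (TT_c A n w h0 b (by omega))
  induction h with
  | b k hk =>
    rcases Nat.lt_or_ge n k with h' | h'
    · simp [hbig k h']
    · have h1 := cc_split A.toGLA w h0 hw k hk
      have h2 : cc A.toGLA w (k + 1) - A.br (w 1) (w k) ∈ TT A.toGLA n w := by
        refine Submodule.span_le.2 ?_ h1
        rintro x ⟨i, j, hi, hj, -, rfl⟩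
        exact TT_br (KM.b i hi).memTT (KM.b j hj).memTT
      have h3 := Submodule.sub_mem _ (TT_c A n w h0 (k + 1) (by omega)) h2
      simpa using h3
  | c k hk hk' => exact hc k hk (by omega)
  | u =>
    rcases Nat.eq_zero_or_pos n with rfl | hn
    · rw [cc_one _ _ h0]; simp
    · exact hc (n + 1) (by omega) le_rfl
  | br hx hy ihx ihy =>
    rw [ad_leib A.toGLA (hw 1) (hx.deg hw) (hy.deg hw)]
    exact Submodule.add_mem _ (TT_br ihx hy.memTT) (Submodule.smul_mem _ _ (TT_br hx.memTT ihy))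

lemma d_KM
    (A : DGLA) (n : ℕ) (w : ℕ → A.L) (h0 : w 0 = 0) (hbig : ∀ k, n < k → w k = 0)
    (hw : ∀ k : ℕ, w k ∈ A.G (2 * (k : ℤ) - 1))
    (hdw : ∀ k, 1 ≤ k → k ≤ n → A.d (w k) = cc A.toGLA w k)
    {a : ℕ} {i : ℤ} {x : A.L} (h : KM A.toGLA n w a i x) : A.d x ∈ TT A.toGLA n w := by
  induction h with
  | b k hk =>
    rcases Nat.lt_or_ge n k with h' | h'
    · simp [hbig k h']
    · rw [hdw k (by omega) h']
      exact TT_c A n w h0 k (by omega)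
  | c k hk hk' =>
    rw [d_cc A n w h0 hbig hw hdw k (by omega)]
    exact Submodule.zero_mem _
  | u =>
    rw [d_cc A n w h0 hbig hw hdw (n + 1) le_rfl]
    exact Submodule.zero_mem _
  | br hx hy ihx ihy =>
    rw [A.d_leibniz _ _ (hx.deg hw)]
    exact Submodule.add_mem _ (TT_br ihx hy.memTT) (Submodule.smul_mem _ _ (TT_br hx.memTT ihy))

lemma top_eq
    (A : DGLA) (n : ℕ) (hn : 1 ≤ n) (w : ℕ → A.L) (h0 : w 0 = 0) (hbig : ∀ k, n < k → w k = 0)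
    (hw : ∀ k : ℕ, w k ∈ A.G (2 * (k : ℤ) - 1))
    {X : Type} {deg : X → ℤ} {gen : X → A.L} (hf : A.toGLA.IsFreeOn X deg gen)
    (hgen : ∀ x, ∃ k, 1 ≤ k ∧ gen x = w k) (x : A.L) :
    ∃ (q : ℚ), ∃ t ∈ TT A.toGLA n w, x = q • w 1 + t := by
  have key := gen_top A.toGLA hf (insert (w 1) {x | ∃ a i, KM A.toGLA n w a i x}) (by
      rintro y (rfl | ⟨a, i, h⟩)
      · exact ⟨_, hw 1⟩
      · exact ⟨i, h.deg hw⟩) (by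
      have hsub : TT A.toGLA n w ≤
          Submodule.span ℚ (insert (w 1) {x | ∃ a i, KM A.toGLA n w a i x}) :=
        Submodule.span_mono (Set.subset_insert _ _)
      rintro x (rfl | ⟨a, i, hx⟩) y (rfl | ⟨b, j, hy⟩) <;> apply hsub
      · rw [cc_two _ _ h0]
        exact Submodule.smul_mem _ _ (TT_c A n w h0 2 (by omega))
      · exact ad_w1 A n w h0 hbig hw hy
      · rw [A.br_antisymm _ _ _ (hw 1) _ (hx.deg hw)]
        exact Submodule.smul_mem _ _ (ad_w1 A n w h0 hbig hw hx)
      · exact TT_br hx.memTT hy.memTT) (by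
      intro x
      obtain ⟨k, hk, e⟩ := hgen x
      rw [e]
      apply Submodule.subset_span
      rcases Nat.lt_or_ge k 2 with h | h
      · obtain rfl : k = 1 := by omega
        exact Set.mem_insert _ _
      · exact Set.mem_insert_of_mem _ ⟨_, _, KM.b k h⟩)
  have hx : x ∈ Submodule.span ℚ (insert (w 1) {x | ∃ a i, KM A.toGLA n w a i x}) := by
    rw [key]; exact Submodule.mem_top
  rw [Submodule.mem_span_insert] at hx
  exact hx


lemma p_cc
    (A : DGLA) (w : ℕ → A.L) (p : A.L →ₗ[ℚ] ℚ) (hp : ∀ x y, p (A.br x y) = 0)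
    (k : ℕ) : p (cc A.toGLA w k) = 0 := by
  simp [cc, hp]

lemma p_TT
    (A : DGLA) (n : ℕ) (w : ℕ → A.L) (p : A.L →ₗ[ℚ] ℚ) (hpw : ∀ k, k ≠ 1 → p (w k) = 0)
    (hp : ∀ x y, p (A.br x y) = 0)
    {x : A.L} (h : x ∈ TT A.toGLA n w) : p x = 0 := by
  have : TT A.toGLA n w ≤ LinearMap.ker p := by
    refine Submodule.span_le.2 ?_
    rintro x ⟨a, i, h⟩
    induction h with
    | b k hk => exact hpw k (by omega)
    | c k hk hk' => exact p_cc A w p hp k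
    | u => exact p_cc A w p hp _
    | br hx hy ihx ihy => exact hp _ _
  exact this h

/-- Value of a twisted derivation on the quadratic elements. -/
lemma h_cc
    (A : DGLA) (w : ℕ → A.L) (hw : ∀ k : ℕ, w k ∈ A.G (2 * (k : ℤ) - 1)) (p : A.L →ₗ[ℚ] ℚ)
    (hpw1 : p (w 1) = 1) (hpw : ∀ k, k ≠ 1 → p (w k) = 0)
    (h g : A.L →ₗ[ℚ] A.L) (hhw : ∀ k, h (w k) = 0)
    (hh : ∀ i, ∀ x ∈ A.G i, ∀ y, h (A.br x y) = A.br (h x) y + ((-1 : ℚ) ^ i) • A.br x (h y)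
        + p x • g y - (p y * (-1 : ℚ) ^ i) • g x) (k : ℕ) :
    h (cc A.toGLA w (k + 1)) = g (w k) := by
  have hpw' : ∀ k, p (w k) = if k = 1 then 1 else 0 := by
    intro k
    split_ifs with hk
    · rw [hk, hpw1]
    · exact hpw k hk
  rw [cc, map_smul, map_sum]
  have e : ∀ x ∈ Finset.HasAntidiagonal.antidiagonal (k + 1), h (A.br (w x.1) (w x.2)) =
      (if x = (1, k) then g (w k) else 0) + (if x = (k, 1) then g (w k) else 0) := by
    rintro ⟨a, b⟩ hab
    rw [Finset.HasAntidiagonal.mem_antidiagonal] at hab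
    simp only at hab ⊢
    rw [hh _ _ (hw a), hhw, hhw, odd_zpow, hpw', hpw']
    have e1 : ((a, b) = (1, k)) ↔ a = 1 := by simp; omega
    have e2 : ((a, b) = (k, 1)) ↔ b = 1 := by simp; omega
    simp only [e1, e2]
    by_cases ha : a = 1 <;> by_cases hb : b = 1
    · obtain rfl : k = 1 := by omega
      subst ha hb
      simp
    · obtain rfl : k = b := by omega
      simp [ha, hb]
    · obtain rfl : k = a := by omega
      simp [ha, hb]
    · simp [ha, hb]
  rw [Finset.sum_congr rfl e, Finset.sum_add_distrib, Finset.sum_ite_eq', Finset.sum_ite_eq']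
  have m1 : (1, k) ∈ Finset.HasAntidiagonal.antidiagonal (k + 1) := by simp; omega
  have m2 : (k, 1) ∈ Finset.HasAntidiagonal.antidiagonal (k + 1) := by simp
  rw [if_pos m1, if_pos m2]
  module

lemma N_KM
    (A : DGLA) (n : ℕ) (w : ℕ → A.L) (h0 : w 0 = 0) (hbig : ∀ k, n < k → w k = 0)
    (hw : ∀ k : ℕ, w k ∈ A.G (2 * (k : ℤ) - 1))
    (hdw : ∀ k, 1 ≤ k → k ≤ n → A.d (w k) = cc A.toGLA w k) (p : A.L →ₗ[ℚ] ℚ) (hpw1 : p (w 1) = 1)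
    (hpw : ∀ k, k ≠ 1 → p (w k) = 0) (hp : ∀ x y, p (A.br x y) = 0)
    (h g : A.L →ₗ[ℚ] A.L) (hhw : ∀ k, h (w k) = 0) (hgw : ∀ k, 1 ≤ k → g (w k) = w (k + 1))
    (hhd : ∀ i, ∀ x ∈ A.G i, h x ∈ A.G (i + 1))
    (hh : ∀ i, ∀ x ∈ A.G i, ∀ y, h (A.br x y) = A.br (h x) y + ((-1 : ℚ) ^ i) • A.br x (h y)
        + p x • g y - (p y * (-1 : ℚ) ^ i) • g x)
    {a : ℕ} {i : ℤ} {x : A.L} (hx : KM A.toGLA n w a i x) :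
    A.d (h x) + h (A.d x) = (a : ℚ) • x := by
  have hc : ∀ k, 2 ≤ k → h (cc A.toGLA w k) = w k := by
    intro k hk
    obtain ⟨m, rfl⟩ : ∃ m, k = m + 1 := ⟨k - 1, by omega⟩
    rw [h_cc A w hw p hpw1 hpw h g hhw hh, hgw m (by omega)]
  induction hx with
  | b k hk =>
    rcases Nat.lt_or_ge n k with h' | h'
    · simp [hbig k h']
    · rw [hhw, hdw k (by omega) h', hc k hk]
      simp
  | c k hk hk' =>
    rw [hc k hk, d_cc A n w h0 hbig hw hdw k (by omega), hdw k (by omega) hk']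
    simp
  | u =>
    rw [d_cc A n w h0 hbig hw hdw (n + 1) le_rfl]
    rcases Nat.eq_zero_or_pos n with rfl | hn
    · simp [cc_one _ _ h0]
    · rw [hc _ (by omega), hbig (n + 1) (by omega)]
      simp
  | @br a b i j x y hx hy ihx ihy =>
    have px := p_TT A n w p hpw hp hx.memTT
    have py := p_TT A n w p hpw hp hy.memTT
    have pdx := p_TT A n w p hpw hp (d_KM A n w h0 hbig hw hdw hx)
    have pdy := p_TT A n w p hpw hp (d_KM A n w h0 hbig hw hdw hy)
    have gx := hx.deg hw
    have gy := hy.deg hw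
    have e1 := hh i x gx y
    have e2 := A.d_leibniz i x gx y
    have e3 := hh _ _ (A.d_grade i x gx) y
    have e4 := hh i x gx (A.d y)
    have e5 := A.d_leibniz _ _ (hhd i x gx) y
    have e6 := A.d_leibniz i x gx (h y)
    have m1 : (-1 : ℚ) ≠ 0 := by norm_num
    rw [zpow_sub₀ m1] at e3
    rw [zpow_add₀ m1] at e5
    rw [e1, e2]
    simp only [map_add, map_sub, map_smul, e3, e4, e5, e6, px, py, pdx, pdy]
    have ihx' : A.br (A.d (h x)) y + A.br (h (A.d x)) y = (a : ℚ) • A.br x y := by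
      rw [← LinearMap.add_apply, ← map_add, ihx]; simp
    have ihy' : A.br x (A.d (h y)) + A.br x (h (A.d y)) = (b : ℚ) • A.br x y := by
      rw [← map_add, ihy]; simp
    push_cast
    rcases neg_one_zpow_cases i with ⟨-, si⟩ | ⟨-, si⟩ <;> simp only [si] <;>
    linear_combination (norm := module) ihx' + ihy'

lemma KM_zero
    (A : DGLA) (n : ℕ) (w : ℕ → A.L) (hw : ∀ k : ℕ, w k ∈ A.G (2 * (k : ℤ) - 1))
    {a : ℕ} {i : ℤ} {x : A.L} (hx : KM A.toGLA n w a i x) (ha : a = 0) :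
    x ∈ Submodule.span ℚ {cc A.toGLA w (n + 1)} := by
  induction hx with
  | b k hk => omega
  | c k hk hk' => omega
  | u => exact Submodule.mem_span_singleton_self _
  | br hx hy ihx ihy =>
    obtain ⟨r, rfl⟩ := Submodule.mem_span_singleton.1 (ihx (by omega))
    obtain ⟨s, rfl⟩ := Submodule.mem_span_singleton.1 (ihy (by omega))
    have h1 := cc_mem A.toGLA w hw (n + 1)
    have h2 := A.br_antisymm _ _ _ h1 _ h1
    rw [Even.neg_one_zpow (Even.mul_left ⟨((n + 1 : ℕ) : ℤ) - 1, by ring⟩ _)] at h2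
    have h3 : A.br (cc A.toGLA w (n + 1)) (cc A.toGLA w (n + 1)) = 0 := by
      linear_combination (norm := module) (1 / 2 : ℚ) • h2
    simp [h3]


lemma lin_final {M : Type} [AddCommGroup M] [Module ℚ M] (d h : M →ₗ[ℚ] M)
    (hd : ∀ x, d (d x) = 0) (u : M) (hu : d u = 0) (hNu : d (h u) + h (d u) = 0)
    (T : Submodule ℚ M)
    (hT : T ≤ Submodule.span ℚ {u} ⊔
      ⨆ μ : ℚ, ⨆ (_ : μ ≠ 0), Module.End.eigenspace (d ∘ₗ h + h ∘ₗ d : M →ₗ[ℚ] M) μ) :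
    (∀ t ∈ T, d t = 0 → ∃ (r : ℚ) (z : M), t = r • u + d z) ∧
    (∀ t ∈ T, ∀ r : ℚ, r • u = d t → r • u = 0) := by
  set N : Module.End ℚ M := d ∘ₗ h + h ∘ₗ d with hN
  set E : Submodule ℚ M := ⨆ μ : ℚ, ⨆ (_ : μ ≠ 0), Module.End.eigenspace N μ with hE
  have hNx : ∀ x, N x = d (h x) + h (d x) := fun x => rfl
  have hcomm : ∀ x, N (d x) = d (N x) := by
    intro x
    simp [hNx, hd]
  have hdE : ∀ x ∈ E, d x ∈ E := by
    have : E ≤ E.comap d := by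
      refine iSup₂_le fun μ hμ x hx => ?_
      rw [Module.End.mem_eigenspace_iff] at hx
      refine Submodule.mem_iSup_of_mem μ (Submodule.mem_iSup_of_mem hμ ?_)
      rw [Module.End.mem_eigenspace_iff, hcomm, hx, map_smul]
    exact this
  have hNE : ∀ x ∈ E, ∃ z ∈ E, N z = x := by
    have : E ≤ E.map N := by
      refine iSup₂_le fun μ hμ x hx => ?_
      refine ⟨μ⁻¹ • x, Submodule.smul_mem _ _
        (Submodule.mem_iSup_of_mem μ (Submodule.mem_iSup_of_mem hμ hx)), ?_⟩
      rw [Module.End.mem_eigenspace_iff] at hx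
      rw [map_smul, hx, smul_smul, inv_mul_cancel₀ hμ, one_smul]
    intro x hx
    obtain ⟨z, hz, e⟩ := this hx
    exact ⟨z, hz, e⟩
  have hker : ∀ x ∈ E, N x = 0 → x = 0 := by
    intro x hx h0
    have := N.eigenspaces_iSupIndep 0
    refine (Submodule.disjoint_def.1 this) x ?_ hx
    rw [Module.End.mem_eigenspace_iff, h0, zero_smul]
  have hNu' : N u = 0 := hNu
  constructor
  · intro t ht hdt
    obtain ⟨a, ha, x, hx, rfl⟩ := Submodule.mem_sup.1 (hT ht)
    obtain ⟨r, rfl⟩ := Submodule.mem_span_singleton.1 ha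
    obtain ⟨z, hz, rfl⟩ := hNE x hx
    have h1 : d (N z) = 0 := by simpa [hu] using hdt
    have h2 : d z = 0 := hker _ (hdE z hz) (by rw [hcomm, h1])
    exact ⟨r, h z, by rw [hNx, h2, map_zero, add_zero]⟩
  · intro t ht r hr
    obtain ⟨a, ha, x, hx, rfl⟩ := Submodule.mem_sup.1 (hT ht)
    obtain ⟨s, rfl⟩ := Submodule.mem_span_singleton.1 ha
    have h1 : r • u = d x := by simpa [hu] using hr
    refine hker _ ?_ (by rw [map_smul, hNu', smul_zero])
    rw [h1]
    exact hdE x hx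

theorem core_final (n : ℕ) (hn : 1 ≤ n)
    (A : DGLA) (w : ℕ → A.L)
    (hfree : A.toGLA.IsFreeOn {k : ℕ // 1 ≤ k ∧ k ≤ n}
      (fun k => 2 * (k : ℤ) - 1) (fun k => w k))
    (h0 : w 0 = 0) (hbig : ∀ k, n < k → w k = 0)
    (hdw : ∀ k, 1 ≤ k → k ≤ n → A.d (w k) = cc A.toGLA w k) :
    cc A.toGLA w (n + 1) ∈ A.G (2 * n) ∧ A.d (cc A.toGLA w (n + 1)) = 0 ∧
    (∀ x : A.L, A.d x = 0 → ∃ (q r : ℚ) (z : A.L),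
      x = q • w 1 + r • cc A.toGLA w (n + 1) + A.d z) ∧
    (∀ (q r : ℚ) (z : A.L), q • w 1 + r • cc A.toGLA w (n + 1) = A.d z → q = 0 ∧ r = 0) := by
  have hcase : ∀ k, (1 ≤ k ∧ k ≤ n) ∨ w k = 0 := by
    intro k
    rcases Nat.lt_or_ge n k with h | h
    · exact Or.inr (hbig k h)
    · rcases Nat.eq_zero_or_pos k with rfl | h'
      · exact Or.inr h0
      · exact Or.inl ⟨h', h⟩
  have hw : ∀ k : ℕ, w k ∈ A.G (2 * (k : ℤ) - 1) := by
    intro k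
    rcases hcase k with h | h
    · exact hfree.1 ⟨k, h⟩
    · rw [h]; exact Submodule.zero_mem _
  obtain ⟨p, hpw1, hpw', hp, hp1⟩ := exists_p A.toGLA hfree ⟨1, le_rfl, hn⟩ (by norm_num)
  have hpw1 : p (w 1) = 1 := hpw1
  have hpw : ∀ k, k ≠ 1 → p (w k) = 0 := by
    intro k hk
    rcases hcase k with h | h
    · exact hpw' ⟨k, h⟩ (fun e => hk (congrArg Subtype.val e))
    · rw [h, map_zero]
  obtain ⟨h, g, hhw', hgw', hhd, hh⟩ := exists_h A.toGLA hfree p hp hp1 1 odd_one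
    (fun k => w (k + 1)) (by
      intro k
      have := hw (k + 1)
      convert this using 2
      push_cast; ring)
  have hhw : ∀ k, h (w k) = 0 := by
    intro k
    rcases hcase k with hk | hk
    · exact hhw' ⟨k, hk⟩
    · rw [hk, map_zero]
  have hgw : ∀ k, 1 ≤ k → g (w k) = w (k + 1) := by
    intro k hk1
    rcases Nat.lt_or_ge n k with h' | h'
    · rw [hbig k h', hbig (k + 1) (by omega), map_zero]
    · exact hgw' ⟨k, hk1, h'⟩
  have hu0 : cc A.toGLA w (n + 1) ≠ 0 := by
    obtain ⟨h', g', hhw2, hgw2, -, hh2⟩ := exists_h A.toGLA hfree p hp hp1 (1 - 2 * (n : ℤ))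
      ⟨-(n : ℤ), by ring⟩ (fun k => if (k : ℕ) = n then w 1 else 0) (by
        rintro ⟨k, hk⟩
        simp only
        split_ifs with hkn
        · have := hw 1
          convert this using 2
          rw [hkn]; push_cast; ring
        · exact Submodule.zero_mem _)
    intro hu
    have e := h_cc A w hw p hpw1 hpw h' g' (by
      intro k
      rcases hcase k with hk | hk
      · exact hhw2 ⟨k, hk⟩
      · rw [hk, map_zero]) hh2 n
    have e2 : g' (w n) = w 1 := (hgw2 ⟨n, hn, le_rfl⟩).trans (if_pos rfl)
    rw [hu, map_zero, e2] at e
    rw [← e, map_zero] at hpw1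
    norm_num at hpw1
  have hdu := d_cc A n w h0 hbig hw hdw (n + 1) le_rfl
  have hNK := fun {a : ℕ} {i : ℤ} {x : A.L} (hx : KM A.toGLA n w a i x) =>
    N_KM A n w h0 hbig hw hdw p hpw1 hpw hp h g hhw hgw hhd hh hx
  have hT : TT A.toGLA n w ≤ Submodule.span ℚ {cc A.toGLA w (n + 1)} ⊔
      ⨆ μ : ℚ, ⨆ (_ : μ ≠ 0), Module.End.eigenspace (A.d ∘ₗ h + h ∘ₗ A.d : A.L →ₗ[ℚ] A.L) μ := by
    refine Submodule.span_le.2 ?_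
    rintro x ⟨a, i, hx⟩
    rcases Nat.eq_zero_or_pos a with ha | ha
    · exact Submodule.mem_sup_left (KM_zero A n w hw hx ha)
    · refine Submodule.mem_sup_right (Submodule.mem_iSup_of_mem (a : ℚ)
        (Submodule.mem_iSup_of_mem (by positivity) ?_))
      rw [Module.End.mem_eigenspace_iff]
      exact hNK hx
  obtain ⟨f1, f2⟩ := lin_final A.d h A.d_sq _ hdu (by rw [hNK KM.u]; simp) _ hT
  have hdw1 : A.d (w 1) = 0 := by rw [hdw 1 le_rfl hn, cc_one _ _ h0]
  have htop := top_eq A n hn w h0 hbig hw hfree (fun k => ⟨k, k.2.1, rfl⟩)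
  have hdT : ∀ t ∈ TT A.toGLA n w, A.d t ∈ TT A.toGLA n w := by
    have : TT A.toGLA n w ≤ (TT A.toGLA n w).comap A.d := by
      refine Submodule.span_le.2 ?_
      rintro x ⟨a, i, hx⟩
      exact d_KM A n w h0 hbig hw hdw hx
    exact this
  refine ⟨?_, hdu, ?_, ?_⟩
  · have := cc_mem A.toGLA w hw (n + 1)
    convert this using 2
    push_cast; ring
  · intro x hx
    obtain ⟨q, t, ht, rfl⟩ := htop x
    obtain ⟨r, z, e⟩ := f1 t ht (by simpa [hdw1] using hx)
    exact ⟨q, r, z, by rw [e, add_assoc]⟩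
  · intro q r z hz
    obtain ⟨a, t, ht, rfl⟩ := htop z
    rw [map_add, map_smul, hdw1, smul_zero, zero_add] at hz
    have hq : q = 0 := by
      have := congrArg p hz
      rw [p_TT A n w p hpw hp (hdT t ht), map_add, map_smul, map_smul, hpw1,
        p_cc A w p hp] at this
      simpa using this
    refine ⟨hq, ?_⟩
    rw [hq, zero_smul, zero_add] at hz
    have := f2 t ht r hz
    exact (smul_eq_zero.1 this).resolve_right hu0

end CPn

/-- In the cellular Lie model of ℂPⁿ, the free graded Lie algebra
𝕃⟨v₁,…,v_n⟩ over ℚ with |v_k| = 2k − 1 and d v_k = ½ Σ_{i+j=k} [v_i, v_j], there is a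
cycle u_n of degree 2n equal to [v₁, v_n] modulo brackets [v_i, v_j] with i, j ≥ 2, and
the homology is one-dimensional in degrees 1 and 2n (spanned by [v₁] and [u_n]) and zero
in all other degrees. -/
theorem stmt16 (nn : ℕ) (hnn : 1 ≤ nn)
    (A : DGLA) (v : ℕ → A.L)
    (hfree : A.toGLA.IsFreeOn {k : ℕ // 1 ≤ k ∧ k ≤ nn}
      (fun k => 2 * (k : ℤ) - 1) (fun k => v k))
    (hdv : ∀ k : ℕ, 1 ≤ k → k ≤ nn →
      A.d (v k) = (1 / 2 : ℚ) • ∑ i ∈ Finset.Ioo 0 k, A.br (v i) (v (k - i))) :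
    ∃ u : A.L,
      -- u_n is a cycle of degree 2n
      u ∈ A.G (2 * nn) ∧ A.d u = 0 ∧
      -- u_n = [v₁, v_n] modulo decomposables from lower stages
      u - A.br (v 1) (v nn) ∈ Submodule.span ℚ
        {x : A.L | ∃ i j : ℕ, 2 ≤ i ∧ 2 ≤ j ∧ i + j = nn + 1 ∧ x = A.br (v i) (v j)} ∧
      -- every homogeneous cycle is homologous to q • v₁ + r • u
      (∀ m : ℤ, ∀ x ∈ A.G m, A.d x = 0 →
        ∃ (q r : ℚ) (z : A.L), x = q • v 1 + r • u + A.d z) ∧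
      -- the classes [v₁] (degree 1) and [u] (degree 2n) are independent in homology
      (∀ (q r : ℚ) (z : A.L), q • v 1 + r • u = A.d z → q = 0 ∧ r = 0) := by
    classical
  set w : ℕ → A.L := fun k => if 1 ≤ k ∧ k ≤ nn then v k else 0 with hwdef
  have hwv : ∀ k, 1 ≤ k → k ≤ nn → w k = v k := fun k h1 h2 => if_pos ⟨h1, h2⟩
  have h0 : w 0 = 0 := if_neg (by omega)
  have hbig : ∀ k, nn < k → w k = 0 := fun k hk => if_neg (by omega)
  have hgen : (fun k : {k : ℕ // 1 ≤ k ∧ k ≤ nn} => w k) =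
      fun k : {k : ℕ // 1 ≤ k ∧ k ≤ nn} => v k := by
    funext k
    exact hwv k k.2.1 k.2.2
  have hfree' : A.toGLA.IsFreeOn {k : ℕ // 1 ≤ k ∧ k ≤ nn}
      (fun k => 2 * (k : ℤ) - 1) (fun k => w k) := by
    rw [hgen]; exact hfree
  have hdw : ∀ k, 1 ≤ k → k ≤ nn → A.d (w k) = CPn.cc A.toGLA w k := by
    intro k h1 h2
    rw [hwv k h1 h2, hdv k h1 h2, CPn.cc]
    congr 1
    rw [Finset.Nat.sum_antidiagonal_eq_sum_range_succ_mk]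
    have hsub : Finset.Ioo 0 k ⊆ Finset.range k.succ := by
      intro i hi
      rw [Finset.mem_Ioo] at hi
      rw [Finset.mem_range]
      omega
    rw [← Finset.sum_subset hsub]
    · refine Finset.sum_congr rfl fun i hi => ?_
      rw [Finset.mem_Ioo] at hi
      rw [hwv i (by omega) (by omega), hwv (k - i) (by omega) (by omega)]
    · intro i hi hi'
      rw [Finset.mem_Ioo] at hi'
      rw [Finset.mem_range] at hi
      rcases Nat.eq_zero_or_pos i with rfl | hpos
      · simp [h0]
      · obtain rfl : i = k := by omega
        simp [h0]
  obtain ⟨c1, c2, c3, c4⟩ := CPn.core_final nn hnn A w hfree' h0 hbig hdw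
  have hw1 : w 1 = v 1 := hwv 1 le_rfl hnn
  rw [hw1] at c3 c4
  have hw : ∀ k : ℕ, w k ∈ A.G (2 * (k : ℤ) - 1) := by
    intro k
    by_cases h : 1 ≤ k ∧ k ≤ nn
    · exact hfree'.1 ⟨k, h⟩
    · have : w k = 0 := if_neg h
      rw [this]; exact Submodule.zero_mem _
  obtain ⟨c, hc, hspan⟩ : ∃ c : ℚ, c ≠ 0 ∧ c • CPn.cc A.toGLA w (nn + 1) - A.br (v 1) (v nn) ∈
      Submodule.span ℚ
        {x : A.L | ∃ i j : ℕ, 2 ≤ i ∧ 2 ≤ j ∧ i + j = nn + 1 ∧ x = A.br (v i) (v j)} := by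
    rcases Nat.eq_or_lt_of_le hnn with h1 | h1
    · refine ⟨2, by norm_num, ?_⟩
      subst h1
      rw [← hw1, CPn.cc_two _ _ h0, sub_self]
      exact Submodule.zero_mem _
    · refine ⟨1, one_ne_zero, ?_⟩
      have := CPn.cc_split A.toGLA w h0 hw nn h1
      rw [hw1, hwv nn hnn le_rfl] at this
      rw [one_smul]
      refine Submodule.span_mono ?_ this
      rintro x ⟨i, j, hi, hj, hij, rfl⟩
      refine ⟨i, j, hi, hj, hij, ?_⟩
      rw [hwv i (by omega) (by omega), hwv j (by omega) (by omega)]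
  refine ⟨c • CPn.cc A.toGLA w (nn + 1), Submodule.smul_mem _ _ c1, by rw [map_smul, c2, smul_zero],
    hspan, ?_, ?_⟩
  · intro m x _ hx
    obtain ⟨q, r, z, e⟩ := c3 x hx
    refine ⟨q, r * c⁻¹, z, ?_⟩
    rw [smul_smul, mul_assoc, inv_mul_cancel₀ hc, mul_one]
    exact e
  · intro q r z hz
    rw [smul_smul] at hz
    obtain ⟨hq, hr⟩ := c4 q (r * c) z hz
    exact ⟨hq, (mul_eq_zero.1 hr).resolve_right hc⟩
end
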